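/- Let (R, 𝔪) be a Cohen–Macaulay Noetherian local ring of dimension d > 0 with R/𝔪 infinite, and let I be a proper ideal that satisfies G_d and is weakly (d−2)-residually S_2. Then for general elements a_1, …, a_{d−1}, a_d of I one has j(I) = length_R( R / ( ((a_1, …, a_{d−1}) :_R I) + a_d R ) ). -/

import Mathlib

open Filter

noncomputable section

/-- The length of a module, as the height of `⊤` in the submodule lattice. -/
def mLength (R M : Type*) [CommRing R] [AddCommGroup M] [Module R M] : ℕ∞ :=
  Order.height (⊤ : Submodule R M)

/-- The Krull dimension of a module, via the annihilator. -/
def mDim (R M : Type*) [CommRing R] [AddCommGroup M] [Module R M] : WithBot ℕ∞ :=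
  ringKrullDim (R ⧸ Module.annihilator R M)

/-- `H⁰_I(N)`: elements killed by a power of `I` (0-th local cohomology). -/
def H0 {R : Type*} [CommRing R] (I : Ideal R) (N : Type*) [AddCommGroup N] [Module R N] :
    Submodule R N :=
  ⨆ n : ℕ, Submodule.torsionBySet R N ((I ^ n : Ideal R) : Set R)

/-- `IⁿM/I^{n+1}M`, as a submodule of `M/I^{n+1}M`. -/
def gradedPiece {R : Type*} [CommRing R] (I : Ideal R) {M : Type*} [AddCommGroup M]
    [Module R M] (n : ℕ) : Submodule R (M ⧸ (I ^ (n + 1) • ⊤ : Submodule R M)) :=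
  Submodule.map (I ^ (n + 1) • ⊤ : Submodule R M).mkQ (I ^ n • ⊤ : Submodule R M)

/-- The `j`-multiplicity `j_d(I, M)`, defined as
`lim_n (d−1)!/n^(d−1) · length_R (H⁰_𝔪(IⁿM/I^{n+1}M))`. -/
def jMult {R : Type*} [CommRing R] (𝔪 I : Ideal R) (M : Type*) [AddCommGroup M]
    [Module R M] (d : ℕ) : ℝ :=
  limUnder atTop fun n : ℕ =>
    ((d - 1).factorial : ℝ) / (n : ℝ) ^ (d - 1) *
      ((mLength R (H0 𝔪 (gradedPiece I (M := M) n))).toNat : ℝ)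

/-- The Hilbert–Samuel multiplicity `e(I; N)` of a `d`-dimensional module `N`
(equal to `0` if `N = 0`), defined as `lim_n d!/n^d · length_R (N/IⁿN)`. -/
def hsMult {R : Type*} [CommRing R] (I : Ideal R) (N : Type*) [AddCommGroup N]
    [Module R N] (d : ℕ) : ℝ :=
  limUnder atTop fun n : ℕ =>
    (d.factorial : ℝ) / (n : ℝ) ^ d *
      ((mLength R (N ⧸ (I ^ n • ⊤ : Submodule R N))).toNat : ℝ)

/-- `K :_M I^∞ = ⋃ₙ (K :_M Iⁿ)`. -/
def satur {R : Type*} [CommRing R] (I : Ideal R) {M : Type*} [AddCommGroup M] [Module R M]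
    (K : Submodule R M) : Submodule R M :=
  Submodule.comap K.mkQ (H0 I (M ⧸ K))

/-- "For general elements `a₁, …, aᵢ` of `I`", i.e. for all `i`-tuples of elements of `I`
whose coefficient vectors with respect to any finite generating set of `I` avoid the zero
locus of some nonzero polynomial over the residue field `R/𝔪` (equivalently, whose images
lie in a suitable nonempty Zariski-open set of choices modulo `𝔪I`), property `P` holds. -/
def GeneralElts {R : Type*} [CommRing R] (𝔪 I : Ideal R) (i : ℕ)
    (P : (Fin i → R) → Prop) : Prop :=
  ∀ (m : ℕ) (x : Fin m → R), Ideal.span (Set.range x) = I →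
    ∃ F : MvPolynomial (Fin i × Fin m) R,
      MvPolynomial.map (Ideal.Quotient.mk 𝔪) F ≠ 0 ∧
      ∀ c : Fin i × Fin m → R,
        MvPolynomial.eval (fun p => Ideal.Quotient.mk 𝔪 (c p))
          (MvPolynomial.map (Ideal.Quotient.mk 𝔪) F) ≠ 0 →
        P fun j => ∑ l, c (j, l) * x l

/-- The height of an ideal: the infimum of the heights of the primes containing it. -/
def idealHeight {R : Type*} [CommRing R] (J : Ideal R) : ℕ∞ :=
  ⨅ (p : PrimeSpectrum R) (_ : J ≤ p.asIdeal), Order.height p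

/-- The minimal number of generators of an ideal. -/
def mu {A : Type*} [CommRing A] (J : Ideal A) : ℕ∞ :=
  sInf ((fun s : Finset A => (s.card : ℕ∞)) '' {s | Ideal.span (s : Set A) = J})

/-- The condition `G_s`: `μ(I_𝔭) ≤ ht 𝔭` for every prime `𝔭 ⊇ I` with `ht 𝔭 < s`. -/
def SatisfiesG {R : Type*} [CommRing R] (I : Ideal R) (s : ℕ) : Prop :=
  ∀ p : PrimeSpectrum R, I ≤ p.asIdeal → Order.height p < (s : ℕ∞) →
    mu (Ideal.map (algebraMap R (Localization.AtPrime p.asIdeal)) I) ≤ Order.height p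

/-- A Noetherian local ring is Cohen–Macaulay iff its maximal ideal contains a regular
sequence whose length is the Krull dimension. -/
def IsCMLocalRing (A : Type*) [CommRing A] [IsLocalRing A] : Prop :=
  ∃ rs : List A, (∀ x ∈ rs, x ∈ IsLocalRing.maximalIdeal A) ∧
    RingTheory.Sequence.IsRegular A rs ∧ ((rs.length : ℕ∞) : WithBot ℕ∞) = ringKrullDim A

/-- Serre's condition `S_2` for a Noetherian ring: `depth A_𝔭 ≥ min (2, dim A_𝔭)` for every
prime `𝔭`, expressed via existence of regular sequences in the maximal ideal of `A_𝔭`. -/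
def SerreS2 (A : Type*) [CommRing A] : Prop :=
  ∀ p : PrimeSpectrum A, ∀ n : ℕ,
    ((n : ℕ∞) : WithBot ℕ∞) ≤
        min (2 : WithBot ℕ∞) (ringKrullDim (Localization.AtPrime p.asIdeal)) →
      ∃ rs : List (Localization.AtPrime p.asIdeal), rs.length = n ∧
        (∀ x ∈ rs, x ∈ IsLocalRing.maximalIdeal (Localization.AtPrime p.asIdeal)) ∧
        RingTheory.Sequence.IsRegular (Localization.AtPrime p.asIdeal) rs

/-- `I` is weakly `s`-residually `S_2`: for every `ht I ≤ i ≤ s` and every geometric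
`i`-residual intersection `K = 𝔞 :_R I` of `I` (with `𝔞 ⊆ I` generated by `i` elements,
`ht K ≥ i` and `ht (I + K) ≥ i + 1`), the ring `R/K` satisfies `S_2`. -/
def WeaklyResiduallyS2 {R : Type*} [CommRing R] (I : Ideal R) (s : ℕ) : Prop :=
  ∀ i : ℕ, idealHeight I ≤ (i : ℕ∞) → i ≤ s →
    ∀ 𝔞 : Ideal R, (∃ x : Fin i → R, Ideal.span (Set.range x) = 𝔞) → 𝔞 ≤ I →
      (i : ℕ∞) ≤ idealHeight (Submodule.colon 𝔞 I) →
      ((i : ℕ∞) + 1) ≤ idealHeight (I ⊔ Submodule.colon 𝔞 I) →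
      SerreS2 (R ⧸ Submodule.colon 𝔞 I)

/-- The length of `B / (A ⊓ B)` for two ideals `A`, `B`. -/
noncomputable def relLen {R : Type*} [CommRing R] (A B : Ideal R) : ℕ∞ :=
  Module.length R (↥B ⧸ Submodule.submoduleOf A B)

namespace relLen

variable {R : Type*} [CommRing R]

theorem eq_of_surjective {M : Type*} [AddCommGroup M] [Module R M] {A B : Ideal R}
    (φ : ↥B →ₗ[R] M) (hφ : Function.Surjective φ) (hk : ∀ u : ↥B, φ u = 0 ↔ (u : R) ∈ A) :
    Module.length R M = relLen A B := by
  have : LinearMap.ker φ = Submodule.submoduleOf A B := by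
    ext u; simp [Submodule.submoduleOf, hk]
  exact (((Submodule.quotEquivOfEq _ _ this.symm).trans
    (φ.quotKerEquivOfSurjective hφ)).length_eq).symm

theorem eq_zero_iff {A B : Ideal R} : relLen A B = 0 ↔ B ≤ A := by
  rw [relLen, Module.length_eq_zero_iff, Submodule.Quotient.subsingleton_iff,
    Submodule.submoduleOf_eq_top]

theorem add {A B C : Ideal R} (hAB : A ≤ B) (hBC : B ≤ C) :
    relLen A C = relLen A B + relLen B C := by
  let f : (↥B ⧸ Submodule.submoduleOf A B) →ₗ[R] (↥C ⧸ Submodule.submoduleOf A C) :=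
    Submodule.mapQ _ _ (Submodule.inclusion hBC) (fun u hu => hu)
  let g : (↥C ⧸ Submodule.submoduleOf A C) →ₗ[R] (↥C ⧸ Submodule.submoduleOf B C) :=
    Submodule.mapQ _ _ LinearMap.id (fun u hu => hAB hu)
  refine Module.length_eq_add_of_exact f g ?_ ?_ ?_
  · rw [← LinearMap.ker_eq_bot, LinearMap.ker_eq_bot']
    intro u hu
    induction u using Submodule.Quotient.induction_on with
    | _ u =>
      have hu' := (Submodule.Quotient.mk_eq_zero _).1 hu
      rw [Submodule.Quotient.mk_eq_zero]; exact hu'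
  · intro u
    induction u using Submodule.Quotient.induction_on with
    | _ u => exact ⟨Submodule.Quotient.mk u, rfl⟩
  · intro u
    induction u using Submodule.Quotient.induction_on with
    | _ u =>
      constructor
      · intro h
        have h' : (u : R) ∈ B := (Submodule.Quotient.mk_eq_zero (Submodule.submoduleOf B C)).1 h
        exact ⟨Submodule.Quotient.mk ⟨u, h'⟩, rfl⟩
      · rintro ⟨v, hv⟩
        induction v using Submodule.Quotient.induction_on with
        | _ v =>
          have := (Submodule.Quotient.eq _).1 hv
          have h2 : ((v : R) - u) ∈ A := this
          have h3 := B.sub_mem v.2 (hAB h2)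
          refine (Submodule.Quotient.mk_eq_zero _).2 ?_
          change (u : R) ∈ B
          simpa using h3

theorem sup_right (A B : Ideal R) : relLen A (A ⊔ B) = relLen A B := by
  let f : ↥B →ₗ[R] (↥(A ⊔ B) ⧸ Submodule.submoduleOf A (A ⊔ B)) :=
    (Submodule.mkQ _).comp (Submodule.inclusion le_sup_right)
  refine eq_of_surjective f ?_ ?_
  · intro u
    induction u using Submodule.Quotient.induction_on with
    | _ u =>
      obtain ⟨x, hx, y, hy, hxy⟩ := Submodule.mem_sup.1 u.2
      refine ⟨⟨y, hy⟩, ?_⟩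
      refine (Submodule.Quotient.eq _).2 ?_
      change y - (u : R) ∈ A
      rw [← hxy]; simpa using hx
  · intro u
    exact Submodule.Quotient.mk_eq_zero _

theorem inf_left (A B : Ideal R) : relLen (A ⊓ B) B = relLen A B := by
  symm
  refine eq_of_surjective (Submodule.mkQ (Submodule.submoduleOf (A ⊓ B) B))
    (Submodule.mkQ_surjective _) ?_ |>.symm
  intro u
  rw [Submodule.mkQ_apply, Submodule.Quotient.mk_eq_zero]
  exact ⟨fun h => h.1, fun h => ⟨h, u.2⟩⟩

theorem mul_left_le {A B A' : Ideal R} (a : R)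
    (h : ∀ u ∈ B, a * u ∈ A' ↔ u ∈ A) :
    relLen A' (Ideal.span {a} * B) = relLen A B := by
  let f : ↥B →ₗ[R] (↥(Ideal.span {a} * B) ⧸ Submodule.submoduleOf A' (Ideal.span {a} * B)) :=
    (Submodule.mkQ _).comp ((LinearMap.mulLeft R a).restrict
      (fun u hu => Ideal.mul_mem_mul (Ideal.mem_span_singleton_self a) hu))
  refine eq_of_surjective f ?_ ?_
  · intro u
    induction u using Submodule.Quotient.induction_on with
    | _ u =>
      obtain ⟨v, hv, hvu⟩ := Ideal.mem_span_singleton_mul.1 u.2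
      exact ⟨⟨v, hv⟩, congrArg (Submodule.mkQ _) (Subtype.ext hvu)⟩
  · intro u
    exact (Submodule.Quotient.mk_eq_zero _).trans (h u u.2)

theorem top_right (A : Ideal R) : Module.length R (R ⧸ A) = relLen A ⊤ := by
  refine eq_of_surjective ((Submodule.mkQ A).comp (Submodule.subtype ⊤)) ?_ ?_
  · intro u
    obtain ⟨v, rfl⟩ := Submodule.mkQ_surjective _ u
    exact ⟨⟨v, trivial⟩, rfl⟩
  · intro u
    exact Submodule.Quotient.mk_eq_zero _

theorem mono_right {A B C : Ideal R} (h : B ≤ C) : relLen A B ≤ relLen A C := by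
  rw [← sup_right A B, ← sup_right A C,
    add (A := A) (B := A ⊔ B) (C := A ⊔ C) le_sup_left (sup_le_sup_left h _)]
  exact le_self_add

theorem anti_left {A A' B : Ideal R} (h : A ≤ A') : relLen A' B ≤ relLen A B := by
  rw [← inf_left A B, ← inf_left A' B,
    add (A := A ⊓ B) (B := A' ⊓ B) (C := B) (inf_le_inf_right _ h) inf_le_right]
  exact le_add_self

theorem le_add (A B C : Ideal R) : relLen A C ≤ relLen A B + relLen B C := by
  have h1 : relLen A C ≤ relLen A (A ⊔ B ⊔ C) := mono_right le_sup_right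
  rw [add (A := A) (B := A ⊔ B) le_sup_left le_sup_left, sup_right, sup_right] at h1
  exact h1.trans (add_le_add le_rfl (anti_left le_sup_right))

theorem le_sup_of_eq {A B C : Ideal R} (hBC : B ≤ C) (h : relLen A B = relLen A C)
    (hfin : relLen A C ≠ ⊤) : C ≤ A ⊔ B := by
  have h1 := add (A := A) (B := A ⊔ B) (C := A ⊔ C) le_sup_left (sup_le_sup_left hBC _)
  rw [sup_right, sup_right, h] at h1
  have h2 : relLen (A ⊔ B) (A ⊔ C) = 0 := by
    have : relLen A C + 0 = relLen A C + relLen (A ⊔ B) (A ⊔ C) := by rw [add_zero]; exact h1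
    exact le_antisymm ((ENat.add_le_add_iff_left hfin).1 this.ge) bot_le
  exact le_sup_right.trans (eq_zero_iff.1 h2)

theorem congr_left {A A' B : Ideal R} (h : A ⊓ B = A' ⊓ B) : relLen A B = relLen A' B := by
  rw [← inf_left A B, h, inf_left]

theorem congr_right {A B B' : Ideal R} (h : A ⊔ B = A ⊔ B') : relLen A B = relLen A B' := by
  rw [← sup_right A B, h, sup_right]

variable [IsLocalRing R]

theorem span_singleton_le_one {A : Ideal R} {b : R}
    (h : ∀ x ∈ IsLocalRing.maximalIdeal R, x * b ∈ A) : relLen A (Ideal.span {b}) ≤ 1 := by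
  let f : R →ₗ[R] (↥(Ideal.span {b}) ⧸ Submodule.submoduleOf A (Ideal.span {b})) :=
    (Submodule.mkQ _).comp ((LinearMap.toSpanSingleton R R b).codRestrict _
      (fun u => Ideal.mul_mem_left _ u (Ideal.mem_span_singleton_self b)))
  have hf : Function.Surjective f := by
    intro u
    induction u using Submodule.Quotient.induction_on with
    | _ u =>
      obtain ⟨v, hv⟩ := Ideal.mem_span_singleton'.1 u.2
      exact ⟨v, congrArg _ (Subtype.ext hv)⟩
  have hle : IsLocalRing.maximalIdeal R ≤ LinearMap.ker f := by
    intro x hx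
    exact (Submodule.Quotient.mk_eq_zero _).2 (h x hx)
  have h1 : Module.length R (R ⧸ IsLocalRing.maximalIdeal R) = 1 := by
    rw [Module.length_eq_one_iff, isSimpleModule_iff_isCoatom, ← Ideal.isMaximal_def]
    infer_instance
  rw [relLen, ← h1]
  exact Module.length_le_of_surjective (Submodule.liftQ _ f hle) (fun u => by
    obtain ⟨v, hv⟩ := hf u
    exact ⟨Submodule.Quotient.mk v, hv⟩)

theorem span_singleton_eq_one {A : Ideal R} {b : R}
    (h : ∀ x ∈ IsLocalRing.maximalIdeal R, x * b ∈ A) (hb : b ∉ A) :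
    relLen A (Ideal.span {b}) = 1 := by
  refine le_antisymm (span_singleton_le_one h) ?_
  rw [Order.one_le_iff_pos, pos_iff_ne_zero, Ne, eq_zero_iff]
  exact fun h => hb (h (Ideal.mem_span_singleton_self b))

theorem exists_socle {A B : Ideal R} {N : ℕ} (hN : IsLocalRing.maximalIdeal R ^ N * B ≤ A)
    (hBA : ¬ B ≤ A) :
    ∃ b ∈ B, b ∉ A ∧ ∀ x ∈ IsLocalRing.maximalIdeal R, x * b ∈ A := by
  induction N with
  | zero => exact absurd (by simpa using hN) hBA
  | succ N ih =>
    by_cases h : IsLocalRing.maximalIdeal R ^ N * B ≤ A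
    · exact ih h
    · obtain ⟨b, hb, hbA⟩ := Set.not_subset.1 h
      refine ⟨b, Ideal.mul_le_right hb, hbA, fun x hx => hN ?_⟩
      rw [pow_succ', mul_assoc]
      exact Ideal.mul_mem_mul hx hb

theorem ne_top_of_pow_mul_le [IsNoetherianRing R] {A B : Ideal R} {N : ℕ}
    (hN : IsLocalRing.maximalIdeal R ^ N * B ≤ A) : relLen A B ≠ ⊤ := by
  induction A using WellFoundedGT.induction with
  | _ A ih =>
    by_cases hBA : B ≤ A
    · rw [eq_zero_iff.2 hBA]; exact ENat.zero_ne_top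
    · obtain ⟨b, hb, hbA, hm⟩ := exists_socle hN hBA
      have h1 := ih (A ⊔ Ideal.span {b})
        (lt_of_le_of_ne le_sup_left (fun h => hbA (by
          rw [h]; exact Ideal.mem_sup_right (Ideal.mem_span_singleton_self b))))
        (hN.trans le_sup_left)
      have h2 := le_add A (A ⊔ Ideal.span {b}) B
      rw [sup_right, span_singleton_eq_one hm hbA] at h2
      exact ne_top_of_le_ne_top (WithTop.add_ne_top.2 ⟨ENat.one_ne_top, h1⟩) h2

/-- A finite relative length bounds the power of the maximal ideal killing the quotient. -/
theorem exists_pow_mul_le [IsNoetherianRing R] {A B : Ideal R} (hAB : A ≤ B)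
    (h : relLen A B ≠ ⊤) : ∃ N, IsLocalRing.maximalIdeal R ^ N * B ≤ A := by
  have key : ∀ n : ℕ, ∀ B : Ideal R, A ≤ B → relLen A B ≤ n →
      ∃ N, IsLocalRing.maximalIdeal R ^ N * B ≤ A := by
    intro n
    induction n with
    | zero =>
      intro B hAB h
      exact ⟨0, by simpa using eq_zero_iff.1 (le_antisymm (by simpa using h) bot_le)⟩
    | succ n ih =>
      intro B hAB h
      by_cases hBA : B ≤ A
      · exact ⟨0, by simpa using hBA⟩
      have hlt : A ⊔ IsLocalRing.maximalIdeal R * B ≤ B := sup_le hAB Ideal.mul_le_right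
      have hne : ¬ B ≤ A ⊔ IsLocalRing.maximalIdeal R * B := by
        intro hle
        exact hBA (Submodule.le_of_le_smul_of_le_jacobson_bot (IsNoetherian.noetherian B)
          (IsLocalRing.maximalIdeal_le_jacobson _) hle)
      have h1 := add (A := A) (B := A ⊔ IsLocalRing.maximalIdeal R * B) le_sup_left hlt
      have h2 : 1 ≤ relLen (A ⊔ IsLocalRing.maximalIdeal R * B) B := by
        rw [Order.one_le_iff_pos, pos_iff_ne_zero, Ne, eq_zero_iff]; exact hne
      have h3 : relLen A (A ⊔ IsLocalRing.maximalIdeal R * B) ≤ n := by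
        have : relLen A (A ⊔ IsLocalRing.maximalIdeal R * B) + 1 ≤ (n : ℕ∞) + 1 := by
          calc _ ≤ _ := add_le_add le_rfl h2
            _ = _ := h1.symm
            _ ≤ _ := by exact_mod_cast h
        exact (ENat.add_le_add_iff_right ENat.one_ne_top).1 this
      obtain ⟨N, hN⟩ := ih _ le_sup_left h3
      refine ⟨N + 1, ?_⟩
      rw [pow_succ, mul_assoc]
      exact (Ideal.mul_mono_right le_sup_right).trans hN
  obtain ⟨n, hn⟩ := ENat.ne_top_iff_exists.1 h
  exact key n B hAB hn.symm.le

end relLen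

theorem tendsto_succ_pow_sub_pow_div (j : ℕ) :
    Tendsto (fun n : ℕ => (((n : ℝ) + 1) ^ (j + 1) - (n : ℝ) ^ (j + 1)) / ((n : ℝ) + 1) ^ j)
      atTop (nhds ((j : ℝ) + 1)) := by
  have h1 : Tendsto (fun n : ℕ => (n : ℝ) / ((n : ℝ) + 1)) atTop (nhds 1) :=
    tendsto_natCast_div_add_atTop 1
  have h2 : Tendsto (fun n : ℕ => ∑ i ∈ Finset.range (j + 1), ((n : ℝ) / ((n : ℝ) + 1)) ^ i)
      atTop (nhds (∑ i ∈ Finset.range (j + 1), (1 : ℝ) ^ i)) :=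
    tendsto_finsetSum _ fun i _ => h1.pow i
  have h3 : (∑ i ∈ Finset.range (j + 1), (1 : ℝ) ^ i) = (j : ℝ) + 1 := by simp
  rw [h3] at h2
  refine h2.congr fun n => ?_
  have hn : ((n : ℝ) + 1) ≠ 0 := by positivity
  have h4 := geom_sum_mul ((n : ℝ) / ((n : ℝ) + 1)) (j + 1)
  have h5 : (n : ℝ) / ((n : ℝ) + 1) - 1 = - (1 / ((n : ℝ) + 1)) := by field_simp; ring
  rw [h5, div_pow] at h4
  have h6 : (∑ i ∈ Finset.range (j + 1), ((n : ℝ) / ((n : ℝ) + 1)) ^ i) =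
      (1 - (n : ℝ) ^ (j + 1) / ((n : ℝ) + 1) ^ (j + 1)) * ((n : ℝ) + 1) := by
    have : (∑ i ∈ Finset.range (j + 1), ((n : ℝ) / ((n : ℝ) + 1)) ^ i) =
      -((∑ i ∈ Finset.range (j + 1), ((n : ℝ) / ((n : ℝ) + 1)) ^ i) *
        -(1 / ((n : ℝ) + 1))) * ((n : ℝ) + 1) := by field_simp
    rw [this, h4]; ring
  rw [h6]
  field_simp
  ring

/-- Stolz–Cesàro for powers. -/
theorem tendsto_div_pow_succ_of_sub {u : ℕ → ℝ} {j : ℕ} {L : ℝ}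
    (h : Tendsto (fun n : ℕ => (u (n + 1) - u n) / ((n : ℝ) + 1) ^ j) atTop (nhds L)) :
    Tendsto (fun n : ℕ => u n / (n : ℝ) ^ (j + 1)) atTop (nhds (L / ((j : ℝ) + 1))) := by
  set c := L / ((j : ℝ) + 1) with hc
  have hj : ((j : ℝ) + 1) ≠ 0 := by positivity
  let f : ℕ → ℝ := fun n => (u (n + 1) - u n) - c * (((n : ℝ) + 1) ^ (j + 1) - (n : ℝ) ^ (j + 1))
  let g : ℕ → ℝ := fun n => ((n : ℝ) + 1) ^ j
  have hg0 : ∀ n, 0 < g n := fun n => by positivity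
  have hfg : f =o[atTop] g := by
    rw [Asymptotics.isLittleO_iff_tendsto (fun n hn => absurd hn (hg0 n).ne')]
    have := h.sub ((tendsto_succ_pow_sub_pow_div j).const_mul c)
    rw [hc, div_mul_cancel₀ _ hj, sub_self] at this
    refine this.congr fun n => ?_
    simp only [f, g, hc]
    ring
  have hgs : Tendsto (fun n => ∑ i ∈ Finset.range n, g i) atTop atTop := by
    refine tendsto_atTop_mono (f := fun n : ℕ => (n : ℝ)) (fun n => ?_)
      tendsto_natCast_atTop_atTop
    calc (n : ℝ) = ∑ i ∈ Finset.range n, (1 : ℝ) := by simp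
      _ ≤ _ := Finset.sum_le_sum fun i _ => one_le_pow₀ (by simp)
  have hs := hfg.sum_range (fun n => (hg0 n).le) hgs
  have hsum : ∀ n, ∑ i ∈ Finset.range n, f i = u n - u 0 - c * (n : ℝ) ^ (j + 1) := by
    intro n
    induction n with
    | zero => simp
    | succ n ih => rw [Finset.sum_range_succ, ih]; simp only [f]; push_cast; ring
  have hgn : ∀ n : ℕ, ∑ i ∈ Finset.range n, g i ≤ (n : ℝ) ^ (j + 1) := by
    intro n
    calc _ ≤ ∑ i ∈ Finset.range n, (n : ℝ) ^ j := Finset.sum_le_sum fun i hi => by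
            have : (i : ℝ) + 1 ≤ n := by exact_mod_cast Finset.mem_range.1 hi
            exact pow_le_pow_left₀ (by positivity) this _
      _ = _ := by simp [pow_succ, mul_comm]
  have hs2 : (fun n : ℕ => u n - u 0 - c * (n : ℝ) ^ (j + 1)) =o[atTop]
      (fun n : ℕ => (n : ℝ) ^ (j + 1)) := by
    refine (hs.congr_left hsum).trans_isBigO (Asymptotics.IsBigO.of_bound 1 ?_)
    refine Eventually.of_forall fun n => ?_
    rw [one_mul, Real.norm_of_nonneg (Finset.sum_nonneg fun i _ => (hg0 i).le),
      Real.norm_of_nonneg (by positivity)]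
    exact hgn n
  have hpow : Tendsto (fun n : ℕ => (n : ℝ) ^ (j + 1)) atTop atTop :=
    (tendsto_pow_atTop (Nat.succ_ne_zero j)).comp tendsto_natCast_atTop_atTop
  have h1 := hs2.tendsto_div_nhds_zero
  have h2 : Tendsto (fun n : ℕ => u 0 / (n : ℝ) ^ (j + 1)) atTop (nhds 0) :=
    hpow.const_div_atTop (u 0)
  have h3 := (h1.add h2).add_const c
  rw [zero_add, zero_add] at h3
  refine h3.congr' ?_
  filter_upwards [eventually_gt_atTop 0] with n hn
  have : (n : ℝ) ^ (j + 1) ≠ 0 := by positivity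
  field_simp
  ring

theorem tendsto_of_iterated_sums {r : ℝ} (E : ℕ → ℕ → ℝ) (h0 : ∀ t, E 0 t = r)
    (hs : ∀ j t, E (j + 1) (t + 1) = E (j + 1) t + E j (t + 1)) (j : ℕ) :
    Tendsto (fun t : ℕ => E j t / (t : ℝ) ^ j) atTop (nhds (r / (j.factorial : ℝ))) := by
  induction j with
  | zero => simp [h0]
  | succ j ih =>
    have h1 : Tendsto (fun n : ℕ => (E (j + 1) (n + 1) - E (j + 1) n) / ((n : ℝ) + 1) ^ j) atTop
        (nhds (r / (j.factorial : ℝ))) := by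
      refine ((tendsto_add_atTop_iff_nat 1).2 ih).congr fun n => ?_
      rw [hs]; push_cast; ring
    have h2 := tendsto_div_pow_succ_of_sub h1
    rw [div_div, mul_comm (j.factorial : ℝ)] at h2
    rw [Nat.factorial_succ]; push_cast
    exact h2

theorem tendsto_shift_div_pow {u : ℕ → ℝ} {k n₀ : ℕ} {L : ℝ}
    (h : Tendsto (fun t : ℕ => u (n₀ + t) / (t : ℝ) ^ k) atTop (nhds (L / (k.factorial : ℝ)))) :
    Tendsto (fun n : ℕ => (k.factorial : ℝ) / (n : ℝ) ^ k * u n) atTop (nhds L) := by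
  rw [← tendsto_add_atTop_iff_nat n₀]
  have h1 : Tendsto (fun t : ℕ => (t : ℝ) / ((t : ℝ) + (n₀ : ℝ))) atTop (nhds 1) :=
    tendsto_natCast_div_add_atTop (n₀ : ℝ)
  have h2 := (h.mul (h1.pow k)).const_mul (k.factorial : ℝ)
  have hk : (k.factorial : ℝ) ≠ 0 := by exact_mod_cast k.factorial_ne_zero
  have h3 : (k.factorial : ℝ) * (L / (k.factorial : ℝ) * 1 ^ k) = L := by field_simp; simp
  rw [h3] at h2
  refine h2.congr' ?_
  filter_upwards [eventually_gt_atTop 0] with t ht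
  have ht' : (t : ℝ) ≠ 0 := by positivity
  have ht2 : (t : ℝ) + n₀ ≠ 0 := by positivity
  rw [div_pow, add_comm n₀ t]; push_cast
  field_simp

theorem tendsto_of_differences {k n₀ r : ℕ} (D : ℕ → ℕ → ℕ)
    (hr : ∀ n ≥ n₀, D k n = r)
    (hD : ∀ i < k, ∀ n ≥ n₀, D i (n + 1) = D i n + D (i + 1) (n + 1)) :
    Tendsto (fun n : ℕ => (k.factorial : ℝ) / (n : ℝ) ^ k * (D 0 n : ℝ)) atTop
      (nhds (r : ℝ)) := by
  induction k generalizing D with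
  | zero =>
    refine tendsto_const_nhds.congr' ?_
    filter_upwards [eventually_ge_atTop n₀] with n hn
    simp [hr n hn]
  | succ k ih =>
    have h1 := ih (fun i n => D (i + 1) n) hr (fun i hi n hn => hD (i + 1) (by omega) n hn)
    have hk : (k.factorial : ℝ) ≠ 0 := by exact_mod_cast k.factorial_ne_zero
    have h2 : Tendsto (fun n : ℕ => ((D 0 (n + 1) : ℝ) - D 0 n) / ((n : ℝ) + 1) ^ k) atTop
        (nhds ((r : ℝ) / (k.factorial : ℝ))) := by
      refine (((tendsto_add_atTop_iff_nat 1).2 h1).div_const (k.factorial : ℝ)).congr' ?_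
      filter_upwards [eventually_ge_atTop n₀] with n hn
      have h3 : (D 0 (n + 1) : ℝ) - D 0 n = D 1 (n + 1) := by
        rw [hD 0 (by omega) n hn]; push_cast; ring
      have hn0 : ((n : ℝ) + 1) ^ k ≠ 0 := by positivity
      rw [h3]; push_cast
      rw [div_mul_eq_mul_div, div_div, mul_comm _ (k.factorial : ℝ), mul_div_mul_left _ _ hk]
    have h3 := (tendsto_div_pow_succ_of_sub (u := fun n => (D 0 n : ℝ)) h2).const_mul
      ((k + 1).factorial : ℝ)
    have h4 : ((k + 1).factorial : ℝ) * ((r : ℝ) / (k.factorial : ℝ) / ((k : ℝ) + 1)) = r := by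
      rw [Nat.factorial_succ]; push_cast; field_simp
    rw [h4] at h3
    refine h3.congr fun n => ?_
    ring

theorem le_of_tendsto_of_differences {k n₀ r : ℕ} (D : ℕ → ℕ → ℕ) {L : ℝ}
    (hr : ∀ n ≥ n₀, D k n ≤ r)
    (hD : ∀ i < k, ∀ n ≥ n₀, D i (n + 1) ≤ D i n + D (i + 1) (n + 1))
    (hL : Tendsto (fun n : ℕ => (k.factorial : ℝ) / (n : ℝ) ^ k * (D 0 n : ℝ)) atTop
      (nhds L)) : L ≤ r := by
  obtain ⟨E, hE0, hEi, hE⟩ : ∃ E : ℕ → ℕ → ℕ, (∀ t, E 0 t = r) ∧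
      (∀ j, E (j + 1) 0 = D (k - (j + 1)) n₀) ∧
      ∀ j t, E (j + 1) (t + 1) = E (j + 1) t + E j (t + 1) :=
    ⟨fun j => Nat.rec (fun _ => r)
      (fun j e t => Nat.rec (D (k - (j + 1)) n₀) (fun t w => w + e (t + 1)) t) j,
      fun _ => rfl, fun _ => rfl, fun _ _ => rfl⟩
  have hle : ∀ j ≤ k, ∀ t, D (k - j) (n₀ + t) ≤ E j t := by
    intro j
    induction j with
    | zero => intro _ t; rw [hE0]; exact hr _ (by omega)
    | succ j ih =>
      intro hj t
      induction t with
      | zero => exact (hEi j).ge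
      | succ t iht =>
        have h1 := hD (k - (j + 1)) (by omega) (n₀ + t) (by omega)
        have h2 := ih (by omega) (t + 1)
        rw [show k - j = k - (j + 1) + 1 by omega] at h2
        rw [hE]
        exact h1.trans (add_le_add iht h2)
  have h1 : Tendsto (fun t : ℕ => (E k t : ℝ) / (t : ℝ) ^ k) atTop
      (nhds ((r : ℝ) / (k.factorial : ℝ))) :=
    tendsto_of_iterated_sums (E := fun j t => ((E j t : ℕ) : ℝ)) (fun t => by simp [hE0])
      (fun j t => by simp only [hE]; push_cast; rfl) k
  have h2 := tendsto_shift_div_pow (n₀ := n₀) (u := fun n => (E k (n - n₀) : ℝ)) (L := (r : ℝ))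
    (k := k) (by simpa using h1)
  refine le_of_tendsto_of_tendsto hL h2 ?_
  filter_upwards [eventually_ge_atTop n₀] with n hn
  have h3 := hle k le_rfl (n - n₀)
  rw [Nat.sub_self, Nat.add_sub_cancel' hn] at h3
  have h4 : (D 0 n : ℝ) ≤ E k (n - n₀) := by exact_mod_cast h3
  exact mul_le_mul_of_nonneg_left h4 (by positivity)

/-- The ideal generated by `a 0, …, a (i - 1)`. -/
def firstSpan {Q : Type*} [CommRing Q] (a : ℕ → Q) (i : ℕ) : Ideal Q :=
  Ideal.span (a '' {j | j < i})

section firstSpan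

variable {Q : Type*} [CommRing Q] (a : ℕ → Q)

@[simp] theorem firstSpan_zero : firstSpan a 0 = ⊥ := by simp [firstSpan]

theorem firstSpan_succ (i : ℕ) : firstSpan a (i + 1) = firstSpan a i ⊔ Ideal.span {a i} := by
  rw [firstSpan, firstSpan, ← Ideal.span_union]
  congr 1
  ext x
  simp only [Set.mem_image, Set.mem_ofPred_eq, Set.mem_union, Set.mem_singleton_iff]
  constructor
  · rintro ⟨j, hj, rfl⟩
    rcases Nat.lt_succ_iff_lt_or_eq.1 hj with h | rfl
    · exact Or.inl ⟨j, h, rfl⟩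
    · exact Or.inr rfl
  · rintro (⟨j, hj, rfl⟩ | rfl)
    · exact ⟨j, by omega, rfl⟩
    · exact ⟨i, by omega, rfl⟩

theorem mem_firstSpan {i j : ℕ} (h : j < i) : a j ∈ firstSpan a i :=
  Ideal.subset_span ⟨j, h, rfl⟩

theorem firstSpan_mono {i j : ℕ} (h : i ≤ j) : firstSpan a i ≤ firstSpan a j :=
  Ideal.span_mono (Set.image_mono fun _ hx => lt_of_lt_of_le hx h)

theorem firstSpan_le {i : ℕ} {K : Ideal Q} : firstSpan a i ≤ K ↔ ∀ j < i, a j ∈ K := by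
  rw [firstSpan, Ideal.span_le]
  exact ⟨fun h j hj => h ⟨j, hj, rfl⟩, by rintro h _ ⟨j, hj, rfl⟩; exact h j hj⟩

theorem mem_firstSpan_succ_mul {i : ℕ} {C : Ideal Q} {u : Q} :
    u ∈ firstSpan a (i + 1) * C ↔ ∃ w ∈ firstSpan a i * C, ∃ v ∈ C, w + a i * v = u := by
  rw [firstSpan_succ, Ideal.sup_mul, Submodule.mem_sup]
  constructor
  · rintro ⟨w, hw, y, hy, rfl⟩
    obtain ⟨v, hv, rfl⟩ := Ideal.mem_span_singleton_mul.1 hy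
    exact ⟨w, hw, v, hv, rfl⟩
  · rintro ⟨w, hw, v, hv, rfl⟩
    exact ⟨w, hw, _, Ideal.mul_mem_mul (Ideal.mem_span_singleton_self _) hv, rfl⟩

end firstSpan

theorem exists_pow_inf_le {Q : Type*} [CommRing Q] [IsNoetherianRing Q] (I K : Ideal Q) :
    ∃ c, ∀ n ≥ c, I ^ n ⊓ K ≤ I ^ (n - c) * K := by
  obtain ⟨c, hc⟩ := I.exists_pow_inf_eq_pow_smul K
  refine ⟨c, fun n hn => ?_⟩
  have := hc n hn
  simp only [smul_eq_mul, Ideal.mul_top] at this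
  rw [this]
  exact Ideal.mul_mono_right inf_le_right

/-- Multiplication by `a j` is injective on the pieces `C / (B + (a 0, …, a (j - 1)) C)`
in degrees above `n₀`, for all `j < i`. -/
def FilterRegular {Q : Type*} [CommRing Q] (a : ℕ → Q) (B C : ℕ → Ideal Q) (i n₀ : ℕ) : Prop :=
  ∀ j < i, ∀ n ≥ n₀, ∀ u ∈ C (n + 1), a j * u ∈ B (n + 2) ⊔ firstSpan a j * C (n + 1) →
    u ∈ B (n + 1) ⊔ firstSpan a j * C n

namespace FilterRegular

variable {Q : Type*} [CommRing Q] {a : ℕ → Q} {B C : ℕ → Ideal Q} {i n₀ : ℕ}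

theorem mono {i' n' : ℕ} (h : FilterRegular a B C i n₀) (hi : i' ≤ i) (hn : n₀ ≤ n') :
    FilterRegular a B C i' n' :=
  fun j hj n hn' u hu h' => h j (hj.trans_le hi) n (hn.trans hn') u hu h'

theorem mul_mem (hC : ∀ j < i, ∀ n, ∀ u ∈ C n, a j * u ∈ C (n + 1)) {j k n : ℕ} (hj : j < i)
    {u : Q} (hu : u ∈ firstSpan a k * C n) : a j * u ∈ firstSpan a k * C (n + 1) := by
  induction hu using Submodule.mul_induction_on' with
  | mem_mul_mem x hx y hy =>
    rw [mul_left_comm]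
    exact Ideal.mul_mem_mul hx (hC j hj n y hy)
  | add x _ y _ hx hy => rw [mul_add]; exact add_mem hx hy

theorem inf_le (h : FilterRegular a B C i n₀)
    (hB : ∀ j < i, ∀ n, ∀ u ∈ B n, a j * u ∈ B (n + 1))
    (hC : ∀ j < i, ∀ n, ∀ u ∈ C n, a j * u ∈ C (n + 1)) {n : ℕ} (hn : n₀ ≤ n) :
    B (n + 2) ⊓ firstSpan a i * C (n + 1) ≤ firstSpan a i * B (n + 1) := by
  induction i with
  | zero => simp
  | succ i ih =>
    rintro u ⟨huB, hu⟩
    obtain ⟨w, hw, v, hv, rfl⟩ := (mem_firstSpan_succ_mul a).1 hu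
    have h1 : a i * v ∈ B (n + 2) ⊔ firstSpan a i * C (n + 1) := by
      have : a i * v = (w + a i * v) - w := by ring
      rw [this]
      exact sub_mem (Ideal.mem_sup_left huB) (Ideal.mem_sup_right hw)
    obtain ⟨b, hb, t, ht, rfl⟩ := Submodule.mem_sup.1 (h i (Nat.lt_succ_self i) n hn v hv h1)
    refine (mem_firstSpan_succ_mul a).2 ⟨w + a i * t, ?_, b, hb, by ring⟩
    refine ih (h.mono (Nat.le_succ i) le_rfl) (fun j hj => hB j (by omega))
      (fun j hj => hC j (by omega)) ⟨?_, add_mem hw (mul_mem hC (Nat.lt_succ_self i) ht)⟩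
    have : w + a i * t = (w + a i * (b + t)) - a i * b := by ring
    rw [this]
    exact sub_mem huB (hB i (Nat.lt_succ_self i) _ b hb)

end FilterRegular

theorem sup_pow_le_sup_pow {Q : Type*} [CommRing Q] (K I : Ideal Q) (n : ℕ) :
    (K ⊔ I) ^ n ≤ K ⊔ I ^ n := by
  induction n with
  | zero => simp
  | succ n ih =>
    rw [pow_succ]
    refine (Ideal.mul_mono_left ih).trans ?_
    rw [Ideal.sup_mul, Ideal.mul_sup, pow_succ, Ideal.mul_sup]
    exact sup_le (le_sup_of_le_left (sup_le Ideal.mul_le_right Ideal.mul_le_left))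
      (sup_le (le_sup_of_le_left Ideal.mul_le_right) le_sup_right)

theorem exists_le_of_bounded {q : ℕ → ℕ∞} {r : ℕ} (n₀ : ℕ) (hr : ∀ n ≥ n₀, q n ≤ r) :
    ∃ n ≥ n₀, q (n + 1) ≤ q n := by
  by_contra! h
  have : ∀ t : ℕ, (t : ℕ∞) ≤ q (n₀ + t) := by
    intro t
    induction t with
    | zero => simp
    | succ t ih =>
      have h1 := h (n₀ + t) (by omega)
      have h2 : ((t : ℕ∞)) < q (n₀ + t + 1) := lt_of_le_of_lt ih h1
      rw [← add_assoc]; push_cast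
      exact Order.add_one_le_of_lt h2
  have h1 := (this (r + 1)).trans (hr _ (by omega))
  have : r + 1 ≤ r := by exact_mod_cast h1
  omega

section superficial

variable {Q : Type*} [CommRing Q] [IsNoetherianRing Q] {a : ℕ → Q} {I : Ideal Q} {k n₀ : ℕ}

theorem exists_pow_inf_firstSpan_le (ha : ∀ j < k, a j ∈ I)
    (hG : FilterRegular a (fun n => I ^ (n + 1)) (fun n => I ^ n) k n₀) :
    ∃ n₁, ∀ n ≥ n₁, I ^ (n + 1) ⊓ firstSpan a k ≤ firstSpan a k * I ^ n := by
  have hmul : ∀ j < k, ∀ n, ∀ u ∈ I ^ n, a j * u ∈ I ^ (n + 1) := fun j hj n u hu => by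
    rw [pow_succ']; exact Ideal.mul_mem_mul (ha j hj) hu
  have h1 : ∀ n ≥ n₀, I ^ (n + 3) ⊓ firstSpan a k * I ^ (n + 1) ≤ firstSpan a k * I ^ (n + 2) :=
    fun n hn => hG.inf_le (fun j hj n => hmul j hj _) hmul hn
  have h2 : ∀ t p : ℕ, n₀ + 1 ≤ p → I ^ (p + t + 1) ⊓ firstSpan a k * I ^ p ≤
      firstSpan a k * I ^ (p + t) := by
    intro t
    induction t with
    | zero => intro p _; exact inf_le_right
    | succ t ih =>
      intro p hp
      obtain ⟨p, rfl⟩ : ∃ p', p = p' + 1 := ⟨p - 1, by omega⟩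
      have h3 := ih (p + 2) (by omega)
      rw [show p + 1 + (t + 1) = p + 2 + t by ring]
      refine le_trans (le_inf inf_le_left ?_) h3
      refine le_trans (inf_le_inf_right _ (Ideal.pow_le_pow_right ?_)) (h1 p (by omega))
      omega
  obtain ⟨c, hc⟩ := exists_pow_inf_le I (firstSpan a k)
  refine ⟨c + n₀ + 1, fun n hn => ?_⟩
  have h3 := hc (n + 1) (by omega)
  have h4 := h2 (c - 1) (n + 1 - c) (by omega)
  rcases Nat.eq_zero_or_pos c with rfl | hc0
  · refine h3.trans ?_
    rw [mul_comm]
    exact Ideal.mul_mono_right (Ideal.pow_le_pow_right (by omega))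
  · rw [show n + 1 - c + (c - 1) = n by omega] at h4
    refine le_trans (le_inf inf_le_left ?_) h4
    rw [mul_comm]; exact h3

/-- Elements of `I ^ (n + 1)` lie in `X ⊔ K` iff they lie in `X ⊔ (a 0, …, a (k - 1)) I ^ n`. -/
theorem exists_mem_sup_iff (ha : ∀ j < k, a j ∈ I)
    (hG : FilterRegular a (fun n => I ^ (n + 1)) (fun n => I ^ n) k n₀) {K : Ideal Q}
    {e : ℕ} (he : I ^ e * K ≤ firstSpan a k) :
    ∃ n₁, ∀ n ≥ n₁, I ^ (n + 1) ⊓ K ≤ firstSpan a k * I ^ n := by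
  obtain ⟨n₁, hn₁⟩ := exists_pow_inf_firstSpan_le ha hG
  obtain ⟨c, hc⟩ := exists_pow_inf_le I K
  refine ⟨n₁ + c + e, fun n hn => ?_⟩
  refine le_trans (le_inf inf_le_left ?_) (hn₁ n (by omega))
  refine (hc (n + 1) (by omega)).trans (le_trans (Ideal.mul_mono_left ?_) he)
  exact Ideal.pow_le_pow_right (by omega)

theorem relLen_pow_of_nonzerodivisor [IsLocalRing Q] {K : Ideal Q} {b : Q} (hb : b ∈ I) {r : ℕ}
    (hnzd : ∀ u, b * u ∈ K → u ∈ K) (hr : relLen (K ⊔ Ideal.span {b}) ⊤ = r) (n : ℕ) :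
    relLen (K ⊔ Ideal.span {b} * I ^ n) (I ^ n) = r := by
  have hbn : Ideal.span {b} * I ^ n ≤ Ideal.span {b} := Ideal.mul_le_left
  have hbn' : Ideal.span {b} * I ^ n ≤ I ^ n := Ideal.mul_le_right
  have e1 := relLen.add (A := K ⊔ Ideal.span {b} * I ^ n) (B := K ⊔ Ideal.span {b}) (C := ⊤)
    (sup_le_sup_left hbn _) le_top
  have e2 := relLen.add (A := K ⊔ Ideal.span {b} * I ^ n) (B := K ⊔ I ^ n) (C := ⊤)
    (sup_le_sup_left hbn' _) le_top
  have e3 : relLen (K ⊔ Ideal.span {b} * I ^ n) (K ⊔ Ideal.span {b}) = relLen (K ⊔ I ^ n) ⊤ := by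
    rw [← relLen.mul_left_le (A := K ⊔ I ^ n) (B := ⊤) (A' := K ⊔ Ideal.span {b} * I ^ n) b,
      Ideal.mul_top]
    · refine relLen.congr_right ?_
      simp only [sup_comm, sup_left_comm, sup_left_idem]
    · intro u _
      constructor
      · intro h
        obtain ⟨κ, hκ, y, hy, hu⟩ := Submodule.mem_sup.1 h
        obtain ⟨v, hv, rfl⟩ := Ideal.mem_span_singleton_mul.1 hy
        have : u - v ∈ K := hnzd _ (by rw [mul_sub, ← hu]; simpa using hκ)
        have h2 : u = (u - v) + v := by ring
        rw [h2]
        exact add_mem (Ideal.mem_sup_left this) (Ideal.mem_sup_right hv)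
      · intro h
        obtain ⟨κ, hκ, v, hv, rfl⟩ := Submodule.mem_sup.1 h
        rw [mul_add]
        exact add_mem (Ideal.mem_sup_left (K.mul_mem_left _ hκ))
          (Ideal.mem_sup_right (Ideal.mul_mem_mul (Ideal.mem_span_singleton_self b) hv))
  have e4 : relLen (K ⊔ Ideal.span {b} * I ^ n) (K ⊔ I ^ n) =
      relLen (K ⊔ Ideal.span {b} * I ^ n) (I ^ n) := by
    refine relLen.congr_right ?_
    simp only [sup_assoc, sup_comm, sup_left_comm, sup_left_idem]
  have hfin : relLen (K ⊔ I ^ n) ⊤ ≠ ⊤ := by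
    obtain ⟨N, hN⟩ := relLen.exists_pow_mul_le (A := K ⊔ Ideal.span {b}) (B := ⊤) le_top
      (by rw [hr]; exact ENat.natCast_ne_top r)
    rw [Ideal.mul_top] at hN
    refine relLen.ne_top_of_pow_mul_le (N := N * n) ?_
    rw [Ideal.mul_top, pow_mul]
    refine (Ideal.pow_right_mono hN n).trans ?_
    refine (Ideal.pow_right_mono (sup_le_sup_left
      ((Ideal.span_singleton_le_iff_mem _).2 hb) K) n).trans ?_
    exact sup_pow_le_sup_pow K I n
  rw [e3, hr] at e1
  rw [e4] at e2
  rw [e1, add_comm] at e2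
  exact le_antisymm ((ENat.add_le_add_iff_right hfin).1 e2.ge) ((ENat.add_le_add_iff_right hfin).1 e2.le)

theorem exists_pow_succ_eq [IsLocalRing Q] (hI : I ≤ IsLocalRing.maximalIdeal Q)
    (ha : ∀ j < k + 1, a j ∈ I)
    (hG : FilterRegular a (fun n => I ^ (n + 1)) (fun n => I ^ n) (k + 1) n₀) {K : Ideal Q}
    (haK : firstSpan a k ≤ K) {e : ℕ} (he : I ^ e * K ≤ firstSpan a k)
    (hnzd : ∀ u, a k * u ∈ K → u ∈ K) {r : ℕ} (hr : relLen (K ⊔ Ideal.span {a k}) ⊤ = r) :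
    ∃ n₁, ∀ n ≥ n₁, I ^ (n + 1) = firstSpan a (k + 1) * I ^ n := by
  obtain ⟨n₁, hn₁⟩ := exists_mem_sup_iff (fun j hj => ha j (by omega))
    (hG.mono (Nat.le_succ k) le_rfl) he
  have hak := ha k (Nat.lt_succ_self k)
  let q : ℕ → ℕ∞ := fun n => relLen (I ^ (n + 2) ⊔ K) (I ^ (n + 1))
  have hq : ∀ n ≥ n₀ + n₁, q n ≤ r := by
    intro n hn
    rw [← relLen_pow_of_nonzerodivisor hak hnzd hr (n + 1)]
    refine relLen.anti_left (sup_le le_sup_right (le_sup_of_le_left ?_))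
    rw [pow_succ' I (n + 1)]
    exact Ideal.mul_mono_left ((Ideal.span_singleton_le_iff_mem _).2 hak)
  obtain ⟨n, hn, hqn⟩ := exists_le_of_bounded (n₀ + n₁) hq
  have hmem : ∀ m ≥ n₁, ∀ u ∈ I ^ (m + 1), u ∈ I ^ (m + 2) ⊔ K →
      u ∈ I ^ (m + 2) ⊔ firstSpan a k * I ^ m := by
    intro m hm u hu h
    obtain ⟨v, hv, κ, hκ, rfl⟩ := Submodule.mem_sup.1 h
    refine add_mem (Ideal.mem_sup_left hv) (Ideal.mem_sup_right (hn₁ m hm ⟨?_, hκ⟩))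
    have : κ = (v + κ) - v := by ring
    rw [this]
    exact sub_mem hu (Ideal.pow_le_pow_right (Nat.le_succ _) hv)
  have e1 : relLen (I ^ (n + 3) ⊔ K) (Ideal.span {a k} * I ^ (n + 1)) = q n := by
    refine relLen.mul_left_le _ fun u hu => ⟨fun h => ?_, fun h => ?_⟩
    · have h1 := hmem (n + 1) (by omega) (a k * u)
        (by rw [pow_succ']; exact Ideal.mul_mem_mul hak hu) h
      have h2 := hG k (Nat.lt_succ_self k) n (by omega) u hu h1
      exact sup_le_sup_left (Ideal.mul_le_left.trans haK) _ h2
    · obtain ⟨v, hv, κ, hκ, rfl⟩ := Submodule.mem_sup.1 h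
      rw [mul_add]
      refine add_mem (Ideal.mem_sup_left ?_) (Ideal.mem_sup_right (K.mul_mem_left _ hκ))
      rw [pow_succ']; exact Ideal.mul_mem_mul hak hv
  have hle : Ideal.span {a k} * I ^ (n + 1) ≤ I ^ (n + 2) := by
    rw [pow_succ' I (n + 1)]
    exact Ideal.mul_mono_left ((Ideal.span_singleton_le_iff_mem _).2 hak)
  have e2 : relLen (I ^ (n + 3) ⊔ K) (Ideal.span {a k} * I ^ (n + 1)) =
      relLen (I ^ (n + 3) ⊔ K) (I ^ (n + 2)) :=
    le_antisymm (relLen.mono_right hle) (by rw [e1]; exact hqn)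
  have hfin : relLen (I ^ (n + 3) ⊔ K) (I ^ (n + 2)) ≠ ⊤ :=
    ne_top_of_le_ne_top (ENat.natCast_ne_top r) (hq (n + 1) (by omega))
  have h5 := relLen.le_sup_of_eq hle e2 hfin
  have h6 : I ^ (n + 2) ≤ firstSpan a (k + 1) * I ^ (n + 1) ⊔ I • I ^ (n + 2) := by
    intro u hu
    obtain ⟨z, hz, y, hy, rfl⟩ := Submodule.mem_sup.1 (h5 hu)
    have hz' : z ∈ I ^ (n + 2) := by
      have : z = z + y - y := by ring
      rw [this]; exact sub_mem hu (hle hy)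
    have h7 := hmem (n + 1) (by omega) z hz' hz
    have h8 : I ^ (n + 3) ≤ I • I ^ (n + 2) := by
      rw [show n + 3 = (n + 2) + 1 from rfl, pow_succ' I (n + 2), smul_eq_mul]
    have h9 : firstSpan a k * I ^ (n + 1) ≤ firstSpan a (k + 1) * I ^ (n + 1) :=
      Ideal.mul_mono_left (firstSpan_mono a (Nat.le_succ k))
    have h10 : Ideal.span {a k} * I ^ (n + 1) ≤ firstSpan a (k + 1) * I ^ (n + 1) :=
      Ideal.mul_mono_left ((Ideal.span_singleton_le_iff_mem _).2 (mem_firstSpan a (Nat.lt_succ_self k)))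
    have h11 : I ^ (n + 3) ⊔ firstSpan a k * I ^ (n + 1) ≤
      firstSpan a (k + 1) * I ^ (n + 1) ⊔ I • I ^ (n + 2) :=
      sup_le (h8.trans le_sup_right) (h9.trans le_sup_left)
    exact add_mem (h11 h7) (Ideal.mem_sup_left (h10 hy))
  have h7 : I ^ (n + 2) ≤ firstSpan a (k + 1) * I ^ (n + 1) :=
    Submodule.le_of_le_smul_of_le_jacobson_bot (IsNoetherian.noetherian _)
      (hI.trans (IsLocalRing.maximalIdeal_le_jacobson _)) h6
  have hle2 : firstSpan a (k + 1) ≤ I := (firstSpan_le a).2 ha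
  refine ⟨n + 1, fun m hm => le_antisymm ?_ ?_⟩
  · obtain ⟨t, rfl⟩ := Nat.exists_eq_add_of_le hm
    have e3 : I ^ (n + 1 + t + 1) = I ^ t * I ^ (n + 2) := by
      rw [← pow_add]; congr 1; ring
    have e4 : firstSpan a (k + 1) * I ^ (n + 1 + t) =
        I ^ t * (firstSpan a (k + 1) * I ^ (n + 1)) := by
      rw [pow_add I (n + 1) t]; ring
    rw [e3, e4]
    exact Ideal.mul_mono_right h7
  · rw [pow_succ' I m]; exact Ideal.mul_mono_left hle2

end superficial

section abstract_filtration

variable {Q : Type*} [CommRing Q] {a : ℕ → Q} {C L : ℕ → Ideal Q} {k n₀ : ℕ}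

theorem mem_sup_of_mul_mem_sup (hC : ∀ j < k, ∀ n, ∀ u ∈ C n, a j * u ∈ C (n + 1))
    (hL : ∀ j < k, ∀ n, ∀ u ∈ L n, a j * u ∈ L (n + 1)) {x : Q}
    (hx : ∀ n ≥ n₀, ∀ u ∈ C n, x * u ∈ L n → u ∈ L n)
    (hY : FilterRegular a (fun n => L n ⊔ Ideal.span {x} * C n) C k n₀) {n : ℕ} (hn : n₀ ≤ n)
    {u : Q} (hu : u ∈ C (n + 2)) (h : x * u ∈ L (n + 2) ⊔ firstSpan a k * C (n + 1)) :
    u ∈ L (n + 2) ⊔ firstSpan a k * C (n + 1) := by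
  induction k generalizing u with
  | zero =>
    simp only [firstSpan_zero, Ideal.bot_mul, bot_le, sup_of_le_left] at h ⊢
    exact hx _ (by omega) u hu h
  | succ i ih =>
    obtain ⟨l, hl, y, hy, hly⟩ := Submodule.mem_sup.1 h
    obtain ⟨w, hw, v, hv, rfl⟩ := (mem_firstSpan_succ_mul a).1 hy
    have h1 : a i * v ∈ (L (n + 2) ⊔ Ideal.span {x} * C (n + 2)) ⊔ firstSpan a i * C (n + 1) := by
      have : a i * v = (-l + x * u) + -w := by rw [← hly]; ring
      rw [this]
      exact add_mem (Ideal.mem_sup_left (add_mem (Ideal.mem_sup_left (neg_mem hl))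
        (Ideal.mem_sup_right (Ideal.mul_mem_mul (Ideal.mem_span_singleton_self x) hu))))
        (Ideal.mem_sup_right (neg_mem hw))
    have h2 := hY i (Nat.lt_succ_self i) n hn v hv h1
    obtain ⟨y', hy', w', hw', rfl⟩ := Submodule.mem_sup.1 h2
    obtain ⟨l', hl', y'', hy'', rfl⟩ := Submodule.mem_sup.1 hy'
    obtain ⟨v', hv', rfl⟩ := Ideal.mem_span_singleton_mul.1 hy''
    have h3 : u - a i * v' ∈ L (n + 2) ⊔ firstSpan a i * C (n + 1) := by
      refine ih (fun j hj => hC j (by omega)) (fun j hj => hL j (by omega))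
        (hY.mono (Nat.le_succ i) le_rfl) (sub_mem hu (hC i (Nat.lt_succ_self i) _ v' hv')) ?_
      have : x * (u - a i * v') = (l + a i * l') + (w + a i * w') := by
        rw [mul_sub, ← hly]; ring
      rw [this]
      exact add_mem (Ideal.mem_sup_left (add_mem hl (hL i (Nat.lt_succ_self i) _ l' hl')))
        (Ideal.mem_sup_right (add_mem hw
          (FilterRegular.mul_mem (i := i + 1) hC (Nat.lt_succ_self i) hw')))
    have h4 : u = (u - a i * v') + a i * v' := by ring
    rw [h4]
    refine add_mem (sup_le_sup_left (Ideal.mul_mono_left (firstSpan_mono a (Nat.le_succ i))) _ h3)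
      (Ideal.mem_sup_right (Ideal.mul_mem_mul (mem_firstSpan a (Nat.lt_succ_self i)) hv'))

theorem relLen_succ_add (hCL : ∀ n, C (n + 1) ≤ L n)
    (hC : ∀ j < k, ∀ n, ∀ u ∈ C n, a j * u ∈ C (n + 1))
    (hL : ∀ j < k, ∀ n, ∀ u ∈ L n, a j * u ∈ L (n + 1))
    (hH : FilterRegular a (fun n => C (n + 1)) L k n₀) {i : ℕ} (hi : i < k) {n : ℕ} (hn : n₀ ≤ n) :
    relLen (C (n + 3) ⊔ firstSpan a i * L (n + 1)) (L (n + 2)) =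
      relLen (C (n + 2) ⊔ firstSpan a i * L n) (L (n + 1)) +
      relLen (C (n + 3) ⊔ firstSpan a (i + 1) * L (n + 1)) (L (n + 2)) := by
  have hspan : ∀ j ≤ k, ∀ n, firstSpan a j * L n ≤ L (n + 1) := by
    intro j hj n
    rw [Ideal.mul_le]
    intro b hb v hv
    refine (show firstSpan a j ≤ Submodule.colon (L (n + 1)) {v} from (firstSpan_le a).2 ?_) hb |>
      Submodule.mem_colon_singleton.1
    exact fun i hi => Submodule.mem_colon_singleton.2 (hL i (by omega) n v hv)
  have e0 : C (n + 3) ⊔ firstSpan a (i + 1) * L (n + 1) =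
      (C (n + 3) ⊔ firstSpan a i * L (n + 1)) ⊔ Ideal.span {a i} * L (n + 1) := by
    rw [firstSpan_succ, Ideal.sup_mul, sup_assoc]
  rw [relLen.add (B := C (n + 3) ⊔ firstSpan a (i + 1) * L (n + 1)) (by rw [e0]; exact le_sup_left)
    (sup_le (hCL _) (hspan _ (by omega) _))]
  congr 1
  rw [e0, relLen.sup_right]
  refine relLen.mul_left_le _ fun u hu => ⟨fun h => hH i hi n hn u hu h, fun h => ?_⟩
  obtain ⟨c, hc, w, hw, rfl⟩ := Submodule.mem_sup.1 h
  rw [mul_add]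
  exact add_mem (Ideal.mem_sup_left (hC i hi _ c hc))
    (Ideal.mem_sup_right (FilterRegular.mul_mem hL hi hw))

theorem tendsto_relLen [IsNoetherianRing Q] [IsLocalRing Q] (hCL : ∀ n, C (n + 1) ≤ L n)
    (hLC : ∀ n, L n ≤ C n) (hC : ∀ j < k, ∀ n, ∀ u ∈ C n, a j * u ∈ C (n + 1))
    (hL : ∀ j < k, ∀ n, ∀ u ∈ L n, a j * u ∈ L (n + 1))
    (hfin : ∃ N, ∀ n, IsLocalRing.maximalIdeal Q ^ N * L n ≤ C (n + 1)) {x : Q}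
    (hxm : x ∈ IsLocalRing.maximalIdeal Q)
    (hx : ∀ n ≥ n₀, ∀ u ∈ C n, x * u ∈ L n → u ∈ L n)
    (hH : FilterRegular a (fun n => C (n + 1)) L k n₀)
    (hG : FilterRegular a L C k n₀)
    (hY : FilterRegular a (fun n => L n ⊔ Ideal.span {x} * C n) C k n₀)
    {K : Ideal Q} (haK : firstSpan a k ≤ K)
    (hK : ∀ n ≥ n₀, C (n + 1) ⊓ K ≤ firstSpan a k * C n) {r : ℕ}
    (hr : ∀ n ≥ n₀, relLen (C (n + 1) ⊔ K) (C n) = r) :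
    Tendsto (fun n : ℕ => (k.factorial : ℝ) / (n : ℝ) ^ k *
      ((relLen (C (n + 1)) (L n)).toNat : ℝ)) atTop (nhds (r : ℝ)) := by
  have hanti : ∀ n, C (n + 1) ≤ C n := fun n => (hCL n).trans (hLC n)
  have hCle : ∀ n ≥ n₀, C (n + 2) ≤ L (n + 2) ⊔ firstSpan a k * C (n + 1) := by
    intro n hn
    by_contra hnot
    obtain ⟨M, hM⟩ := relLen.exists_pow_mul_le (A := C (n + 3) ⊔ K) (B := C (n + 2) ⊔ (C (n + 3) ⊔ K))
      le_sup_right (by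
        rw [sup_comm (C (n + 2)), relLen.sup_right, hr _ (by omega)]; exact ENat.natCast_ne_top r)
    have hM' : IsLocalRing.maximalIdeal Q ^ M * C (n + 2) ≤
        L (n + 2) ⊔ firstSpan a k * C (n + 1) := by
      intro u hu
      obtain ⟨c, hc, κ, hκ, rfl⟩ := Submodule.mem_sup.1 (hM (Ideal.mul_mono_right le_sup_left hu))
      refine add_mem (Ideal.mem_sup_left (hCL _ hc)) (Ideal.mem_sup_right (hK _ (by omega) ⟨?_, hκ⟩))
      have : κ = (c + κ) - c := by ring
      rw [this]
      exact sub_mem (Ideal.mul_le_right hu) (hanti _ hc)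
    obtain ⟨b, hb, hb', hmb⟩ := relLen.exists_socle hM' hnot
    exact hb' (mem_sup_of_mul_mem_sup hC hL hx hY hn hb (hmb x hxm))
  have hr2 : ∀ n ≥ n₀, relLen (C (n + 3) ⊔ firstSpan a k * L (n + 1)) (L (n + 2)) = r := by
    intro n hn
    rw [← hr (n + 2) (by omega)]
    have e1 : relLen (C (n + 2 + 1) ⊔ K) (C (n + 2)) = relLen (C (n + 2 + 1) ⊔ K) (L (n + 2)) := by
      refine relLen.congr_right (le_antisymm (sup_le le_sup_left ?_)
        (sup_le_sup_left (hLC _) _))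
      refine (hCle n hn).trans (sup_le le_sup_right ?_)
      exact le_sup_of_le_left (le_sup_of_le_right (Ideal.mul_le_left.trans haK))
    refine Eq.trans ?_ e1.symm
    refine relLen.congr_left (le_antisymm ?_ ?_)
    · exact inf_le_inf_right _ (sup_le_sup_left (Ideal.mul_le_left.trans haK) _)
    · rintro u ⟨hu, huL⟩
      refine ⟨?_, huL⟩
      obtain ⟨c, hc, κ, hκ, rfl⟩ := Submodule.mem_sup.1 hu
      have hκL : κ ∈ L (n + 2) := by
        have : κ = (c + κ) - c := by ring
        rw [this]; exact sub_mem huL (hCL _ hc)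
      have h1 : κ ∈ firstSpan a k * C (n + 1) := hK _ (by omega) ⟨hLC _ hκL, hκ⟩
      have h2 : κ ∈ firstSpan a k * L (n + 1) := hG.inf_le hL hC hn ⟨hκL, h1⟩
      exact add_mem (Ideal.mem_sup_left hc) (Ideal.mem_sup_right h2)
  have hfin' : ∀ i n, relLen (C (n + 1) ⊔ firstSpan a i * L (n - 1)) (L n) ≠ ⊤ := by
    intro i n
    obtain ⟨N, hN⟩ := hfin
    exact relLen.ne_top_of_pow_mul_le ((hN n).trans le_sup_left)
  have key := tendsto_of_differences (k := k) (n₀ := n₀ + 2) (r := r)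
    (fun i n => (relLen (C (n + 1) ⊔ firstSpan a i * L (n - 1)) (L n)).toNat)
    (fun n hn => by
      obtain ⟨m, rfl⟩ : ∃ m, n = m + 2 := ⟨n - 2, by omega⟩
      have := hr2 m (by omega)
      simp only [show m + 2 - 1 = m + 1 from rfl]
      rw [this]; rfl)
    (fun i hi n hn => by
      obtain ⟨m, rfl⟩ : ∃ m, n = m + 1 := ⟨n - 1, by omega⟩
      have h1 := relLen_succ_add hCL hC hL hH hi (show n₀ ≤ m by omega)
      have f1 := hfin' i (m + 1)
      have f2 := hfin' (i + 1) (m + 2)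
      change (relLen (C (m + 3) ⊔ firstSpan a i * L (m + 1)) (L (m + 2))).toNat = _
      rw [h1]
      exact ENat.toNat_add f1 f2)
  simpa using key

end abstract_filtration

theorem tendsto_relLen_pow {Q : Type*} [CommRing Q] [IsNoetherianRing Q] [IsLocalRing Q]
    {a : ℕ → Q} {I : Ideal Q} {L : ℕ → Ideal Q} {k n₀ : ℕ}
    (hI : I ≤ IsLocalRing.maximalIdeal Q) (ha : ∀ j < k + 1, a j ∈ I)
    (hCL : ∀ n, I ^ (n + 1) ≤ L n) (hLC : ∀ n, L n ≤ I ^ n)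
    (hL : ∀ j < k, ∀ n, ∀ u ∈ L n, a j * u ∈ L (n + 1))
    (hfin : ∃ N, ∀ n, IsLocalRing.maximalIdeal Q ^ N * L n ≤ I ^ (n + 1)) {x : Q}
    (hxm : x ∈ IsLocalRing.maximalIdeal Q)
    (hx : ∀ n ≥ n₀, ∀ u ∈ I ^ n, x * u ∈ L n → u ∈ L n)
    (hH : FilterRegular a (fun n => I ^ (n + 1)) L k n₀)
    (hG : FilterRegular a (fun n => I ^ (n + 1)) (fun n => I ^ n) (k + 1) n₀)
    (hGL : FilterRegular a L (fun n => I ^ n) k n₀)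
    (hY : FilterRegular a (fun n => L n ⊔ Ideal.span {x} * I ^ n) (fun n => I ^ n) k n₀)
    {K : Ideal Q} (haK : firstSpan a k ≤ K) {e : ℕ} (he : I ^ e * K ≤ firstSpan a k)
    (hnzd : ∀ u, a k * u ∈ K → u ∈ K) {r : ℕ} (hr : relLen (K ⊔ Ideal.span {a k}) ⊤ = r) :
    Tendsto (fun n : ℕ => (k.factorial : ℝ) / (n : ℝ) ^ k *
      ((relLen (I ^ (n + 1)) (L n)).toNat : ℝ)) atTop (nhds (r : ℝ)) := by
  obtain ⟨n₁, hn₁⟩ := exists_mem_sup_iff (fun j hj => ha j (by omega))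
    (hG.mono (Nat.le_succ k) le_rfl) he
  obtain ⟨n₂, hn₂⟩ := exists_pow_succ_eq hI ha hG haK he hnzd hr
  have hmul : ∀ j < k + 1, ∀ n, ∀ u ∈ I ^ n, a j * u ∈ I ^ (n + 1) := fun j hj n u hu => by
    rw [pow_succ' I n]; exact Ideal.mul_mem_mul (ha j hj) hu
  have hle : n₀ ≤ n₀ + n₁ + n₂ := by omega
  refine tendsto_relLen (C := fun n => I ^ n) (n₀ := n₀ + n₁ + n₂) hCL hLC
    (fun j hj => hmul j (by omega)) hL hfin hxm
    (fun n hn => hx n (by omega)) (hH.mono le_rfl hle) (hGL.mono le_rfl hle) (hY.mono le_rfl hle)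
    haK (fun n hn => hn₁ n (by omega)) fun n hn => ?_
  have h1 := relLen_pow_of_nonzerodivisor (ha k (Nat.lt_succ_self k)) hnzd hr n
  rw [← h1]
  congr 1
  refine le_antisymm (sup_le ?_ le_sup_left) (sup_le le_sup_right (le_sup_of_le_left ?_))
  · have h2 : I ^ (n + 1) = firstSpan a (k + 1) * I ^ n := hn₂ n (by omega)
    rw [h2, firstSpan_succ, Ideal.sup_mul]
    exact sup_le_sup_right (Ideal.mul_le_left.trans haK) _
  · rw [Ideal.span_singleton_mul_le_iff]
    exact fun u hu => hmul k (Nat.lt_succ_self k) n u hu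

section coefficients

variable {R σ : Type*} [CommRing R] (z : σ)

open Classical in
/-- Polynomials viewed as polynomials in the single variable `z`. -/
def varEquiv : MvPolynomial σ R ≃ₐ[R] Polynomial (MvPolynomial {p : σ // p ≠ z} R) :=
  (MvPolynomial.renameEquiv R (Equiv.optionSubtypeNe z).symm).trans
    (MvPolynomial.optionEquivLeft R {p : σ // p ≠ z})

theorem varEquiv_X_self : varEquiv z (MvPolynomial.X z : MvPolynomial σ R) = Polynomial.X := by
  simp [varEquiv, MvPolynomial.optionEquivLeft_X_none]

theorem varEquiv_X_of_ne {p : σ} (h : p ≠ z) : varEquiv z (MvPolynomial.X p : MvPolynomial σ R) =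
    Polynomial.C (MvPolynomial.X ⟨p, h⟩) := by
  simp [varEquiv, Equiv.optionSubtypeNe_symm_apply, h]

theorem varEquiv_C (r : R) : varEquiv z (MvPolynomial.C r : MvPolynomial σ R) =
    Polynomial.C (MvPolynomial.C r) := by
  simp [varEquiv, MvPolynomial.optionEquivLeft_C]

/-- The polynomials not involving the variable `z`. -/
def varFree (z : σ) : Subring (MvPolynomial σ R) :=
  (Polynomial.C : MvPolynomial {p : σ // p ≠ z} R →+* _).range.comap
    ((varEquiv (R := R) z : MvPolynomial σ R →+* Polynomial (MvPolynomial {p : σ // p ≠ z} R)))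

variable {z}

theorem mem_varFree {f : MvPolynomial σ R} : f ∈ varFree z ↔ ∃ s, Polynomial.C s = varEquiv z f :=
  Iff.rfl

theorem C_mem_varFree (r : R) : (MvPolynomial.C r : MvPolynomial σ R) ∈ varFree z :=
  mem_varFree.2 ⟨_, (varEquiv_C z r).symm⟩

theorem X_mem_varFree {p : σ} (h : p ≠ z) : (MvPolynomial.X p : MvPolynomial σ R) ∈ varFree z :=
  mem_varFree.2 ⟨_, (varEquiv_X_of_ne z h).symm⟩

variable (z) in
/-- The coefficient of `z ^ k`. -/
def varCoeff (k : ℕ) : MvPolynomial σ R →+ MvPolynomial σ R where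
  toFun f := (varEquiv z).symm (Polynomial.C ((varEquiv z f).coeff k))
  map_zero' := by simp
  map_add' f g := by simp

theorem varEquiv_varCoeff (k : ℕ) (f : MvPolynomial σ R) :
    varEquiv z (varCoeff z k f) = Polynomial.C ((varEquiv z f).coeff k) := by
  simp [varCoeff]

theorem varCoeff_mem_varFree (k : ℕ) (f : MvPolynomial σ R) : varCoeff z k f ∈ varFree z :=
  mem_varFree.2 ⟨_, (varEquiv_varCoeff k f).symm⟩

theorem varCoeff_mul {v : MvPolynomial σ R} (hv : v ∈ varFree z) (k : ℕ) (f : MvPolynomial σ R) :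
    varCoeff z k (v * f) = v * varCoeff z k f := by
  obtain ⟨s, hs⟩ := mem_varFree.1 hv
  apply (varEquiv z).injective
  rw [varEquiv_varCoeff, map_mul, map_mul, varEquiv_varCoeff, ← hs, Polynomial.coeff_C_mul, map_mul]

theorem varCoeff_X_mul (k : ℕ) (f : MvPolynomial σ R) :
    varCoeff z (k + 1) (MvPolynomial.X z * f) = varCoeff z k f := by
  apply (varEquiv z).injective
  rw [varEquiv_varCoeff, map_mul, varEquiv_varCoeff, varEquiv_X_self, Polynomial.coeff_X_mul]

theorem varCoeff_zero_of_mem {v : MvPolynomial σ R} (hv : v ∈ varFree z) : varCoeff z 0 v = v := by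
  obtain ⟨s, hs⟩ := mem_varFree.1 hv
  apply (varEquiv z).injective
  rw [varEquiv_varCoeff, ← hs, Polynomial.coeff_C_zero]

theorem varCoeff_succ_of_mem {v : MvPolynomial σ R} (hv : v ∈ varFree z) (k : ℕ) :
    varCoeff z (k + 1) v = 0 := by
  obtain ⟨s, hs⟩ := mem_varFree.1 hv
  apply (varEquiv z).injective
  rw [varEquiv_varCoeff, ← hs, Polynomial.coeff_C_succ]; simp

theorem exists_varCoeff_eq_zero (z : σ) (f : MvPolynomial σ R) :
    ∃ D, ∀ k ≥ D, varCoeff z k f = 0 := by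
  refine ⟨(varEquiv z f).natDegree + 1, fun k hk => (varEquiv z).injective ?_⟩
  rw [varEquiv_varCoeff, Polynomial.coeff_eq_zero_of_natDegree_lt (by omega)]; simp

theorem mem_of_varCoeff_mem {B : Ideal (MvPolynomial σ R)} {f : MvPolynomial σ R}
    (h : ∀ k, varCoeff z k f ∈ B) : f ∈ B := by
  have h1 : (varEquiv z).symm (varEquiv z f) ∈ B := by
    rw [(varEquiv z f).as_sum_range_C_mul_X_pow, map_sum]
    refine sum_mem fun k _ => ?_
    rw [map_mul]
    exact Ideal.mul_mem_right _ _ (h k)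
  simpa using h1

/-- Ideals closed under taking coefficients with respect to `z`; these are the ideals
extended from polynomials not involving `z`. -/
def IsVarFree (z : σ) (B : Ideal (MvPolynomial σ R)) : Prop :=
  ∀ f ∈ B, ∀ k, varCoeff z k f ∈ B

theorem isVarFree_span {s : Set (MvPolynomial σ R)} (hs : ∀ v ∈ s, v ∈ varFree z) :
    IsVarFree z (Ideal.span s) := by
  intro f hf k
  induction hf using Submodule.span_induction with
  | mem v hv =>
    rcases k with _ | k
    · rw [varCoeff_zero_of_mem (hs _ hv)]; exact Ideal.subset_span hv
    · rw [varCoeff_succ_of_mem (hs _ hv)]; exact zero_mem _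
  | zero => simp
  | add f g _ _ hf hg => rw [map_add]; exact add_mem hf hg
  | smul c f hf' hf =>
    clear hf
    obtain ⟨n, g, w, rfl⟩ := Submodule.mem_span_set'.1 hf'
    rw [smul_eq_mul, Finset.mul_sum, map_sum]
    refine sum_mem fun i _ => ?_
    rw [smul_eq_mul, show c * (g i * (w i : MvPolynomial σ R)) = w i * (c * g i) by ring,
      varCoeff_mul (hs _ (w i).2)]
    exact Ideal.mul_mem_right _ _ (Ideal.subset_span (w i).2)

theorem IsVarFree.sup {A B : Ideal (MvPolynomial σ R)} (hA : IsVarFree z A) (hB : IsVarFree z B) :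
    IsVarFree z (A ⊔ B) := by
  intro f hf k
  obtain ⟨u, hu, v, hv, rfl⟩ := Submodule.mem_sup.1 hf
  rw [map_add]
  exact add_mem (Ideal.mem_sup_left (hA u hu k)) (Ideal.mem_sup_right (hB v hv k))

/-- If `T = z x + t` with `x`, `t` free of `z`, multiplication by `T` is injective
up to powers of `x` modulo ideals that are free of `z`. -/
theorem exists_pow_mul_mem {B : ℕ → Ideal (MvPolynomial σ R)} {x t : MvPolynomial σ R}
    (hx : x ∈ varFree z) (ht : t ∈ varFree z) (hB : ∀ n, IsVarFree z (B n))
    (hxB : ∀ n, ∀ b ∈ B n, x * b ∈ B (n + 1)) (htB : ∀ n, ∀ b ∈ B n, t * b ∈ B (n + 1)) {n : ℕ} {u : MvPolynomial σ R}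
    (hu : (MvPolynomial.X z * x + t) * u ∈ B (n + 1)) : ∃ D, x ^ D * u ∈ B (n + D) := by
  obtain ⟨D, hD⟩ := exists_varCoeff_eq_zero z u
  have hpow : ∀ e n, ∀ b ∈ B n, x ^ e * b ∈ B (n + e) := by
    intro e
    induction e with
    | zero => intro n b hb; simpa using hb
    | succ e ih =>
      intro n b hb
      rw [pow_succ', mul_assoc, ← add_assoc]
      exact hxB _ _ (ih n b hb)
  have h1 : ∀ k, x * varCoeff z k u + t * varCoeff z (k + 1) u ∈ B (n + 1) := by
    intro k
    have := hB (n + 1) _ hu (k + 1)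
    rwa [show (MvPolynomial.X z * x + t) * u = MvPolynomial.X z * (x * u) + t * u by ring, map_add,
      varCoeff_X_mul, varCoeff_mul hx, varCoeff_mul ht] at this
  have h2 : ∀ e k, D ≤ k + e → x ^ e * varCoeff z k u ∈ B (n + e) := by
    intro e
    induction e with
    | zero => intro k hk; rw [hD k hk]; simp
    | succ e ih =>
      intro k hk
      have e1 : x ^ (e + 1) * varCoeff z k u =
          x ^ e * (x * varCoeff z k u + t * varCoeff z (k + 1) u) -
            t * (x ^ e * varCoeff z (k + 1) u) := by ring
      rw [e1]
      refine sub_mem ?_ (htB _ _ (ih (k + 1) (by omega)))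
      rw [show n + (e + 1) = n + 1 + e by ring]
      exact hpow e _ _ (h1 k)
  refine ⟨D, mem_of_varCoeff_mem (z := z) fun k => ?_⟩
  rw [varCoeff_mul (pow_mem hx D)]
  exact h2 D k (by omega)

end coefficients

section torsion

variable {Q : Type*} [CommRing Q] (J : Ideal Q) (B C : ℕ → Ideal Q)

/-- The elements of `C n` multiplied into `B (n + e)` by `J ^ e`. -/
def powTorsion (n e : ℕ) : Ideal Q := C n ⊓ (B (n + e)).colon ((J ^ e : Ideal Q) : Set Q)

variable {J B C}

theorem mem_powTorsion {n e : ℕ} {u : Q} :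
    u ∈ powTorsion J B C n e ↔ u ∈ C n ∧ J ^ e * Ideal.span {u} ≤ B (n + e) := by
  rw [powTorsion, Submodule.mem_inf, Submodule.mem_colon, mul_comm, Ideal.span_singleton_mul_le_iff]
  rfl

theorem pow_mul_le_add (hB : ∀ n, J * B n ≤ B (n + 1)) (t : ℕ) (n : ℕ) :
    J ^ t * B n ≤ B (n + t) := by
  induction t with
  | zero => simp
  | succ t ih =>
    rw [pow_succ', mul_assoc, ← add_assoc]
    exact (Ideal.mul_mono_right ih).trans (hB _)

theorem pow_add_mul_le (hB : ∀ n, J * B n ≤ B (n + 1)) {U : Ideal Q} {n e : ℕ} (t : ℕ)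
    (h : J ^ e * U ≤ B (n + e)) : J ^ (e + t) * U ≤ B (n + (e + t)) := by
  rw [add_comm e t, pow_add, mul_assoc, show n + (t + e) = n + e + t by ring]
  exact (Ideal.mul_mono_right h).trans (pow_mul_le_add hB t _)

theorem exists_le_of_powTorsion [IsNoetherianRing Q] (hBa : ∀ n, B (n + 1) ≤ B n)
    (hCa : ∀ n, C (n + 1) ≤ C n) (hB : ∀ n, J * B n ≤ B (n + 1)) (hC : ∀ n, J * C n ≤ C (n + 1))
    {n₁ : ℕ} (hCs : ∀ n ≥ n₁, C (n + 1) ≤ J * C n) :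
    ∃ n₀, ∀ n ≥ n₀, ∀ u ∈ C n, ∀ e, J ^ e * Ideal.span {u} ≤ B (n + e) → u ∈ B n := by
  have hmono : ∀ n, Monotone (powTorsion J B C n) := by
    intro n e e' hee u hu
    obtain ⟨t, rfl⟩ := Nat.exists_eq_add_of_le hee
    rw [mem_powTorsion] at hu ⊢
    exact ⟨hu.1, pow_add_mul_le hB t hu.2⟩
  let N : ℕ → Ideal Q := fun n => ⨆ e, powTorsion J B C n e
  have hmem : ∀ n u, u ∈ N n ↔ ∃ e, u ∈ powTorsion J B C n e := fun n u =>
    Submodule.mem_iSup_of_chain ⟨_, hmono n⟩ u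
  let F : J.Filtration Q := ⟨C, hCa, hC⟩
  let F' : J.Filtration Q := ⟨N, fun n u hu => by
      obtain ⟨e, he⟩ := (hmem _ _).1 hu
      rw [mem_powTorsion] at he
      refine (hmem _ _).2 ⟨e, mem_powTorsion.2 ⟨hCa _ he.1, he.2.trans ?_⟩⟩
      rw [show n + 1 + e = n + e + 1 by ring]
      exact hBa _, fun n => by
      rw [smul_eq_mul, Ideal.mul_le]
      intro w hw u hu
      obtain ⟨e, he⟩ := (hmem _ _).1 hu
      have he' := mem_powTorsion.1 (hmono n (Nat.le_succ e) he)
      refine (hmem _ _).2 ⟨e, mem_powTorsion.2 ⟨hC n (Ideal.mul_mem_mul hw he'.1), ?_⟩⟩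
      rw [← Ideal.span_singleton_mul_span_singleton, ← mul_assoc,
        show n + 1 + e = n + (e + 1) by ring]
      refine le_trans (Ideal.mul_mono_left ?_) he'.2
      rw [pow_succ]
      exact Ideal.mul_mono_right ((Ideal.span_singleton_le_iff_mem _).2 hw)⟩
  have hF : F.Stable := ⟨n₁, fun n hn => le_antisymm (hC n) (hCs n hn)⟩
  have hle : F' ≤ F := fun n u hu => by
    obtain ⟨e, he⟩ := (hmem _ _).1 hu
    exact he.1
  obtain ⟨n₂, hn₂⟩ := hF.of_le hle
  obtain ⟨e₀, he₀⟩ := monotone_stabilizes_iff_noetherian.2 inferInstance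
    (⟨_, hmono n₂⟩ : ℕ →o Ideal Q)
  have h1 : J ^ e₀ * N n₂ ≤ B (n₂ + e₀) := by
    rw [Ideal.mul_le]
    intro w hw u hu
    obtain ⟨e, he⟩ := (hmem _ _).1 hu
    have h2 : u ∈ powTorsion J B C n₂ e₀ := by
      rcases le_total e e₀ with h | h
      · exact hmono n₂ h he
      · have := he₀ e h
        change powTorsion J B C n₂ e₀ = powTorsion J B C n₂ e at this
        rwa [this]
    exact (mem_powTorsion.1 h2).2 (Ideal.mul_mem_mul hw (Ideal.mem_span_singleton_self u))
  have h2 : ∀ t, N (n₂ + t) ≤ J ^ t * N n₂ := by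
    intro t
    induction t with
    | zero => simp
    | succ t ih =>
      have : J • N (n₂ + t) = N (n₂ + t + 1) := hn₂ (n₂ + t) (by omega)
      rw [← add_assoc, ← this, pow_succ', mul_assoc]
      exact Ideal.mul_mono_right ih
  refine ⟨n₂ + e₀, fun n hn u hu e he => ?_⟩
  obtain ⟨t, rfl⟩ := Nat.exists_eq_add_of_le hn
  have h3 : u ∈ N (n₂ + (e₀ + t)) := by
    rw [← add_assoc]
    exact (hmem _ _).2 ⟨e, mem_powTorsion.2 ⟨hu, he⟩⟩
  have h4 := h2 _ h3
  rw [add_assoc]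
  exact pow_add_mul_le hB t h1 h4

theorem pow_sup_mul_le {A A' : Ideal Q} (hA : ∀ n, A * B n ≤ B (n + 1))
    (hA' : ∀ n, A' * B n ≤ B (n + 1)) (s : ℕ) : ∀ (e D n : ℕ) (U : Ideal Q), e + D = s →
    A ^ e * U ≤ B (n + e) → A' ^ D * U ≤ B (n + D) → (A ⊔ A') ^ s * U ≤ B (n + s) := by
  have hAA : ∀ n, (A ⊔ A') * B n ≤ B (n + 1) := fun n => by
    rw [Ideal.sup_mul]; exact sup_le (hA n) (hA' n)
  induction s with
  | zero =>
    intro e D n U h h1 _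
    obtain rfl : e = 0 := by omega
    simpa using h1
  | succ s ih =>
    intro e D n U h h1 h2
    rcases e with _ | e
    · have : U ≤ B n := by simpa using h1
      exact (Ideal.mul_mono_right this).trans (pow_mul_le_add hAA _ _)
    rcases D with _ | D
    · have : U ≤ B n := by simpa using h2
      exact (Ideal.mul_mono_right this).trans (pow_mul_le_add hAA _ _)
    rw [pow_succ, mul_assoc, Ideal.sup_mul, Ideal.mul_sup, show n + (s + 1) = n + 1 + s by ring]
    refine sup_le ?_ ?_
    · refine ih e (D + 1) (n + 1) (A * U) (by omega) ?_ ?_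
      · rw [← mul_assoc, ← pow_succ, show n + 1 + e = n + (e + 1) by ring]; exact h1
      · rw [mul_left_comm, show n + 1 + (D + 1) = n + (D + 1) + 1 by ring]
        exact (Ideal.mul_mono_right h2).trans (hA _)
    · refine ih (e + 1) D (n + 1) (A' * U) (by omega) ?_ ?_
      · rw [mul_left_comm, show n + 1 + (e + 1) = n + (e + 1) + 1 by ring]
        exact (Ideal.mul_mono_right h1).trans (hA' _)
      · rw [← mul_assoc, ← pow_succ, show n + 1 + D = n + (D + 1) by ring]; exact h2

theorem exists_pow_span_mul_le {ι : Type*} [Finite ι] {y : ι → Q}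
    (hy : ∀ l n, ∀ b ∈ B n, y l * b ∈ B (n + 1)) {n : ℕ} {u : Q}
    (h : ∀ l, ∃ D, y l ^ D * u ∈ B (n + D)) :
    ∃ e, Ideal.span (Set.range y) ^ e * Ideal.span {u} ≤ B (n + e) := by
  classical
  cases nonempty_fintype ι
  have key : ∀ s : Finset ι, (∀ n, Ideal.span (y '' s) * B n ≤ B (n + 1)) ∧
      ∃ e, Ideal.span (y '' s) ^ e * Ideal.span {u} ≤ B (n + e) := by
    intro s
    induction s using Finset.induction_on with
    | empty => exact ⟨by simp, 1, by simp⟩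
    | insert l s _ ih =>
      obtain ⟨h1, e, he⟩ := ih
      obtain ⟨D, hD⟩ := h l
      have h2 : ∀ n, Ideal.span {y l} * B n ≤ B (n + 1) := fun n =>
        Ideal.span_singleton_mul_le_iff.2 (hy l n)
      have e1 : Ideal.span (y '' (insert l s : Finset ι)) =
          Ideal.span {y l} ⊔ Ideal.span (y '' s) := by
        rw [Finset.coe_insert, Set.image_insert_eq, Ideal.span_insert]
      rw [e1]
      refine ⟨fun n => by rw [Ideal.sup_mul]; exact sup_le (h2 n) (h1 n), D + e, ?_⟩
      refine pow_sup_mul_le h2 h1 _ D e n _ rfl ?_ he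
      rw [Ideal.span_singleton_pow, Ideal.span_singleton_mul_span_singleton,
        Ideal.span_singleton_le_iff_mem]
      exact hD
  have := (key Finset.univ).2
  simpa using this

end torsion

section generic

variable {R : Type*} [CommRing R] {m : ℕ}

/-- The generic linear combinations of `x` for indices `j < d`, and `0` for `j ≥ d`. -/
def genElt (d : ℕ) (x : Fin m → R) (j : ℕ) : MvPolynomial (Fin d × Fin m) R :=
  if h : j < d then ∑ l, MvPolynomial.X (⟨j, h⟩, l) * MvPolynomial.C (x l) else 0

variable {d : ℕ} {x : Fin m → R}

theorem genElt_mem (j : ℕ) : genElt d x j ∈ (Ideal.span (Set.range x)).map MvPolynomial.C := by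
  unfold genElt
  split_ifs
  · exact sum_mem fun l _ => Ideal.mul_mem_left _ _
      (Ideal.mem_map_of_mem _ (Ideal.subset_span ⟨l, rfl⟩))
  · exact zero_mem _

theorem genElt_eq {j : ℕ} (hj : j < d) (l : Fin m) :
    ∃ t ∈ varFree ((⟨j, hj⟩ : Fin d), l), t ∈ (Ideal.span (Set.range x)).map MvPolynomial.C ∧
      genElt d x j = MvPolynomial.X (⟨j, hj⟩, l) * MvPolynomial.C (x l) + t := by
  refine ⟨∑ l' ∈ Finset.univ.erase l, MvPolynomial.X (⟨j, hj⟩, l') * MvPolynomial.C (x l'),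
    sum_mem fun l' hl' => ?_, sum_mem fun l' _ => ?_, ?_⟩
  · refine mul_mem (X_mem_varFree fun h => ?_) (C_mem_varFree _)
    exact Finset.ne_of_mem_erase hl' (Prod.ext_iff.1 h).2
  · exact Ideal.mul_mem_left _ _ (Ideal.mem_map_of_mem _ (Ideal.subset_span ⟨l', rfl⟩))
  · rw [genElt, dif_pos hj]
    exact (Finset.add_sum_erase _ _ (Finset.mem_univ l)).symm

theorem genElt_mem_varFree {i j : ℕ} (hj : j < d) (hij : i ≠ j) (l : Fin m) :
    genElt d x i ∈ varFree ((⟨j, hj⟩ : Fin d), l) := by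
  unfold genElt
  split_ifs
  · refine sum_mem fun l' _ => mul_mem (X_mem_varFree fun h => hij ?_) (C_mem_varFree _)
    simpa using (Prod.ext_iff.1 h).1
  · exact zero_mem _

open scoped Pointwise in
theorem firstSpan_mul_map (A : Ideal R) (i : ℕ) : firstSpan (genElt d x) i * A.map MvPolynomial.C =
    Ideal.span ((genElt d x '' {j | j < i} : Set (MvPolynomial (Fin d × Fin m) R)) *
      (MvPolynomial.C '' (A : Set R) : Set (MvPolynomial (Fin d × Fin m) R))) := by
  rw [firstSpan, Ideal.map, Ideal.span_mul_span']

theorem isVarFree_map (z : Fin d × Fin m) (A : Ideal R) : IsVarFree z (A.map MvPolynomial.C) :=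
  isVarFree_span (by rintro _ ⟨r, -, rfl⟩; exact C_mem_varFree r)

theorem isVarFree_firstSpan {j : ℕ} (hj : j < d) (l : Fin m) :
    IsVarFree ((⟨j, hj⟩ : Fin d), l) (firstSpan (genElt d x) j) :=
  isVarFree_span (by rintro _ ⟨i, hi, rfl⟩; exact genElt_mem_varFree hj (ne_of_lt hi) l)

theorem isVarFree_firstSpan_mul {j : ℕ} (hj : j < d) (l : Fin m) (A : Ideal R) :
    IsVarFree ((⟨j, hj⟩ : Fin d), l) (firstSpan (genElt d x) j * A.map MvPolynomial.C) := by
  rw [firstSpan_mul_map]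
  refine isVarFree_span ?_
  rintro _ ⟨_, ⟨i, hi, rfl⟩, _, ⟨r, -, rfl⟩, rfl⟩
  exact mul_mem (genElt_mem_varFree hj (ne_of_lt hi) l) (C_mem_varFree r)

theorem map_C_span_range : (Ideal.span (Set.range x)).map (MvPolynomial.C (σ := Fin d × Fin m)) =
    Ideal.span (Set.range fun l => MvPolynomial.C (x l)) := by
  rw [Ideal.map_span, ← Set.range_comp]; rfl

theorem exists_pow_genElt {B : ℕ → Ideal (MvPolynomial (Fin d × Fin m) R)} {j : ℕ} (hj : j < d)
    (hB : ∀ n l, IsVarFree ((⟨j, hj⟩ : Fin d), l) (B n))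
    (hJB : ∀ n, (Ideal.span (Set.range x)).map MvPolynomial.C * B n ≤ B (n + 1)) {n : ℕ}
    {u : MvPolynomial (Fin d × Fin m) R} (hu : genElt d x j * u ∈ B (n + 1)) :
    ∃ e, (Ideal.span (Set.range x)).map MvPolynomial.C ^ e * Ideal.span {u} ≤ B (n + e) := by
  have hx : ∀ l, MvPolynomial.C (x l) ∈
      (Ideal.span (Set.range x)).map (MvPolynomial.C (σ := Fin d × Fin m)) := fun l =>
    Ideal.mem_map_of_mem _ (Ideal.subset_span ⟨l, rfl⟩)
  have hxB : ∀ l n, ∀ b ∈ B n, MvPolynomial.C (x l) * b ∈ B (n + 1) := fun l n b hb =>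
    hJB n (Ideal.mul_mem_mul (hx l) hb)
  rw [map_C_span_range]
  refine exists_pow_span_mul_le hxB fun l => ?_
  obtain ⟨t, ht, htJ, e⟩ := genElt_eq (x := x) hj l
  rw [e] at hu
  exact exists_pow_mul_mem (C_mem_varFree _) ht (fun n => hB n l) (hxB l)
    (fun n b hb => hJB n (Ideal.mul_mem_mul htJ hb)) hu

theorem exists_filterRegular_genElt [IsNoetherianRing R] {B C : ℕ → Ideal R}
    (hBa : ∀ n, B (n + 1) ≤ B n) (hCa : ∀ n, C (n + 1) ≤ C n)
    (hB : ∀ n, Ideal.span (Set.range x) * B n ≤ B (n + 1))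
    (hC : ∀ n, Ideal.span (Set.range x) * C n ≤ C (n + 1))
    {n₁ : ℕ} (hCs : ∀ n ≥ n₁, C (n + 1) ≤ Ideal.span (Set.range x) * C n) {i : ℕ} (hi : i ≤ d) :
    ∃ n₀, FilterRegular (genElt d x) (fun n => (B n).map MvPolynomial.C)
      (fun n => (C n).map MvPolynomial.C) i n₀ := by
  induction i with
  | zero => exact ⟨0, fun j hj => absurd hj (Nat.not_lt_zero j)⟩
  | succ j ih =>
    obtain ⟨n₂, hn₂⟩ := ih (by omega)
    let B' : ℕ → Ideal (MvPolynomial (Fin d × Fin m) R) := fun n =>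
      (B n).map MvPolynomial.C ⊔ firstSpan (genElt d x) j * (C (n - 1)).map MvPolynomial.C
    have hJC' : ∀ n, Ideal.span (Set.range x) * C (n - 1) ≤ C (n + 1 - 1) := by
      intro n
      rcases n with _ | n
      · exact Ideal.mul_le_right
      · exact hC n
    have hJB' : ∀ n, (Ideal.span (Set.range x)).map MvPolynomial.C * B' n ≤ B' (n + 1) := by
      intro n
      rw [Ideal.mul_sup, ← Ideal.map_mul, mul_left_comm, ← Ideal.map_mul]
      exact sup_le_sup (Ideal.map_mono (hB n)) (Ideal.mul_mono_right (Ideal.map_mono (hJC' n)))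
    obtain ⟨n₀, hn₀⟩ := exists_le_of_powTorsion
      (J := (Ideal.span (Set.range x)).map (MvPolynomial.C (σ := Fin d × Fin m))) (B := B')
      (C := fun n => (C n).map MvPolynomial.C) (fun n => by
        refine sup_le_sup (Ideal.map_mono (hBa n)) (Ideal.mul_mono_right (Ideal.map_mono ?_))
        rcases n with _ | n
        · exact le_rfl
        · exact hCa n)
      (fun n => Ideal.map_mono (hCa n)) hJB'
      (fun n => by rw [← Ideal.map_mul]; exact Ideal.map_mono (hC n)) (n₁ := n₁)
      (fun n hn => by rw [← Ideal.map_mul]; exact Ideal.map_mono (hCs n hn))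
    refine ⟨n₀ + n₂, fun i hi' n hn u hu h => ?_⟩
    rcases Nat.lt_succ_iff_lt_or_eq.1 hi' with h1 | rfl
    · exact hn₂ i h1 n (by omega) u hu h
    · obtain ⟨e, he⟩ := exists_pow_genElt (B := B') (n := n + 1) (by omega)
        (fun n l => (isVarFree_map _ _).sup (isVarFree_firstSpan_mul _ l _)) hJB' h
      exact hn₀ (n + 1) (by omega) u hu e he

end generic

section localization

variable {A Q : Type*} [CommRing A] [CommRing Q] [Algebra A Q]

theorem mem_map_of_mul_mem_map (M : Submonoid A) [IsLocalization M Q] {U B D : Ideal A} {t : A} (h : ∀ u ∈ U, t * u ∈ B → u ∈ D) :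
    ∀ u ∈ U.map (algebraMap A Q), algebraMap A Q t * u ∈ B.map (algebraMap A Q) →
      u ∈ D.map (algebraMap A Q) := by
  intro u hu htu
  obtain ⟨⟨v, s⟩, hv⟩ := (IsLocalization.mem_map_algebraMap_iff M Q).1 hu
  have h1 : algebraMap A Q (t * v) ∈ B.map (algebraMap A Q) := by
    rw [map_mul, ← hv, ← mul_assoc]
    exact Ideal.mul_mem_right _ _ htu
  obtain ⟨s', hs', h2⟩ := (IsLocalization.algebraMap_mem_map_algebraMap_iff M Q _ _).1 h1
  have h3 : s' * (v : A) ∈ D := by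
    refine h _ (U.mul_mem_left _ v.2) ?_
    rwa [mul_left_comm]
  have h4 : algebraMap A Q (s' * v) ∈ D.map (algebraMap A Q) := Ideal.mem_map_of_mem _ h3
  rw [map_mul, ← hv, Ideal.unit_mul_mem_iff_mem _ (IsLocalization.map_units Q ⟨s', hs'⟩)] at h4
  exact (Ideal.mul_unit_mem_iff_mem _ (IsLocalization.map_units Q s)).1 h4

theorem map_firstSpan (a : ℕ → A) (i : ℕ) : (firstSpan a i).map (algebraMap A Q) =
    firstSpan (fun j => algebraMap A Q (a j)) i := by
  rw [firstSpan, firstSpan, Ideal.map_span, Set.image_image]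

theorem FilterRegular.map (M : Submonoid A) [IsLocalization M Q] {a : ℕ → A} {B C : ℕ → Ideal A} {i n₀ : ℕ}
    (h : FilterRegular a B C i n₀) :
    FilterRegular (fun j => algebraMap A Q (a j)) (fun n => (B n).map (algebraMap A Q))
      (fun n => (C n).map (algebraMap A Q)) i n₀ := by
  intro j hj n hn u hu hau
  rw [← map_firstSpan, ← Ideal.map_mul, ← Ideal.map_sup] at hau ⊢
  exact mem_map_of_mul_mem_map M (h j hj n hn) u hu hau

end localization

section varPrime

variable {R σ : Type*} [CommRing R] {z : σ}

/-- The elements all of whose coefficients with respect to `z` lie in `q`. -/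
def varPrime (z : σ) (q : Ideal (MvPolynomial σ R)) : Ideal (MvPolynomial σ R) :=
  ((q.comap (((varEquiv (R := R) z).symm : _ →+* MvPolynomial σ R).comp Polynomial.C)).map
    Polynomial.C).comap
      (varEquiv (R := R) z : MvPolynomial σ R →+* Polynomial (MvPolynomial {p : σ // p ≠ z} R))

theorem mem_varPrime {q : Ideal (MvPolynomial σ R)} {f : MvPolynomial σ R} :
    f ∈ varPrime z q ↔ ∀ k, varCoeff z k f ∈ q := by
  rw [varPrime, Ideal.mem_comap, Ideal.mem_map_C_iff]
  rfl

instance isPrime_varPrime (q : Ideal (MvPolynomial σ R)) [q.IsPrime] : (varPrime z q).IsPrime := by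
  unfold varPrime
  infer_instance

theorem varPrime_le (q : Ideal (MvPolynomial σ R)) : varPrime z q ≤ q := fun _ hf =>
  mem_of_varCoeff_mem (mem_varPrime.1 hf)

theorem IsVarFree.le_varPrime {B q : Ideal (MvPolynomial σ R)} (hB : IsVarFree z B) (h : B ≤ q) :
    B ≤ varPrime z q := fun f hf => mem_varPrime.2 fun k => h (hB f hf k)

theorem height_varPrime_add_one_le {q : Ideal (MvPolynomial σ R)} [q.IsPrime]
    {y : MvPolynomial σ R} (hy : y ∈ q) (hy1 : varCoeff z 1 y ∉ q) :
    (varPrime z q).height + 1 ≤ q.height :=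
  Ideal.height_add_one_le_of_lt_of_isPrime
    (lt_of_le_of_ne (varPrime_le q) fun h => hy1 (mem_varPrime.1 (h.symm.le hy) 1))

theorem height_comap_C_le [IsNoetherianRing R] [Finite σ] (q : Ideal (MvPolynomial σ R)) [q.IsPrime] :
    (q.comap MvPolynomial.C).height ≤ q.height := by
  have : q.LiesOver (q.comap (algebraMap R (MvPolynomial σ R))) := ⟨rfl⟩
  have := Ideal.height_eq_height_add_of_liesOver_of_hasGoingDown
    (q.comap (algebraMap R (MvPolynomial σ R))) q
  rw [this]
  exact le_self_add

end varPrime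

section generators

theorem exists_subset_card_le {A : Type*} [CommRing A] [IsLocalRing A] {m : ℕ} (x : Fin m → A)
    (t : Finset A) (ht : Ideal.span (t : Set A) = Ideal.span (Set.range x)) :
    ∃ s : Finset (Fin m), Ideal.span (x '' s) = Ideal.span (Set.range x) ∧ s.card ≤ t.card := by
  classical
  have hne : ∃ k, ∃ s : Finset (Fin m),
      Ideal.span (x '' s) = Ideal.span (Set.range x) ∧ s.card = k :=
    ⟨_, Finset.univ, by simp, rfl⟩
  obtain ⟨s, hs, hk⟩ := Nat.find_spec hne
  refine ⟨s, hs, ?_⟩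
  by_contra! hlt
  have h1 : ∀ l : s, ∃ c : t → A, ∑ i, c i • (i : A) = x l := fun l => by
    have : x l ∈ Ideal.span (Set.range ((↑) : t → A)) := by
      rw [Subtype.range_coe_subtype]
      simp only [SetLike.setOfPred_mem_eq] 
      rw [ht]
      exact Ideal.subset_span ⟨_, rfl⟩
    exact Submodule.mem_span_range_iff_exists_fun A |>.1 this
  have h2 : ∀ i : t, ∃ c : s → A, ∑ l, c l • x l = (i : A) := fun i => by
    have : (i : A) ∈ Ideal.span (Set.range fun l : s => x l) := by
      have e : Set.range (fun l : s => x l) = x '' s := by ext; simp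
      rw [e, hs, ← ht]
      exact Ideal.subset_span i.2
    exact Submodule.mem_span_range_iff_exists_fun A |>.1 this
  choose N hN using h1
  choose M hM using h2
  let NM : Matrix s s A := Matrix.of N * Matrix.of M
  have hx : ∀ l : s, ∑ l', NM l l' * x l' = x l := by
    intro l
    simp only [NM, Matrix.mul_apply, Matrix.of_apply, Finset.sum_mul]
    rw [Finset.sum_comm, ← hN l]
    refine Finset.sum_congr rfl fun i _ => ?_
    rw [← hM i, Finset.smul_sum]
    exact Finset.sum_congr rfl fun l' _ => by simp [mul_assoc]
  have hne1 : NM.map (IsLocalRing.residue A) ≠ 1 := by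
    intro h
    have h3 : ((Matrix.of N).map (IsLocalRing.residue A) *
        (Matrix.of M).map (IsLocalRing.residue A)).rank ≤ Fintype.card t :=
      (Matrix.rank_mul_le_left _ _).trans (Matrix.rank_le_card_width _)
    rw [← Matrix.map_mul, show Matrix.of N * Matrix.of M = NM from rfl, h, Matrix.rank_one] at h3
    simp only [Fintype.card_coe] at h3
    omega
  have hex : ∃ l l' : s, IsUnit ((1 - NM) l l') := by
    by_contra! h
    apply hne1
    ext l l'
    have h3 := (IsLocalRing.residue_eq_zero_iff _).2 ((IsLocalRing.mem_maximalIdeal _).2 (h l l'))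
    rw [Matrix.sub_apply, map_sub, sub_eq_zero] at h3
    rw [Matrix.map_apply, ← h3, Matrix.one_apply, Matrix.one_apply]
    split_ifs <;> simp
  obtain ⟨l, l', u, hu⟩ := hex
  have h0 : ∑ r, (1 - NM) l r * x r = 0 := by
    simp only [Matrix.sub_apply, sub_mul, Finset.sum_sub_distrib, hx]
    simp [Matrix.one_apply]
  rw [← Finset.add_sum_erase _ _ (Finset.mem_univ l'), ← hu] at h0
  have hmem : x l' ∈ Ideal.span (x '' (s.erase l' : Finset _)) := by
    rw [← Ideal.unit_mul_mem_iff_mem _ u.isUnit, eq_neg_of_add_eq_zero_left h0]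
    refine neg_mem (sum_mem fun r hr => Ideal.mul_mem_left _ _ (Ideal.subset_span ⟨r, ?_, rfl⟩))
    have h4 : r ≠ l' := Finset.ne_of_mem_erase hr
    exact Finset.mem_coe.2 (Finset.mem_erase.2 ⟨fun h => h4 (Subtype.ext h), r.2⟩)
  refine Nat.find_min hne (m := (s.erase l').card) ?_ ⟨_, le_antisymm ?_ ?_, rfl⟩
  · rw [← hk]; exact Finset.card_erase_lt_of_mem l'.2
  · exact Ideal.span_mono (Set.image_subset_range _ _)
  · rw [← hs, Ideal.span_le]
    rintro _ ⟨r, hr, rfl⟩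
    by_cases e : r = l'
    · rw [e]; exact hmem
    · exact Ideal.subset_span ⟨r, by simpa [e] using hr, rfl⟩

end generators

section genericHeights

variable {R : Type*} [CommRing R] {m d : ℕ} {x : Fin m → R}

/-- An ideal containing `i` generic linear combinations of `x` but not all of `x`
has height at least `i`. -/
theorem le_height_of_firstSpan_le {i : ℕ} (hi : i ≤ d) (q : Ideal (MvPolynomial (Fin d × Fin m) R))
    [q.IsPrime] (ha : firstSpan (genElt d x) i ≤ q)
    (hJ : ¬ (Ideal.span (Set.range x)).map MvPolynomial.C ≤ q) : (i : ℕ∞) ≤ q.height := by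
  induction i generalizing q with
  | zero => simp
  | succ i ih =>
    obtain ⟨l, hl⟩ : ∃ l, MvPolynomial.C (x l) ∉ q := by
      by_contra! h
      apply hJ
      rw [map_C_span_range, Ideal.span_le]
      rintro _ ⟨l, rfl⟩
      exact h l
    have hid : i < d := by omega
    set z : Fin d × Fin m := (⟨i, hid⟩, l)
    have h1 := ih (by omega) (varPrime z q)
      ((isVarFree_firstSpan hid l).le_varPrime ((firstSpan_mono _ (Nat.le_succ i)).trans ha))
      (fun h => hJ (h.trans (varPrime_le q)))
    have hy : varCoeff z 1 (genElt d x i) = MvPolynomial.C (x l) := by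
      obtain ⟨t, ht, -, e⟩ := genElt_eq (x := x) hid l
      rw [e, map_add, varCoeff_X_mul, varCoeff_zero_of_mem (C_mem_varFree _),
        varCoeff_succ_of_mem ht, add_zero]
    push_cast
    exact (add_le_add_left h1 1).trans (height_varPrime_add_one_le (z := z)
      (ha (mem_firstSpan _ (Nat.lt_succ_self i))) (by rwa [hy]))

theorem isVarFree_span_C (z : Fin d × Fin m) (s : Finset (Fin m)) :
    IsVarFree z (Ideal.span ((fun l => MvPolynomial.C (x l)) '' (s : Set (Fin m)))) :=
  isVarFree_span (by rintro _ ⟨l, -, rfl⟩; exact C_mem_varFree _)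

theorem exists_varFree_mul_mem {i : ℕ} (hi : i < d) {l' : Fin m}
    {q : Ideal (MvPolynomial (Fin d × Fin m) R)}
    {s : Finset (Fin m)} {g : MvPolynomial (Fin d × Fin m) R} (hg : g ∉ q)
    (hgs : ∀ l, g * MvPolynomial.C (x l) ∈
      firstSpan (genElt d x) i ⊔ Ideal.span ((fun l => MvPolynomial.C (x l)) '' (s : Set (Fin m)))) :
    ∃ g ∈ varFree ((⟨i, hi⟩ : Fin d), l'), g ∉ q ∧ ∀ l, g * MvPolynomial.C (x l) ∈
      firstSpan (genElt d x) i ⊔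
        Ideal.span ((fun l => MvPolynomial.C (x l)) '' (s : Set (Fin m))) := by
  set z : Fin d × Fin m := (⟨i, hi⟩, l')
  obtain ⟨k, hk⟩ : ∃ k, varCoeff z k g ∉ q := by
    by_contra! h
    exact hg (mem_of_varCoeff_mem h)
  refine ⟨varCoeff z k g, varCoeff_mem_varFree k g, hk, fun l => ?_⟩
  rw [mul_comm, ← varCoeff_mul (C_mem_varFree _), mul_comm]
  exact ((isVarFree_firstSpan hi l').sup (isVarFree_span_C z s)) _ (hgs l) k

theorem add_le_height
    (hbase : ∀ q : Ideal (MvPolynomial (Fin d × Fin m) R), q.IsPrime →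
      (Ideal.span (Set.range x)).map MvPolynomial.C ≤ q →
      (q.comap MvPolynomial.C).height < d → ∃ s : Finset (Fin m), (s.card : ℕ∞) ≤ q.height ∧
        ∃ g ∉ q, ∀ l, g * MvPolynomial.C (x l) ∈
          Ideal.span ((fun l => MvPolynomial.C (x l)) '' (s : Set (Fin m))))
    {i : ℕ} (hi : i ≤ d) {k : ℕ} (hk : 1 ≤ k) (q : Ideal (MvPolynomial (Fin d × Fin m) R))
    [q.IsPrime] (hJ : (Ideal.span (Set.range x)).map MvPolynomial.C ≤ q)
    (hd : (q.comap MvPolynomial.C).height < d)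
    (h : ∀ s : Finset (Fin m), ∀ g ∉ q, (∀ l, g * MvPolynomial.C (x l) ∈
      firstSpan (genElt d x) i ⊔ Ideal.span ((fun l => MvPolynomial.C (x l)) '' (s : Set (Fin m))))
      → k ≤ s.card) : ((i + k : ℕ) : ℕ∞) ≤ q.height := by
  classical
  induction i generalizing q k with
  | zero =>
    obtain ⟨s, hs, g, hg, hgs⟩ := hbase q inferInstance hJ hd
    have := h s g hg (fun l => Ideal.mem_sup_right (hgs l))
    rw [zero_add]
    exact (Nat.cast_le.2 this).trans hs
  | succ i ih =>
    have hid : i < d := by omega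
    have hmono : firstSpan (genElt d x) i ≤ firstSpan (genElt d x) (i + 1) :=
      firstSpan_mono _ (Nat.le_succ i)
    by_cases hc : ∀ s : Finset (Fin m), ∀ g ∉ q, (∀ l, g * MvPolynomial.C (x l) ∈
      firstSpan (genElt d x) i ⊔ Ideal.span ((fun l => MvPolynomial.C (x l)) '' (s : Set (Fin m))))
      → k + 1 ≤ s.card
    · have := ih (by omega) (by omega) q hJ hd hc
      rwa [show i + 1 + k = i + (k + 1) by omega]
    push Not at hc
    obtain ⟨s, g₀, hg₀, hgs₀, hsk⟩ := hc
    have hsk' := h s g₀ hg₀ (fun l => sup_le_sup_right hmono _ (hgs₀ l))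
    obtain ⟨l', hl'⟩ : s.Nonempty := Finset.card_pos.1 (by omega)
    set z : Fin d × Fin m := (⟨i, hid⟩, l') with hz
    obtain ⟨g, hgz, hg, hgs⟩ := exists_varFree_mul_mem hid (l' := l') hg₀ hgs₀
    set B := firstSpan (genElt d x) i ⊔
      Ideal.span ((fun l => MvPolynomial.C (x l)) '' ((s.erase l' : Finset (Fin m)) : Set (Fin m)))
      with hB
    have hBz : IsVarFree z B := (isVarFree_firstSpan hid l').sup (isVarFree_span_C z _)
    have hsup : firstSpan (genElt d x) i ⊔
        Ideal.span ((fun l => MvPolynomial.C (x l)) '' (s : Set (Fin m))) =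
        B ⊔ Ideal.span {MvPolynomial.C (x l')} := by
      rw [hB, sup_assoc, ← Ideal.span_union, ← Set.image_singleton (f := fun l => MvPolynomial.C (x l)),
        ← Set.image_union]
      congr 3
      ext r
      by_cases e : r = l' <;> simp [e, hl']
    have h1 : ∀ l, ∃ e ∈ varFree z,
        g * MvPolynomial.C (x l) - e * MvPolynomial.C (x l') ∈ B := by
      intro l
      have := hgs l
      rw [hsup] at this
      obtain ⟨b, hb, c, hc, e⟩ := Submodule.mem_sup.1 this
      obtain ⟨f, rfl⟩ := Ideal.mem_span_singleton'.1 hc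
      refine ⟨varCoeff z 0 f, varCoeff_mem_varFree _ _, ?_⟩
      have h2 := hBz b hb 0
      rwa [eq_sub_of_add_eq e, map_sub, varCoeff_zero_of_mem (mul_mem hgz (C_mem_varFree _)),
        mul_comm f, varCoeff_mul (C_mem_varFree _), mul_comm (MvPolynomial.C (x l')) (varCoeff z 0 f)] at h2
    choose e hez he using h1
    set y := MvPolynomial.X z * g +
      ∑ l ∈ Finset.univ.erase l', MvPolynomial.X (⟨i, hid⟩, l) * e l with hy
    have hy1 : varCoeff z 1 y = g := by
      have h3 : ∑ l ∈ Finset.univ.erase l', MvPolynomial.X (⟨i, hid⟩, l) * e l ∈ varFree z := by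
        refine sum_mem fun l hl => mul_mem (X_mem_varFree fun h => ?_) (hez l)
        exact Finset.ne_of_mem_erase hl (Prod.ext_iff.1 h).2
      rw [hy, map_add, varCoeff_X_mul, varCoeff_zero_of_mem hgz, varCoeff_succ_of_mem h3, add_zero]
    have hyB : y * MvPolynomial.C (x l') ∈ firstSpan (genElt d x) (i + 1) ⊔
        Ideal.span ((fun l => MvPolynomial.C (x l)) ''
          ((s.erase l' : Finset (Fin m)) : Set (Fin m))) := by
      have h4 : y * MvPolynomial.C (x l') = g * genElt d x i -
          ∑ l ∈ Finset.univ.erase l', MvPolynomial.X (⟨i, hid⟩, l) *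
            (g * MvPolynomial.C (x l) - e l * MvPolynomial.C (x l')) := by
        rw [genElt, dif_pos hid, ← Finset.add_sum_erase _ _ (Finset.mem_univ l'), hy, add_mul,
          mul_add, Finset.sum_mul, Finset.mul_sum, add_sub_assoc, ← Finset.sum_sub_distrib]
        congr 1
        · ring
        · exact Finset.sum_congr rfl fun l _ => by ring
      rw [h4]
      refine sub_mem (Ideal.mem_sup_left (Ideal.mul_mem_left _ _
        (mem_firstSpan _ (Nat.lt_succ_self i)))) (sum_mem fun l _ => Ideal.mul_mem_left _ _ ?_)
      exact sup_le_sup_right hmono _ (he l)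
    have hyq : y ∈ q := by
      by_contra hyq
      have hprod : y * g ∉ q := fun h => ((Ideal.IsPrime.mem_or_mem ‹_› h).elim hyq hg)
      have := h (s.erase l') (y * g) hprod fun l => by
        have h5 : y * g * MvPolynomial.C (x l) = y * (g * MvPolynomial.C (x l) -
          e l * MvPolynomial.C (x l')) + e l * (y * MvPolynomial.C (x l')) := by ring
        rw [h5]
        exact add_mem (Ideal.mul_mem_left _ _ (sup_le_sup_right hmono _ (he l)))
          (Ideal.mul_mem_left _ _ hyB)
      rw [Finset.card_erase_of_mem hl'] at this
      omega
    have hcomap : (varPrime z q).comap MvPolynomial.C ≤ q.comap MvPolynomial.C :=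
      Ideal.comap_mono (varPrime_le q)
    have h6 := ih (by omega) hk (varPrime z q) ((isVarFree_map z _).le_varPrime hJ)
      ((Ideal.height_mono hcomap).trans_lt hd) (fun s' g' hg' hgs' => by
        obtain ⟨n, hn⟩ : ∃ n, varCoeff z n g' ∉ q := by
          by_contra! h; exact hg' (mem_varPrime.2 h)
        refine h s' (varCoeff z n g') hn fun l => sup_le_sup_right hmono _ ?_
        rw [mul_comm, ← varCoeff_mul (C_mem_varFree _), mul_comm]
        exact ((isVarFree_firstSpan hid l').sup (isVarFree_span_C z s')) _ (hgs' l) n)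
    have h7 := height_varPrime_add_one_le (z := z) hyq (by rwa [hy1])
    rw [show i + 1 + k = i + k + 1 by omega]
    push_cast at h6 ⊢
    exact (add_le_add_left h6 1).trans h7

end genericHeights

section associated

variable {R : Type*} [CommRing R]

/-- `P` is an associated prime of `R ⧸ K`, of the form `K : w`. -/
def IsAss (K P : Ideal R) : Prop := P.IsPrime ∧ ∃ w, ∀ y, y ∈ P ↔ y * w ∈ K

theorem IsAss.le {K P : Ideal R} (h : IsAss K P) : K ≤ P := fun y hy => by
  obtain ⟨-, w, hw⟩ := h
  exact (hw y).2 (Ideal.mul_mem_right _ _ hy)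

theorem mem_bot_colon_mk {K : Ideal R} {w y : R} :
    y ∈ (⊥ : Submodule R (R ⧸ K)).colon {Ideal.Quotient.mk K w} ↔ y * w ∈ K := by
  rw [Submodule.mem_colon_singleton, Submodule.mem_bot, Algebra.smul_def,
    Ideal.Quotient.algebraMap_eq, ← map_mul, Ideal.Quotient.eq_zero_iff_mem]

theorem exists_mem_forall_notMem {S : Set (Ideal R)} (hS : S.Finite) (hp : ∀ P ∈ S, P.IsPrime)
    {J : Ideal R} (hJ : ∀ P ∈ S, ¬ J ≤ P) : ∃ y ∈ J, ∀ P ∈ S, y ∉ P := by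
  by_contra! h
  have h1 : (J : Set R) ⊆ ⋃ P ∈ (hS.toFinset : Set (Ideal R)), P := fun y hy => by
    obtain ⟨P, hP, hyP⟩ := h y hy
    exact Set.mem_biUnion (by simpa using hP) hyP
  obtain ⟨P, hP, hle⟩ := (Ideal.subset_union_prime (f := fun P => P) ⊥ ⊥
    (fun P hP _ _ => hp P (by simpa using hP))).1 h1
  exact hJ P (by simpa using hP) hle

theorem notMem_of_isAss {K P : Ideal R} {y : R} (hy : ∀ u, y * u ∈ K → u ∈ K) (hP : IsAss K P) :
    y ∉ P := by
  obtain ⟨hp, w, hw⟩ := hP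
  intro h
  exact hp.ne_top ((Ideal.eq_top_iff_one _).2 ((hw 1).2 (by simpa using hy w ((hw y).1 h))))

variable [IsNoetherianRing R]

theorem isAss_iff {K P : Ideal R} : IsAss K P ↔ P ∈ associatedPrimes R (R ⧸ K) := by
  rw [AssociatedPrimes.mem_iff, isAssociatedPrime_iff, IsAss, and_congr_right_iff]
  refine fun _ => ⟨?_, ?_⟩
  · rintro ⟨w, hw⟩
    exact ⟨Ideal.Quotient.mk K w, Ideal.ext fun y => (hw y).trans mem_bot_colon_mk.symm⟩
  · rintro ⟨x, rfl⟩
    obtain ⟨w, rfl⟩ := Ideal.Quotient.mk_surjective x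
    exact ⟨w, fun y => mem_bot_colon_mk⟩

theorem finite_isAss (K : Ideal R) : {P | IsAss K P}.Finite :=
  (associatedPrimes.finite R (R ⧸ K)).subset fun _ h => isAss_iff.1 h

theorem exists_isAss_of_notMem {K : Ideal R} {w : R} (hw : w ∉ K) :
    ∃ P, IsAss K P ∧ ∀ y, y * w ∈ K → y ∈ P := by
  obtain ⟨P, hP, h⟩ := exists_le_isAssociatedPrime_of_isNoetherianRing R (Ideal.Quotient.mk K w)
    (by rwa [Ne, Ideal.Quotient.eq_zero_iff_mem])
  exact ⟨P, isAss_iff.2 hP, fun y hy => h (mem_bot_colon_mk.2 hy)⟩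

theorem isAss_of_mem_minimalPrimes {K P : Ideal R} (h : P ∈ K.minimalPrimes) : IsAss K P := by
  rw [isAss_iff]
  apply Module.associatedPrimes.minimalPrimes_annihilator_subset_associatedPrimes
  rwa [Ideal.annihilator_quotient]

theorem mem_of_mul_mem_of_isAss {K : Ideal R} {y : R} (hy : ∀ P, IsAss K P → y ∉ P) :
    ∀ u, y * u ∈ K → u ∈ K := by
  intro u hu
  by_contra h
  obtain ⟨P, hP, hle⟩ := exists_isAss_of_notMem h
  exact hy P hP (hle y hu)

end associated

section colon

variable {R : Type*} [CommRing R]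

/-- The colon ideal of two ideals. -/
abbrev colonI (A B : Ideal R) : Ideal R := Submodule.colon A (B : Set R)

theorem mem_colon_ideal {A B : Ideal R} {u : R} :
    u ∈ Submodule.colon A (B : Set R) ↔ ∀ b ∈ B, u * b ∈ A := by
  rw [Submodule.mem_colon]; rfl

theorem le_colon_iff {A B C : Ideal R} : C ≤ Submodule.colon A (B : Set R) ↔ C * B ≤ A := by
  rw [Ideal.mul_le]
  exact ⟨fun h u hu b hb => mem_colon_ideal.1 (h hu) b hb,
    fun h u hu => mem_colon_ideal.2 fun b hb => h u hu b hb⟩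

theorem colon_mul_le (A B : Ideal R) : Submodule.colon A (B : Set R) * B ≤ A :=
  le_colon_iff.1 le_rfl

theorem le_colon_self (A B : Ideal R) : A ≤ Submodule.colon A (B : Set R) :=
  le_colon_iff.2 Ideal.mul_le_left

theorem exists_colon_pow_stable [IsNoetherianRing R] (A J : Ideal R) :
    ∃ e, ∀ n, Submodule.colon A ((J ^ n : Ideal R) : Set R) ≤
      Submodule.colon A ((J ^ e : Ideal R) : Set R) := by
  have hmono : Monotone fun n => Submodule.colon A ((J ^ n : Ideal R) : Set R) := fun n k hnk =>
    Submodule.colon_mono le_rfl (Ideal.pow_le_pow_right hnk)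
  obtain ⟨e, he⟩ := monotone_stabilizes_iff_noetherian.2 (inferInstance : IsNoetherian R R)
    ⟨_, hmono⟩
  refine ⟨e, fun n => ?_⟩
  rcases le_total n e with h | h
  · exact hmono h
  · exact (he n h).ge

end colon

section heights

variable {R : Type*} [CommRing R] [IsNoetherianRing R] {m d : ℕ} {x : Fin m → R}

theorem exists_subset_mul_mem_span (hG : SatisfiesG (Ideal.span (Set.range x)) d)
    (q : Ideal (MvPolynomial (Fin d × Fin m) R)) [q.IsPrime]
    (hJ : (Ideal.span (Set.range x)).map MvPolynomial.C ≤ q)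
    (hd : (q.comap MvPolynomial.C).height < d) :
    ∃ s : Finset (Fin m), (s.card : ℕ∞) ≤ q.height ∧ ∃ g ∉ q, ∀ l, g * MvPolynomial.C (x l) ∈
      Ideal.span ((fun l => MvPolynomial.C (x l)) '' (s : Set (Fin m))) := by
  set p := q.comap (MvPolynomial.C : R →+* MvPolynomial (Fin d × Fin m) R) with hp
  have hpp : p.IsPrime := Ideal.comap_isPrime _ _
  have hG' := hG ⟨p, hpp⟩ (Ideal.map_le_iff_le_comap.1 hJ)
    (by rwa [← PrimeSpectrum.height_eq_orderHeight])
  rw [← PrimeSpectrum.height_eq_orderHeight] at hG'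
  simp only at hG'
  set A := Localization.AtPrime p
  have hmem : mu (Ideal.map (algebraMap R A) (Ideal.span (Set.range x))) ∈
      ((fun s : Finset A => (s.card : ℕ∞)) '' {s | Ideal.span (s : Set A) =
        Ideal.map (algebraMap R A) (Ideal.span (Set.range x))}) := by
    refine csInf_mem ?_
    by_contra h
    rw [Set.not_nonempty_iff_eq_empty] at h
    rw [mu, h, sInf_empty] at hG'
    exact absurd (hG'.trans_lt hd) (not_lt.2 le_top)
  obtain ⟨t, ht, hcard⟩ := hmem
  have hmap : Ideal.map (algebraMap R A) (Ideal.span (Set.range x)) =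
      Ideal.span (Set.range fun l => algebraMap R A (x l)) := by
    rw [Ideal.map_span, ← Set.range_comp]; rfl
  obtain ⟨s, hs, hst⟩ := exists_subset_card_le (fun l => algebraMap R A (x l)) t (ht.trans hmap)
  refine ⟨s, ((Nat.cast_le.2 hst).trans_eq hcard).trans (hG'.trans (height_comap_C_le q)), ?_⟩
  have h1 : ∀ l, ∃ g ∈ p.primeCompl, g * x l ∈ Ideal.span (x '' (s : Set (Fin m))) := by
    intro l
    have h2 : algebraMap R A (x l) ∈ (Ideal.span (x '' (s : Set (Fin m)))).map (algebraMap R A) := by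
      rw [Ideal.map_span, Set.image_image, hs]
      exact Ideal.subset_span ⟨l, rfl⟩
    exact (IsLocalization.algebraMap_mem_map_algebraMap_iff p.primeCompl A _ _).1 h2
  choose g hg hgx using h1
  refine ⟨MvPolynomial.C (∏ l, g l), fun h => ?_, fun l => ?_⟩
  · have : ∏ l, g l ∈ p := h
    obtain ⟨l, -, hl⟩ := (Ideal.IsPrime.prod_mem_iff).1 this
    exact hg l hl
  · have h3 : (∏ l, g l) * x l ∈ Ideal.span (x '' (s : Set (Fin m))) := by
      rw [← Finset.prod_erase_mul _ _ (Finset.mem_univ l), mul_assoc]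
      exact Ideal.mul_mem_left _ _ (hgx l)
    have h4 := Ideal.mem_map_of_mem (MvPolynomial.C : R →+* MvPolynomial (Fin d × Fin m) R) h3
    rwa [map_mul, Ideal.map_span, Set.image_image] at h4

theorem add_one_le_height_of_colon_le (hG : SatisfiesG (Ideal.span (Set.range x)) d)
    {i : ℕ} (hi : i ≤ d) (q : Ideal (MvPolynomial (Fin d × Fin m) R)) [q.IsPrime]
    (hJ : (Ideal.span (Set.range x)).map MvPolynomial.C ≤ q)
    (hq : colonI (firstSpan (genElt d x) i)
      ((Ideal.span (Set.range x)).map MvPolynomial.C) ≤ q) :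
    min (d : ℕ∞) (i + 1 : ℕ) ≤ q.height := by
  by_cases hd : (q.comap MvPolynomial.C).height < d
  · refine (min_le_right _ _).trans (add_le_height
      (fun q _ hJ hd => exists_subset_mul_mem_span hG q hJ hd) hi le_rfl q hJ hd ?_)
    intro s g hg hgs
    rw [Nat.one_le_iff_ne_zero, Ne, Finset.card_eq_zero]
    rintro rfl
    refine hg (hq (le_colon_iff (C := Ideal.span {g}) |>.2 ?_ (Ideal.mem_span_singleton_self g)))
    rw [map_C_span_range, Ideal.span_singleton_mul_le_iff]
    intro f hf
    induction hf using Submodule.span_induction with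
    | mem _ h => obtain ⟨l, rfl⟩ := h; simpa using hgs l
    | zero => simp
    | add f f' _ _ h h' => rw [mul_add]; exact add_mem h h'
    | smul c f _ h => rw [smul_eq_mul, mul_left_comm]; exact Ideal.mul_mem_left _ _ h
  · exact (min_le_left _ _).trans ((not_lt.1 hd).trans (height_comap_C_le q))

theorem le_height_of_colon_le (hG : SatisfiesG (Ideal.span (Set.range x)) d)
    {i : ℕ} (hi : i ≤ d) (q : Ideal (MvPolynomial (Fin d × Fin m) R)) [q.IsPrime]
    (hq : colonI (firstSpan (genElt d x) i)
      ((Ideal.span (Set.range x)).map MvPolynomial.C) ≤ q) : (i : ℕ∞) ≤ q.height := by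
  by_cases hJ : (Ideal.span (Set.range x)).map MvPolynomial.C ≤ q
  · refine le_trans (le_min (Nat.cast_le.2 hi) (Nat.cast_le.2 (Nat.le_succ i)))
      (add_one_le_height_of_colon_le hG hi q hJ hq)
  · exact le_height_of_firstSpan_le hi q ((le_colon_self _ _).trans hq) hJ

theorem height_map_C_le {P : Ideal R} [P.IsPrime]
    [(P.map (MvPolynomial.C (σ := Fin d × Fin m))).IsPrime] :
    (P.map (MvPolynomial.C (σ := Fin d × Fin m))).height ≤ P.height := by
  have : (P.map (MvPolynomial.C (σ := Fin d × Fin m))).LiesOver P := ⟨by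
    ext r
    rw [Ideal.under_def, Ideal.mem_comap]
    refine ⟨fun h => Ideal.mem_map_of_mem _ h, fun h => ?_⟩
    simpa using MvPolynomial.mem_map_C_iff.1 h 0⟩
  refine (Ideal.height_le_height_add_of_liesOver P _).trans ?_
  rw [show (algebraMap R (MvPolynomial (Fin d × Fin m) R)) = MvPolynomial.C from rfl]
  rw [Ideal.map_quotient_self]
  simp

/-- A colon ideal `𝔞 : J ^ e` with `e` large, for `k` generic elements. -/
theorem exists_saturation (x : Fin m → R) {k : ℕ} (hk : k < d) :
    ∃ e, ∃ K : Ideal (MvPolynomial (Fin d × Fin m) R),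
      K = colonI (firstSpan (genElt d x) k)
        (((Ideal.span (Set.range x)).map MvPolynomial.C) ^ e) ∧
      (∀ n, ∀ u, ((Ideal.span (Set.range x)).map MvPolynomial.C) ^ n * Ideal.span {u} ≤ K → u ∈ K) ∧
      (∀ u, genElt d x k * u ∈ K → u ∈ K) := by
  obtain ⟨e, he⟩ := exists_colon_pow_stable (firstSpan (genElt d x) k)
    ((Ideal.span (Set.range x)).map MvPolynomial.C)
  set J := (Ideal.span (Set.range x)).map (MvPolynomial.C (σ := Fin d × Fin m)) with hJ
  set K := colonI (firstSpan (genElt d x) k) (J ^ e) with hK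
  have hsat : ∀ n, ∀ u, J ^ n * Ideal.span {u} ≤ K → u ∈ K := by
    intro n u hu
    refine he (n + e) (le_colon_iff (C := Ideal.span {u}) |>.2 ?_ (Ideal.mem_span_singleton_self u))
    rw [pow_add, ← mul_assoc, mul_comm (Ideal.span {u})]
    exact (Ideal.mul_mono_left hu).trans (colon_mul_le _ _)
  refine ⟨e, K, rfl, hsat, fun u hu => ?_⟩
  have hfree : ∀ l, IsVarFree ((⟨k, hk⟩ : Fin d), l) K := by
    intro l f hf n
    rw [hK, hJ, ← Ideal.map_pow, Ideal.map] at hf ⊢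
    rw [colonI, Ideal.colon_span, Submodule.mem_colon] at hf ⊢
    rintro _ ⟨r, hr, rfl⟩
    have h1 := isVarFree_firstSpan (x := x) hk l _ (hf _ ⟨r, hr, rfl⟩) n
    rwa [smul_eq_mul, mul_comm, varCoeff_mul (C_mem_varFree _), mul_comm] at h1
  obtain ⟨n, hn⟩ := exists_pow_genElt (B := fun _ => K) (n := 0) hk (fun _ l => hfree l)
    (fun _ => Ideal.mul_le_right) hu
  exact hsat n u hn

theorem add_one_le_height_of_saturation_le {k : ℕ} (hk : k < d)
    {K : Ideal (MvPolynomial (Fin d × Fin m) R)} (haK : firstSpan (genElt d x) k ≤ K)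
    (hsat : ∀ u, (Ideal.span (Set.range x)).map MvPolynomial.C * Ideal.span {u} ≤ K → u ∈ K)
    (hnzd : ∀ u, genElt d x k * u ∈ K → u ∈ K)
    (q : Ideal (MvPolynomial (Fin d × Fin m) R)) [q.IsPrime]
    (hq : K ⊔ Ideal.span {genElt d x k} ≤ q) : ((k + 1 : ℕ) : ℕ∞) ≤ q.height := by
  obtain ⟨q', hq', hle⟩ := Ideal.exists_minimalPrimes_le (le_sup_left.trans hq)
  have hass := isAss_of_mem_minimalPrimes hq'
  have hp := hass.1
  have h1 : ¬ (Ideal.span (Set.range x)).map MvPolynomial.C ≤ q' := by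
    intro h
    obtain ⟨-, w, hw⟩ := hass
    have h2 : w ∈ K := hsat w (by
      rw [mul_comm, Ideal.span_singleton_mul_le_iff]
      intro y hy
      rw [mul_comm]
      exact (hw y).1 (h hy))
    exact hp.ne_top ((Ideal.eq_top_iff_one _).2 ((hw 1).2 (by simpa using h2)))
  have h3 : genElt d x k ∉ q' := notMem_of_isAss hnzd hass
  have h4 := le_height_of_firstSpan_le hk.le q' (haK.trans hass.le) h1
  have hlt : q' < q := lt_of_le_of_ne hle fun h =>
    h3 (h ▸ hq (Ideal.mem_sup_right (Ideal.mem_span_singleton_self _)))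
  push_cast
  exact (add_le_add_left h4 1).trans (Ideal.height_add_one_le_of_lt_of_isPrime hlt)

end heights

section localization

variable {A : Type*} [CommRing A] [IsNoetherianRing A] (P : Ideal A) [P.IsPrime]

theorem exists_pow_maximalIdeal_le_map (B : Ideal A)
    (h : ∀ q : Ideal A, q.IsPrime → B ≤ q → q ≤ P → q = P) :
    ∃ N, IsLocalRing.maximalIdeal (Localization.AtPrime P) ^ N ≤
      B.map (algebraMap A (Localization.AtPrime P)) := by
  refine Ideal.exists_pow_le_of_le_radical_of_fg ?_ (IsNoetherian.noetherian _)
  rw [Ideal.radical_eq_sInf]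
  refine le_sInf ?_
  rintro Q ⟨hBQ, hQ⟩
  have h1 : Q.comap (algebraMap A (Localization.AtPrime P)) ≤ P := by
    refine le_trans ?_ (IsLocalization.AtPrime.under_maximalIdeal (Localization.AtPrime P) P).le
    exact Ideal.comap_mono (IsLocalRing.le_maximalIdeal hQ.ne_top)
  have h2 := h _ (Ideal.comap_isPrime _ _) (Ideal.map_le_iff_le_comap.1 hBQ) h1
  rw [← IsLocalization.map_under P.primeCompl _ Q, Ideal.under_def, h2, Localization.AtPrime.map_eq_maximalIdeal]

end localization

section generic

instance isPrime_map_mvPolynomial_C {R σ : Type*} [CommRing R] (P : Ideal R) [P.IsPrime] :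
    (P.map (MvPolynomial.C (σ := σ))).IsPrime := by
  have h := RingHom.ker_isPrime (MvPolynomial.map (σ := σ) (Ideal.Quotient.mk P))
  rwa [MvPolynomial.ker_map, Ideal.mk_ker] at h

variable (R : Type*) [CommRing R] [IsLocalRing R] (σ : Type*)

/-- The extension of a local ring obtained by adjoining variables and localizing at the
extension of the maximal ideal. -/
abbrev GenRing : Type _ :=
  Localization.AtPrime ((IsLocalRing.maximalIdeal R).map (MvPolynomial.C (σ := σ)))

variable {R}

/-- The extension of an ideal to `GenRing`. -/
def genExt (A : Ideal R) : Ideal (GenRing R σ) :=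
  (A.map (MvPolynomial.C (σ := σ))).map (algebraMap _ (GenRing R σ))

/-- The image of an element in `GenRing`. -/
def toGen (r : R) : GenRing R σ := algebraMap (MvPolynomial σ R) (GenRing R σ) (MvPolynomial.C r)

variable {σ}

theorem genExt_mul (A B : Ideal R) : genExt σ (A * B) = genExt σ A * genExt σ B := by
  simp [genExt, Ideal.map_mul]

theorem genExt_pow (A : Ideal R) (n : ℕ) : genExt σ (A ^ n) = genExt σ A ^ n := by
  simp [genExt, Ideal.map_pow]

theorem genExt_sup (A B : Ideal R) : genExt σ (A ⊔ B) = genExt σ A ⊔ genExt σ B := by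
  simp [genExt, Ideal.map_sup]

theorem genExt_mono {A B : Ideal R} (h : A ≤ B) : genExt σ A ≤ genExt σ B :=
  Ideal.map_mono (Ideal.map_mono h)

theorem genExt_span_singleton (b : R) :
    genExt σ (Ideal.span {b}) = Ideal.span {toGen σ b} := by
  simp [genExt, toGen, Ideal.map_span]

theorem toGen_mem {A : Ideal R} {b : R} (h : b ∈ A) : toGen σ b ∈ genExt σ A :=
  Ideal.mem_map_of_mem _ (Ideal.mem_map_of_mem _ h)

theorem genExt_maximalIdeal : genExt σ (IsLocalRing.maximalIdeal R) =
    IsLocalRing.maximalIdeal (GenRing R σ) :=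
  Localization.AtPrime.map_eq_maximalIdeal

theorem exists_isUnit_coeff {f : MvPolynomial σ R}
    (hf : f ∉ (IsLocalRing.maximalIdeal R).map (MvPolynomial.C (σ := σ))) :
    ∃ s, IsUnit (f.coeff s) := by
  rw [MvPolynomial.mem_map_C_iff] at hf
  push Not at hf
  obtain ⟨s, hs⟩ := hf
  exact ⟨s, by simpa using hs⟩

theorem toGen_mem_genExt_iff {A : Ideal R} {r : R} : toGen σ r ∈ genExt σ A ↔ r ∈ A := by
  refine ⟨fun h => ?_, toGen_mem⟩
  obtain ⟨f, hf, h1⟩ := (IsLocalization.algebraMap_mem_map_algebraMap_iff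
    ((IsLocalRing.maximalIdeal R).map (MvPolynomial.C (σ := σ))).primeCompl (GenRing R σ) _ _).1 h
  obtain ⟨s, hs⟩ := exists_isUnit_coeff hf
  have h2 := MvPolynomial.mem_map_C_iff.1 h1 s
  rw [mul_comm, MvPolynomial.coeff_C_mul] at h2
  exact (Ideal.mul_unit_mem_iff_mem _ hs).1 h2

theorem relLen_genExt [IsNoetherianRing R] {A B : Ideal R} (hAB : A ≤ B) {N : ℕ}
    (hN : IsLocalRing.maximalIdeal R ^ N * B ≤ A) :
    relLen (genExt σ A) (genExt σ B) = relLen A B := by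
  induction A using WellFoundedGT.induction with
  | _ A ih =>
    by_cases hBA : B ≤ A
    · rw [relLen.eq_zero_iff.2 hBA, relLen.eq_zero_iff.2 (genExt_mono hBA)]
    · obtain ⟨b, hb, hbA, hm⟩ := relLen.exists_socle hN hBA
      have hlt : A < A ⊔ Ideal.span {b} := lt_of_le_of_ne le_sup_left fun h =>
        hbA (h ▸ Ideal.mem_sup_right (Ideal.mem_span_singleton_self b))
      have hle : A ⊔ Ideal.span {b} ≤ B := sup_le hAB ((Ideal.span_singleton_le_iff_mem _).2 hb)
      rw [relLen.add le_sup_left hle, relLen.add (genExt_mono le_sup_left) (genExt_mono hle),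
        ih _ hlt hle (hN.trans le_sup_left), genExt_sup, relLen.sup_right, relLen.sup_right,
        genExt_span_singleton, relLen.span_singleton_eq_one hm hbA, relLen.span_singleton_eq_one]
      · have h1 : genExt σ (IsLocalRing.maximalIdeal R) * Ideal.span {toGen σ b} ≤ genExt σ A := by
          rw [← genExt_span_singleton, ← genExt_mul, mul_comm]
          exact genExt_mono (Ideal.span_singleton_mul_le_iff.2 fun x hx => by
            rw [mul_comm]; exact hm x hx)
        rw [genExt_maximalIdeal] at h1
        exact fun x hx => h1 (Ideal.mul_mem_mul hx (Ideal.mem_span_singleton_self _))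
      · rwa [toGen_mem_genExt_iff]

end generic

section pieces

variable {R : Type*} [CommRing R]

/-- The elements of `I ^ n` whose class in `I ^ n / I ^ (n + 1)` is killed by a power of `𝔪`. -/
def torsPiece (𝔪 I : Ideal R) (n : ℕ) : Ideal R :=
  I ^ n ⊓ ⨆ N : ℕ, colonI (I ^ (n + 1)) (𝔪 ^ N)

variable {𝔪 I : Ideal R}

theorem mem_torsPiece {n : ℕ} {u : R} :
    u ∈ torsPiece 𝔪 I n ↔ u ∈ I ^ n ∧ ∃ N, ∀ b ∈ 𝔪 ^ N, u * b ∈ I ^ (n + 1) := by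
  have hmono : Monotone fun N : ℕ => colonI (I ^ (n + 1)) (𝔪 ^ N) := fun N N' h u hu => by
    rw [mem_colon_ideal] at hu ⊢
    exact fun b hb => hu b (Ideal.pow_le_pow_right h hb)
  rw [torsPiece, Submodule.mem_inf, Submodule.mem_iSup_of_directed _ hmono.directed_le]
  simp only [mem_colon_ideal]

theorem torsPiece_le (n : ℕ) : torsPiece 𝔪 I n ≤ I ^ n := inf_le_left

theorem pow_succ_le_torsPiece (n : ℕ) : I ^ (n + 1) ≤ torsPiece 𝔪 I n := fun _ hu =>
  mem_torsPiece.2 ⟨Ideal.pow_le_pow_right (Nat.le_succ n) hu, 0, fun _ _ => Ideal.mul_mem_right _ _ hu⟩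

theorem mul_mem_torsPiece {n k : ℕ} {a u : R} (ha : a ∈ I ^ k) (hu : u ∈ torsPiece 𝔪 I n) :
    a * u ∈ torsPiece 𝔪 I (n + k) := by
  obtain ⟨h1, N, hN⟩ := mem_torsPiece.1 hu
  refine mem_torsPiece.2 ⟨?_, N, fun b hb => ?_⟩
  · rw [add_comm n k, pow_add]; exact Ideal.mul_mem_mul ha h1
  · have h2 := Ideal.mul_mem_mul ha (hN b hb)
    rw [← pow_add, ← mul_assoc] at h2
    rwa [show n + k + 1 = k + (n + 1) by ring]

theorem mem_torsPiece_of_mul_mem [IsNoetherianRing R] {n : ℕ} {u : R} (hu : u ∈ I ^ n)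
    (h : ∀ b ∈ 𝔪, b * u ∈ torsPiece 𝔪 I n) : u ∈ torsPiece 𝔪 I n := by
  obtain ⟨s, hs⟩ := IsNoetherian.noetherian 𝔪
  have h1 : ∃ N, ∀ b ∈ s, ∀ c ∈ 𝔪 ^ N, b * u * c ∈ I ^ (n + 1) := by
    have h2 : ∀ b : s, ∃ N, ∀ c ∈ 𝔪 ^ N, (b : R) * u * c ∈ I ^ (n + 1) := fun b =>
      (mem_torsPiece.1 (h b (hs ▸ Ideal.subset_span b.2))).2
    choose N hN using h2
    refine ⟨∑ b, N b, fun b hb c hc => hN ⟨b, hb⟩ c (Ideal.pow_le_pow_right ?_ hc)⟩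
    exact Finset.single_le_sum (f := N) (fun _ _ => Nat.zero_le _) (Finset.mem_univ _)
  obtain ⟨N, hN⟩ := h1
  refine mem_torsPiece.2 ⟨hu, N + 1, fun c hc => ?_⟩
  have h3 : 𝔪 ^ (N + 1) ≤ colonI (I ^ (n + 1)) (Ideal.span {u}) := by
    rw [pow_succ, mul_comm, ← hs, Ideal.mul_le]
    intro b hb c hc
    rw [mem_colon_ideal]
    intro v hv
    obtain ⟨w, rfl⟩ := Ideal.mem_span_singleton'.1 hv
    have h4 : (s : Set R) ⊆ colonI (I ^ (n + 1)) (𝔪 ^ N * Ideal.span {u}) := by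
      intro b hb
      rw [SetLike.mem_coe, mem_colon_ideal]
      intro y hy
      rw [mul_comm, Ideal.mem_span_singleton_mul] at hy
      obtain ⟨z, hz, rfl⟩ := hy
      rw [← mul_assoc]
      exact hN b hb z hz
    have h5 := mem_colon_ideal.1 (Ideal.span_le.2 h4 hb) (c * u)
      (Ideal.mul_mem_mul (hs ▸ hc) (Ideal.mem_span_singleton_self u))
    rw [show b * c * (w * u) = w * (b * (c * u)) by ring]
    exact Ideal.mul_mem_left _ _ h5
  rw [mul_comm]
  exact mem_colon_ideal.1 (h3 hc) u (Ideal.mem_span_singleton_self u)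

end pieces

section pieces

variable {R : Type*} [CommRing R] {𝔪 I : Ideal R}

theorem mem_H0 {N : Type*} [AddCommGroup N] [Module R N] {x : N} :
    x ∈ H0 𝔪 N ↔ ∃ n, ∀ b ∈ 𝔪 ^ n, b • x = 0 := by
  have hmono : Monotone fun n : ℕ => Submodule.torsionBySet R N ((𝔪 ^ n : Ideal R) : Set R) :=
    fun n n' h => Submodule.torsionBySet_le_torsionBySet_of_subset (Ideal.pow_le_pow_right h)
  rw [H0, Submodule.mem_iSup_of_directed _ hmono.directed_le]
  simp [Submodule.mem_torsionBySet_iff]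

theorem mLength_eq (R M : Type*) [CommRing R] [AddCommGroup M] [Module R M] :
    mLength R M = Module.length R M := (Module.length_eq_height R M).symm

theorem mLength_H0_gradedPiece (n : ℕ) :
    mLength R (H0 𝔪 (gradedPiece I (M := R) n)) = relLen (I ^ (n + 1)) (torsPiece 𝔪 I n) := by
  have hI : ∀ k, (I ^ k • ⊤ : Submodule R R) = I ^ k := fun k => by simp
  have hmk : ∀ u : R, (I ^ (n + 1) • ⊤ : Submodule R R).mkQ u = 0 ↔ u ∈ I ^ (n + 1) := fun u => by
    rw [Submodule.mkQ_apply, Submodule.Quotient.mk_eq_zero, hI]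
  have h1 : ∀ u : ↥(torsPiece 𝔪 I n),
      (I ^ (n + 1) • ⊤ : Submodule R R).mkQ u ∈ gradedPiece I (M := R) n := fun u =>
    ⟨u, (hI n).symm ▸ torsPiece_le n u.2, rfl⟩
  let φ : ↥(torsPiece 𝔪 I n) →ₗ[R] gradedPiece I (M := R) n :=
    ((I ^ (n + 1) • ⊤ : Submodule R R).mkQ.comp (Submodule.subtype _)).codRestrict _ h1
  have h2 : ∀ u, φ u ∈ H0 𝔪 (gradedPiece I (M := R) n) := fun u => by
    obtain ⟨-, N, hN⟩ := mem_torsPiece.1 u.2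
    refine mem_H0.2 ⟨N, fun b hb => Subtype.ext ?_⟩
    change b • (I ^ (n + 1) • ⊤ : Submodule R R).mkQ u = 0
    rw [← map_smul, hmk, smul_eq_mul, mul_comm]
    exact hN b hb
  rw [mLength_eq]
  refine relLen.eq_of_surjective (φ.codRestrict _ h2) ?_ ?_
  · rintro ⟨⟨_, u, hu, rfl⟩, hy⟩
    obtain ⟨N, hN⟩ := mem_H0.1 hy
    refine ⟨⟨u, mem_torsPiece.2 ⟨hI n ▸ hu, N, fun b hb => ?_⟩⟩, rfl⟩
    have h3 : b • (I ^ (n + 1) • ⊤ : Submodule R R).mkQ u = 0 := congrArg Subtype.val (hN b hb)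
    rw [← map_smul, hmk, smul_eq_mul, mul_comm] at h3
    exact h3
  · intro u
    rw [← hmk, Subtype.ext_iff, Subtype.ext_iff]
    rfl

variable [IsNoetherianRing R]

theorem exists_pow_mul_torsPiece_le (n : ℕ) : ∃ N, 𝔪 ^ N * torsPiece 𝔪 I n ≤ I ^ (n + 1) := by
  have hmono : Monotone fun N : ℕ => colonI (I ^ (n + 1)) (𝔪 ^ N) := fun N N' h u hu => by
    rw [mem_colon_ideal] at hu ⊢
    exact fun b hb => hu b (Ideal.pow_le_pow_right h hb)
  obtain ⟨N, hN⟩ := monotone_stabilizes_iff_noetherian.2 ‹IsNoetherian R R› ⟨_, hmono⟩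
  refine ⟨N, ?_⟩
  rw [mul_comm]
  refine le_colon_iff.1 (inf_le_right.trans (iSup_le fun k => ?_))
  refine (hmono (le_max_left k N)).trans (hN (max k N) (le_max_right _ _)).ge

theorem exists_succ_le_mul {J : Ideal R} {B C : ℕ → Ideal R} (hBa : ∀ n, B (n + 1) ≤ B n)
    (hCa : ∀ n, C (n + 1) ≤ C n) (hB : ∀ n, J * B n ≤ B (n + 1)) (hC : ∀ n, J * C n ≤ C (n + 1))
    {n₁ : ℕ} (hCs : ∀ n ≥ n₁, C (n + 1) ≤ J * C n) (hBC : ∀ n, B n ≤ C n) :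
    ∃ n₂, ∀ n ≥ n₂, B (n + 1) ≤ J * B n := by
  let F : J.Filtration R := ⟨C, hCa, hC⟩
  let G : J.Filtration R := ⟨B, hBa, hB⟩
  have hF : F.Stable := ⟨n₁, fun n hn => le_antisymm (hC n) (hCs n hn)⟩
  have hG : G.Stable := hF.of_le (F' := G) hBC
  obtain ⟨n₂, h⟩ := hG
  exact ⟨n₂, fun n hn => (h n hn).ge⟩

theorem exists_forall_pow_mul_torsPiece_le {J : Ideal R} (hJI : J ≤ I) {n₁ : ℕ}
    (hJ : ∀ n ≥ n₁, I ^ (n + 1) ≤ J * I ^ n) :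
    ∃ N, ∀ n, 𝔪 ^ N * torsPiece 𝔪 I n ≤ I ^ (n + 1) := by
  obtain ⟨n₂, hn₂⟩ := exists_succ_le_mul (J := J) (B := torsPiece 𝔪 I) (C := fun n => I ^ n)
    (fun n => (torsPiece_le (n + 1)).trans (pow_succ_le_torsPiece n))
    (fun n => Ideal.pow_le_pow_right (Nat.le_succ n))
    (fun n => Ideal.mul_le.2 fun a ha u hu => mul_mem_torsPiece (by simpa using hJI ha) hu)
    (fun n => by rw [pow_succ' I n]; exact Ideal.mul_mono_left hJI) hJ torsPiece_le
  choose N hN using fun n => exists_pow_mul_torsPiece_le (𝔪 := 𝔪) (I := I) n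
  have h1 : ∀ n ≤ n₂, 𝔪 ^ (∑ i ∈ Finset.range (n₂ + 1), N i) * torsPiece 𝔪 I n ≤ I ^ (n + 1) :=
    fun n hn => (Ideal.mul_mono_left (Ideal.pow_le_pow_right
      (Finset.single_le_sum (f := N) (fun _ _ => Nat.zero_le _)
        (Finset.mem_range.2 (by omega))))).trans (hN n)
  refine ⟨∑ i ∈ Finset.range (n₂ + 1), N i, fun n => ?_⟩
  induction n with
  | zero => exact h1 0 (Nat.zero_le _)
  | succ n ih =>
    rcases le_or_gt (n + 1) n₂ with h | h
    · exact h1 _ h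
    · refine (Ideal.mul_mono_right (hn₂ n (by omega))).trans ?_
      rw [mul_left_comm, pow_succ' I (n + 1)]
      exact Ideal.mul_mono hJI ih

theorem exists_forall_mem_torsPiece : ∃ x ∈ 𝔪, ∀ n, ∀ u ∈ I ^ n,
    x * u ∈ torsPiece 𝔪 I n → u ∈ torsPiece 𝔪 I n := by
  let L : Ideal (reesAlgebra I) :=
    { carrier := {f | ∀ i, (f : Polynomial R).coeff i ∈ torsPiece 𝔪 I i}
      add_mem' := fun {f g} hf hg i => by
        simpa using Ideal.add_mem _ (hf i) (hg i)
      zero_mem' := fun i => by simp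
      smul_mem' := fun f g hg i => by
        rw [smul_eq_mul, Subalgebra.coe_mul, Polynomial.coeff_mul]
        refine Ideal.sum_mem _ fun p hp => ?_
        rw [← Finset.HasAntidiagonal.mem_antidiagonal.1 hp, add_comm]
        exact mul_mem_torsPiece (f.2 p.1) (hg p.2) }
  have hL : ∀ f : reesAlgebra I, f ∈ L ↔ ∀ i, (f : Polynomial R).coeff i ∈ torsPiece 𝔪 I i :=
    fun f => Iff.rfl
  have hcoeff : ∀ (b : R) (f : reesAlgebra I) (i : ℕ),
      ((algebraMap R (reesAlgebra I) b * f : reesAlgebra I) : Polynomial R).coeff i =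
        b * (f : Polynomial R).coeff i := fun b f i => by
    rw [← Algebra.smul_def]; simp
  have h1 : ∀ P ∈ Ideal.comap (algebraMap R (reesAlgebra I)) '' {P | IsAss L P}, ¬ 𝔪 ≤ P := by
    rintro _ ⟨P, ⟨hP, w, hw⟩, rfl⟩ hle
    have h2 : w ∈ L := (hL w).2 fun i => mem_torsPiece_of_mul_mem (w.2 i) fun b hb => by
      rw [← hcoeff]
      exact (hL _).1 ((hw _).1 (hle hb)) i
    exact hP.ne_top ((Ideal.eq_top_iff_one _).2 ((hw 1).2 (by simpa using h2)))
  obtain ⟨x, hx, hxP⟩ := exists_mem_forall_notMem ((finite_isAss L).image _)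
    (by rintro _ ⟨P, hP, rfl⟩; have := hP.1; exact Ideal.comap_isPrime _ _) h1
  have h2 := mem_of_mul_mem_of_isAss (K := L) (y := algebraMap R (reesAlgebra I) x)
    fun P hP h => hxP _ ⟨P, hP, rfl⟩ h
  refine ⟨x, hx, fun n u hu hxu => ?_⟩
  have h3 := (hL _).1 (h2 ⟨Polynomial.monomial n u, reesAlgebra.monomial_mem.2 hu⟩ ((hL _).2 fun i => ?_)) n
  · simpa using h3
  · rw [hcoeff, Polynomial.coeff_monomial]
    split_ifs with h
    · exact h ▸ hxu
    · simp

end pieces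

section

variable {R : Type*} [CommRing R]

theorem pow_add_le_pow {I J : Ideal R} {n₁ : ℕ} (hJ : ∀ n ≥ n₁, I ^ (n + 1) ≤ J * I ^ n) (e : ℕ) :
    I ^ (n₁ + e) ≤ J ^ e := by
  have h : I ^ (n₁ + e) ≤ J ^ e * I ^ n₁ := by
    induction e with
    | zero => simp
    | succ e ih =>
      have h1 : I ^ (n₁ + (e + 1)) ≤ J * I ^ (n₁ + e) := hJ (n₁ + e) (by omega)
      refine h1.trans ((Ideal.mul_mono_right ih).trans ?_)
      rw [← mul_assoc, ← pow_succ']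
  exact h.trans Ideal.mul_le_left

variable [IsNoetherianRing R] [IsLocalRing R] {m d : ℕ}

theorem exists_filterRegular_genExt {x : Fin m → R} {B C : ℕ → Ideal R}
    (hBa : ∀ n, B (n + 1) ≤ B n) (hCa : ∀ n, C (n + 1) ≤ C n)
    (hB : ∀ n, Ideal.span (Set.range x) * B n ≤ B (n + 1))
    (hC : ∀ n, Ideal.span (Set.range x) * C n ≤ C (n + 1))
    {n₁ : ℕ} (hCs : ∀ n ≥ n₁, C (n + 1) ≤ Ideal.span (Set.range x) * C n) {i : ℕ} (hi : i ≤ d) :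
    ∃ n₀, FilterRegular (fun j => algebraMap _ (GenRing R (Fin d × Fin m)) (genElt d x j))
      (fun n => genExt (Fin d × Fin m) (B n)) (fun n => genExt (Fin d × Fin m) (C n)) i n₀ := by
  obtain ⟨n₀, h⟩ := exists_filterRegular_genElt hBa hCa hB hC hCs hi
  exact ⟨n₀, h.map ((IsLocalRing.maximalIdeal R).map MvPolynomial.C).primeCompl⟩

theorem relLen_saturation_ne_top {k : ℕ} {x : Fin m → R}
    (hht : (IsLocalRing.maximalIdeal R).height ≤ ((k + 1 : ℕ) : ℕ∞))
    {K : Ideal (MvPolynomial (Fin (k + 1) × Fin m) R)}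
    (haK : firstSpan (genElt (k + 1) x) k ≤ K)
    (hsat : ∀ u, (Ideal.span (Set.range x)).map MvPolynomial.C * Ideal.span {u} ≤ K → u ∈ K)
    (hnzd : ∀ u, genElt (k + 1) x k * u ∈ K → u ∈ K) :
    relLen (K.map (algebraMap _ (GenRing R (Fin (k + 1) × Fin m))) ⊔
      Ideal.span {algebraMap _ (GenRing R (Fin (k + 1) × Fin m)) (genElt (k + 1) x k)}) ⊤ ≠ ⊤ := by
  obtain ⟨N, hN⟩ := exists_pow_maximalIdeal_le_map
    ((IsLocalRing.maximalIdeal R).map (MvPolynomial.C (σ := Fin (k + 1) × Fin m)))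
    (K ⊔ Ideal.span {genElt (k + 1) x k}) (fun q hq hBq hqP => by
      have h1 : ((k + 1 : ℕ) : ℕ∞) ≤ q.height := add_one_le_height_of_saturation_le (Nat.lt_succ_self k) haK hsat hnzd q hBq
      refine Ideal.eq_of_le_of_height_le _ hqP ?_
      exact (height_map_C_le.trans hht).trans h1)
  rw [Ideal.map_sup, Ideal.map_span, Set.image_singleton] at hN
  exact relLen.ne_top_of_pow_mul_le (N := N) (Ideal.mul_le_left.trans hN)

theorem tendsto_and_exists_pow_succ_eq {k n₁ e : ℕ} {x : Fin m → R} {I : Ideal R}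
    (hI : I ≤ IsLocalRing.maximalIdeal R) (hJI : Ideal.span (Set.range x) ≤ I)
    (hJ : ∀ n ≥ n₁, I ^ (n + 1) ≤ Ideal.span (Set.range x) * I ^ n)
    {K : Ideal (MvPolynomial (Fin (k + 1) × Fin m) R)}
    (hK : K = colonI (firstSpan (genElt (k + 1) x) k)
      (((Ideal.span (Set.range x)).map MvPolynomial.C) ^ e))
    (hnzd : ∀ u, genElt (k + 1) x k * u ∈ K → u ∈ K) {a : ℕ → GenRing R (Fin (k + 1) × Fin m)}
    (ha : a = fun j => algebraMap _ _ (genElt (k + 1) x j)) {r : ℕ}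
    (hr : relLen (K.map (algebraMap _ (GenRing R (Fin (k + 1) × Fin m))) ⊔ Ideal.span {a k}) ⊤ =
      r) :
    Tendsto (fun n : ℕ => (k.factorial : ℝ) / (n : ℝ) ^ k *
      ((mLength R (H0 (IsLocalRing.maximalIdeal R) (gradedPiece I (M := R) n))).toNat : ℝ))
      atTop (nhds (r : ℝ)) ∧
    ∃ n₂, ∀ n ≥ n₂, genExt (Fin (k + 1) × Fin m) I ^ (n + 1) =
      firstSpan a (k + 1) * genExt (Fin (k + 1) × Fin m) I ^ n := by
  set 𝔪 := IsLocalRing.maximalIdeal R with h𝔪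
  set L := torsPiece 𝔪 I with hLdef
  obtain ⟨N, hN⟩ := exists_forall_pow_mul_torsPiece_le (𝔪 := 𝔪) hJI hJ
  obtain ⟨y, hym, hy⟩ := exists_forall_mem_torsPiece (𝔪 := 𝔪) (I := I)
  have hpa : ∀ n, I ^ (n + 1) ≤ I ^ n := fun n => Ideal.pow_le_pow_right (Nat.le_succ n)
  have hpm : ∀ n, Ideal.span (Set.range x) * I ^ n ≤ I ^ (n + 1) := fun n => by
    rw [pow_succ' I n]; exact Ideal.mul_mono_left hJI
  have hLa : ∀ n, L (n + 1) ≤ L n := fun n => (torsPiece_le (n + 1)).trans (pow_succ_le_torsPiece n)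
  have hIL : ∀ n, I * L n ≤ L (n + 1) := fun n =>
    Ideal.mul_le.2 fun a ha u hu => mul_mem_torsPiece (by simpa using ha) hu
  have hLm : ∀ n, Ideal.span (Set.range x) * L n ≤ L (n + 1) := fun n =>
    (Ideal.mul_mono_left hJI).trans (hIL n)
  obtain ⟨n₂, hn₂⟩ := exists_succ_le_mul hLa hpa hLm hpm hJ torsPiece_le
  obtain ⟨m₁, hm₁⟩ := exists_filterRegular_genExt (d := k + 1) (x := x) (B := fun n => I ^ (n + 1))
    (C := L) (fun n => hpa _) hLa (fun n => hpm _) hLm hn₂ (Nat.le_succ k)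
  obtain ⟨m₂, hm₂⟩ := exists_filterRegular_genExt (d := k + 1) (x := x) (B := fun n => I ^ (n + 1))
    (C := fun n => I ^ n) (fun n => hpa _) hpa (fun n => hpm _) hpm hJ le_rfl
  obtain ⟨m₃, hm₃⟩ := exists_filterRegular_genExt (d := k + 1) (x := x) (B := L)
    (C := fun n => I ^ n) hLa hpa hLm hpm hJ (Nat.le_succ k)
  obtain ⟨m₄, hm₄⟩ := exists_filterRegular_genExt (d := k + 1) (x := x)
    (B := fun n => L n ⊔ Ideal.span {y} * I ^ n)
    (C := fun n => I ^ n) (fun n => sup_le_sup (hLa n) (Ideal.mul_mono_right (hpa n))) hpa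
    (fun n => by
      rw [Ideal.mul_sup, mul_left_comm]
      exact sup_le_sup (hLm n) (Ideal.mul_mono_right (hpm n))) hpm hJ (Nat.le_succ k)
  simp only [genExt_sup, genExt_mul, genExt_pow, genExt_span_singleton, ← ha] at hm₁ hm₂ hm₃ hm₄
  have haI : ∀ j, a j ∈ genExt (Fin (k + 1) × Fin m) I := fun j => by
    rw [ha]
    exact Ideal.mem_map_of_mem _ (Ideal.map_mono hJI (genElt_mem j))
  have hm₀ : genExt (Fin (k + 1) × Fin m) I ≤ IsLocalRing.maximalIdeal (GenRing R (Fin (k + 1) × Fin m)) := by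
    rw [← genExt_maximalIdeal]; exact genExt_mono hI
  have haK : firstSpan a k ≤ K.map (algebraMap _ (GenRing R (Fin (k + 1) × Fin m))) := by
    rw [ha, ← map_firstSpan, hK]
    exact Ideal.map_mono (le_colon_self _ _)
  have he : genExt (Fin (k + 1) × Fin m) I ^ (n₁ + e) * K.map (algebraMap _ (GenRing R (Fin (k + 1) × Fin m))) ≤ firstSpan a k := by
    rw [← genExt_pow]
    refine (Ideal.mul_mono_left (genExt_mono (pow_add_le_pow hJ e))).trans ?_
    rw [genExt, ← Ideal.map_mul, ha, ← map_firstSpan]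
    refine Ideal.map_mono ?_
    rw [Ideal.map_pow, mul_comm, hK]
    exact colon_mul_le _ _
  have hnzd' : ∀ u, a k * u ∈ K.map (algebraMap _ (GenRing R (Fin (k + 1) × Fin m))) →
      u ∈ K.map (algebraMap _ (GenRing R (Fin (k + 1) × Fin m))) := fun u hu => by
    have h1 := mem_map_of_mul_mem_map (Q := GenRing R (Fin (k + 1) × Fin m)) (𝔪.map MvPolynomial.C).primeCompl
      (U := ⊤) (B := K) (D := K) (t := genElt (k + 1) x k) (fun u _ => hnzd u) u
      (by rw [Ideal.map_top]; trivial)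
    rw [ha] at hu
    exact h1 hu
  refine ⟨?_, ?_⟩
  · have key := tendsto_relLen_pow (a := a) (I := genExt (Fin (k + 1) × Fin m) I) (L := fun n => genExt (Fin (k + 1) × Fin m) (L n)) (k := k)
      (n₀ := m₁ + m₂ + m₃ + m₄) hm₀ (fun j _ => haI j)
      (fun n => by rw [← genExt_pow]; exact genExt_mono (pow_succ_le_torsPiece n))
      (fun n => by rw [← genExt_pow]; exact genExt_mono (torsPiece_le n))
      (fun j _ n u hu => by
        have h1 := Ideal.mul_mem_mul (haI j) hu
        rw [← genExt_mul] at h1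
        exact genExt_mono (hIL n) h1)
      ⟨N, fun n => by
        rw [← genExt_maximalIdeal, ← genExt_pow, ← genExt_pow, ← genExt_mul]
        exact genExt_mono (hN n)⟩
      (x := toGen (Fin (k + 1) × Fin m) y) (by rw [← genExt_maximalIdeal]; exact toGen_mem hym)
      (fun n _ u hu hyu => by
        rw [← genExt_pow] at hu
        refine mem_map_of_mul_mem_map (𝔪.map MvPolynomial.C).primeCompl
          (U := (I ^ n).map MvPolynomial.C) (t := MvPolynomial.C y) ?_ u hu hyu
        intro f hf hyf
        rw [MvPolynomial.mem_map_C_iff] at hf hyf ⊢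
        exact fun s => hy n _ (hf s) (by simpa using hyf s))
      (hm₁.mono le_rfl (by omega)) (hm₂.mono le_rfl (by omega)) (hm₃.mono le_rfl (by omega))
      (hm₄.mono le_rfl (by omega)) haK he hnzd' hr
    refine key.congr fun n => ?_
    rw [mLength_H0_gradedPiece, ← genExt_pow,
      relLen_genExt (pow_succ_le_torsPiece n) (hN n)]
  · exact exists_pow_succ_eq hm₀ (fun j _ => haI j) hm₂ haK he hnzd' hr

end

section sop

variable {A : Type*} [CommRing A] [IsNoetherianRing A] (P : Ideal A) [P.IsPrime]

theorem exists_finset_pow_maximalIdeal_le_map (n : ℕ) (B : Ideal A)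
    (h : ∀ q : Ideal A, q.IsPrime → B ≤ q → q ≤ P → P.height ≤ q.height + n) :
    ∃ s : Finset A, s.card ≤ n ∧ (s : Set A) ⊆ P ∧
      ∃ N, IsLocalRing.maximalIdeal (Localization.AtPrime P) ^ N ≤
        (B ⊔ Ideal.span (s : Set A)).map (algebraMap A (Localization.AtPrime P)) := by
  classical
  induction n generalizing B with
  | zero =>
    refine ⟨∅, le_rfl, by simp, ?_⟩
    refine exists_pow_maximalIdeal_le_map P _ fun q hq hBq hqP => ?_
    exact Ideal.eq_of_le_of_height_le _ hqP
      (by simpa using h q hq (le_sup_left.trans hBq) hqP)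
  | succ n ih =>
    obtain ⟨w, hw, hwq⟩ := exists_mem_forall_notMem (J := P)
      (S := {q | q ∈ B.minimalPrimes ∧ ¬ P ≤ q})
      (B.finite_minimalPrimes_of_isNoetherianRing.subset fun q hq => hq.1)
      (fun q hq => hq.1.1.1) (fun q hq => hq.2)
    obtain ⟨s, hs, hsP, N, hN⟩ := ih (B ⊔ Ideal.span {w}) (fun q hq hBq hqP => by
      obtain ⟨q₀, hq₀, hle⟩ := Ideal.exists_minimalPrimes_le (le_sup_left.trans hBq)
      have := hq₀.1.1
      by_cases hP : P ≤ q₀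
      · exact (Ideal.height_mono (hP.trans hle)).trans le_self_add
      · have hlt : q₀ < q := lt_of_le_of_ne hle fun h' =>
          hwq q₀ ⟨hq₀, hP⟩ (h' ▸ hBq (Ideal.mem_sup_right (Ideal.mem_span_singleton_self w)))
        refine (h q₀ this hq₀.1.2 (hle.trans hqP)).trans ?_
        push_cast
        rw [add_comm (n : ℕ∞) 1, ← add_assoc]
        exact add_le_add_left (Ideal.height_add_one_le_of_lt_of_isPrime hlt) _)
    refine ⟨insert w s, (Finset.card_insert_le _ _).trans (by omega), ?_, N, ?_⟩
    · rw [Finset.coe_insert]; exact Set.insert_subset hw hsP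
    · rwa [Finset.coe_insert, Ideal.span_insert, ← sup_assoc]

end sop

section cert

variable {R : Type*} [CommRing R] {σ : Type*}

theorem map_C_map_eval (A : Ideal R) (c : σ → R) :
    (A.map (MvPolynomial.C (σ := σ))).map (MvPolynomial.eval c) = A := by
  rw [Ideal.map_map, show (MvPolynomial.eval c).comp MvPolynomial.C = RingHom.id R from
    RingHom.ext fun r => by simp, Ideal.map_id]

theorem map_eval_firstSpan (a : ℕ → MvPolynomial σ R) (i : ℕ) (c : σ → R) :
    (firstSpan a i).map (MvPolynomial.eval c) =
      firstSpan (fun j => MvPolynomial.eval c (a j)) i := by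
  rw [firstSpan, firstSpan, Ideal.map_span, Set.image_image]

variable [IsLocalRing R]

/-- A property of coefficient vectors that holds on a nonempty Zariski open set over the
residue field. -/
def ForGeneral (P : (σ → R) → Prop) : Prop :=
  ∃ F : MvPolynomial σ R, F ∉ (IsLocalRing.maximalIdeal R).map (MvPolynomial.C (σ := σ)) ∧
    ∀ c, MvPolynomial.eval c F ∉ IsLocalRing.maximalIdeal R → P c

theorem ForGeneral.mono {P P' : (σ → R) → Prop} (h : ForGeneral P) (hP : ∀ c, P c → P' c) :
    ForGeneral P' := by
  obtain ⟨F, hF, h⟩ := h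
  exact ⟨F, hF, fun c hc => hP c (h c hc)⟩

theorem ForGeneral.of_forall {P : (σ → R) → Prop} (h : ∀ c, P c) : ForGeneral P :=
  ⟨1, by rw [← Ideal.ne_top_iff_one]; exact Ideal.IsPrime.ne_top inferInstance, fun c _ => h c⟩

theorem ForGeneral.and {P P' : (σ → R) → Prop} (h : ForGeneral P) (h' : ForGeneral P') :
    ForGeneral fun c => P c ∧ P' c := by
  obtain ⟨F, hF, h⟩ := h
  obtain ⟨F', hF', h'⟩ := h'
  refine ⟨F * F', fun hm => ?_, fun c hc => ?_⟩
  · exact (Ideal.IsPrime.mem_or_mem inferInstance hm).elim hF hF'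
  · rw [map_mul] at hc
    exact ⟨h c fun h1 => hc (Ideal.mul_mem_right _ _ h1),
      h' c fun h1 => hc (Ideal.mul_mem_left _ _ h1)⟩

theorem ForGeneral.forall_lt {P : ℕ → (σ → R) → Prop} {n : ℕ} (h : ∀ i < n, ForGeneral (P i)) :
    ForGeneral fun c => ∀ i < n, P i c := by
  induction n with
  | zero => exact ForGeneral.of_forall fun c i hi => absurd hi (Nat.not_lt_zero i)
  | succ n ih =>
    refine ((ih fun i hi => h i (by omega)).and (h n (by omega))).mono fun c hc i hi => ?_
    rcases Nat.lt_succ_iff_lt_or_eq.1 hi with h1 | rfl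
    · exact hc.1 i h1
    · exact hc.2

variable [IsNoetherianRing R] [Finite σ]

theorem forGeneral_map_le {A B : Ideal (MvPolynomial σ R)}
    (h : A.map (algebraMap _ (GenRing R σ)) ≤ B.map (algebraMap _ (GenRing R σ))) :
    ForGeneral fun c : σ → R => A.map (MvPolynomial.eval c) ≤ B.map (MvPolynomial.eval c) := by
  obtain ⟨s, hs⟩ := IsNoetherian.noetherian A
  suffices H : ∀ t : Finset (MvPolynomial σ R), (∀ f ∈ t, f ∈ A) → ForGeneral fun c : σ → R =>
      ∀ f ∈ t, MvPolynomial.eval c f ∈ B.map (MvPolynomial.eval c) by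
    refine (H s fun f hf => hs ▸ Ideal.subset_span hf).mono fun c hc => ?_
    rw [Ideal.map_le_iff_le_comap, ← hs]
    exact Ideal.span_le.2 hc
  classical
  intro t
  induction t using Finset.induction_on with
  | empty => exact fun _ => ForGeneral.of_forall fun c f hf => absurd hf (Finset.notMem_empty f)
  | insert f t _ ih =>
    intro ht
    have h1 := h (Ideal.mem_map_of_mem _ (ht f (Finset.mem_insert_self _ _)))
    obtain ⟨g, hg, h2⟩ := (IsLocalization.algebraMap_mem_map_algebraMap_iff
      ((IsLocalRing.maximalIdeal R).map (MvPolynomial.C (σ := σ))).primeCompl (GenRing R σ) _ _).1 h1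
    have h3 : ForGeneral fun c : σ → R =>
        MvPolynomial.eval c f ∈ B.map (MvPolynomial.eval c) := by
      refine ⟨g, hg, fun c hc => ?_⟩
      have h4 := Ideal.mem_map_of_mem (MvPolynomial.eval c) h2
      rw [map_mul] at h4
      exact (Ideal.unit_mul_mem_iff_mem _ (by simpa using hc)).1 h4
    refine (h3.and (ih fun f' hf' => ht f' (Finset.mem_insert_of_mem hf'))).mono ?_
    rintro c ⟨h5, h6⟩ f' hf'
    rcases Finset.mem_insert.1 hf' with rfl | hf'
    · exact h5
    · exact h6 f' hf'

theorem forGeneral_exists_finset (n : ℕ) (B : Ideal (MvPolynomial σ R))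
    (h : ∀ q : Ideal (MvPolynomial σ R), q.IsPrime → B ≤ q →
      ((IsLocalRing.maximalIdeal R).map (MvPolynomial.C (σ := σ))).height ≤ q.height + n) :
    ForGeneral fun c : σ → R => ∃ s : Finset R, s.card ≤ n ∧
      (s : Set R) ⊆ IsLocalRing.maximalIdeal R ∧
      ∃ N, IsLocalRing.maximalIdeal R ^ N ≤
        B.map (MvPolynomial.eval c) ⊔ Ideal.span (s : Set R) := by
  classical
  obtain ⟨s, hs, hsm, N, hN⟩ := exists_finset_pow_maximalIdeal_le_map
    ((IsLocalRing.maximalIdeal R).map (MvPolynomial.C (σ := σ))) n B (fun q hq hBq _ => h q hq hBq)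
  rw [← Localization.AtPrime.map_eq_maximalIdeal, ← Ideal.map_pow] at hN
  refine (forGeneral_map_le hN).mono fun c hc => ⟨s.image (MvPolynomial.eval c),
    Finset.card_image_le.trans hs, ?_, N, ?_⟩
  · rw [Finset.coe_image]
    rintro _ ⟨f, hf, rfl⟩
    have h1 := Ideal.mem_map_of_mem (MvPolynomial.eval c) (hsm hf)
    rwa [map_C_map_eval] at h1
  · rwa [Ideal.map_pow, map_C_map_eval, Ideal.map_sup, Ideal.map_span, ← Finset.coe_image] at hc

theorem forGeneral_relLen_le (B : Ideal (MvPolynomial σ R))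
    (hB : relLen (B.map (algebraMap _ (GenRing R σ))) ⊤ ≠ ⊤) :
    ForGeneral fun c : σ → R => relLen (B.map (MvPolynomial.eval c)) ⊤ ≤
      relLen (B.map (algebraMap _ (GenRing R σ))) ⊤ := by
  induction B using WellFoundedGT.induction with
  | _ B ih =>
    by_cases htop : (⊤ : Ideal (GenRing R σ)) ≤ B.map (algebraMap _ (GenRing R σ))
    · rw [← Ideal.map_top (algebraMap (MvPolynomial σ R) (GenRing R σ))] at htop
      refine (forGeneral_map_le htop).mono fun c hc => ?_
      rw [Ideal.map_top] at hc
      rw [relLen.eq_zero_iff.2 hc]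
      exact bot_le
    · obtain ⟨N, hN⟩ := relLen.exists_pow_mul_le le_top hB
      obtain ⟨b', -, hb', hm'⟩ := relLen.exists_socle hN htop
      obtain ⟨b, hb, hm⟩ : ∃ b : MvPolynomial σ R,
          algebraMap _ (GenRing R σ) b ∉ B.map (algebraMap _ (GenRing R σ)) ∧
          ∀ x ∈ IsLocalRing.maximalIdeal (GenRing R σ), x * algebraMap _ (GenRing R σ) b ∈
            B.map (algebraMap _ (GenRing R σ)) := by
        obtain ⟨⟨b, t⟩, hbt⟩ := IsLocalization.surj
          ((IsLocalRing.maximalIdeal R).map (MvPolynomial.C (σ := σ))).primeCompl b'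
        have hu := IsLocalization.map_units (GenRing R σ) t
        refine ⟨b, ?_, fun x hx => ?_⟩
        · rw [← hbt, Ideal.mul_unit_mem_iff_mem _ hu]; exact hb'
        · rw [← hbt, ← mul_assoc]; exact Ideal.mul_mem_right _ _ (hm' x hx)
      have hlt : B < B ⊔ Ideal.span {b} := lt_of_le_of_ne le_sup_left fun h =>
        hb (Ideal.mem_map_of_mem _ (h ▸ Ideal.mem_sup_right (Ideal.mem_span_singleton_self b)))
      have hadd : relLen (B.map (algebraMap _ (GenRing R σ))) ⊤ =
          1 + relLen ((B ⊔ Ideal.span {b}).map (algebraMap _ (GenRing R σ))) ⊤ := by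
        rw [relLen.add (Ideal.map_mono hlt.le) le_top, Ideal.map_sup, relLen.sup_right,
          Ideal.map_span, Set.image_singleton, relLen.span_singleton_eq_one hm hb]
      have h1 := ih _ hlt fun h => hB (by rw [hadd, h]; simp)
      have h2 : (((IsLocalRing.maximalIdeal R).map (MvPolynomial.C (σ := σ))) *
          Ideal.span {b}).map (algebraMap _ (GenRing R σ)) ≤ B.map (algebraMap _ (GenRing R σ)) := by
        rw [Ideal.map_mul, Localization.AtPrime.map_eq_maximalIdeal, Ideal.map_span,
          Set.image_singleton, mul_comm, Ideal.span_singleton_mul_le_iff]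
        intro x hx
        rw [mul_comm]
        exact hm x hx
      refine (h1.and (forGeneral_map_le h2)).mono ?_
      rintro c ⟨h3, h4⟩
      rw [Ideal.map_mul, map_C_map_eval, Ideal.map_span, Set.image_singleton, mul_comm,
        Ideal.span_singleton_mul_le_iff] at h4
      rw [hadd, relLen.add (Ideal.map_mono hlt.le) le_top]
      refine add_le_add ?_ h3
      rw [Ideal.map_sup, relLen.sup_right, Ideal.map_span, Set.image_singleton]
      exact relLen.span_singleton_le_one fun x hx => by rw [mul_comm]; exact h4 x hx

end cert

section localNakayama

variable {R : Type*} [CommRing R]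

theorem exists_notMem_mul_mem_of_map_le {P A : Ideal R} [P.IsPrime] {w : R}
    (h : algebraMap R (Localization.AtPrime P) w ∈ A.map (algebraMap R (Localization.AtPrime P))) :
    ∃ s ∉ P, s * w ∈ A := by
  rw [IsLocalization.mem_map_algebraMap_iff P.primeCompl] at h
  obtain ⟨⟨⟨a, ha⟩, ⟨s, hs⟩⟩, h⟩ := h
  rw [← map_mul, IsLocalization.eq_iff_exists P.primeCompl] at h
  obtain ⟨⟨t, ht⟩, h⟩ := h
  refine ⟨t * s, fun hts => (Ideal.IsPrime.mem_or_mem ‹_› hts).elim ht hs, ?_⟩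
  have : t * s * w = t * a := by rw [mul_assoc, mul_comm s w]; exact h
  rw [this]
  exact A.mul_mem_left _ ha

variable [IsNoetherianRing R]

theorem exists_forall_mul_notMem_sup {J Q P : Ideal R} [P.IsPrime] (hQ : IsAss J Q) (hQP : Q ≤ P)
    {y : R} (hyP : y ∈ P) (hy : ∀ u, y * u ∈ J → u ∈ J) :
    ∃ v, (∀ q ∈ Q, q * v ∈ J) ∧ ∀ s ∉ P, s * v ∉ J ⊔ Ideal.span {y} := by
  by_contra! h
  set φ := algebraMap R (Localization.AtPrime P)
  have hN : ((colonI J Q).map φ) ≤ J.map φ ⊔ (P.map φ) • ((colonI J Q).map φ) := by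
    refine Ideal.map_le_iff_le_comap.2 fun v hv => ?_
    rw [mem_colon_ideal] at hv
    obtain ⟨s, hs, hsv⟩ := h v fun q hq => by rw [mul_comm]; exact hv q hq
    obtain ⟨j, hj, t, ht, hjt⟩ := Submodule.mem_sup.1 hsv
    obtain ⟨v', rfl⟩ := Ideal.mem_span_singleton'.1 ht
    have hv' : v' ∈ colonI J Q := mem_colon_ideal.2 fun q hq => by
      apply hy
      have : y * (v' * q) = s * (v * q) - q * j := by linear_combination q * hjt
      rw [this]
      exact J.sub_mem (J.mul_mem_left _ (hv q hq)) (J.mul_mem_left _ hj)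
    have hu : IsUnit (φ s) := IsLocalization.map_units (M := P.primeCompl) _ ⟨s, hs⟩
    rw [Ideal.mem_comap]
    refine (Ideal.unit_mul_mem_iff_mem _ hu).1 ?_
    rw [← map_mul, ← hjt, map_add, mul_comm v', map_mul, smul_eq_mul]
    exact Submodule.add_mem_sup (Ideal.mem_map_of_mem _ hj)
      (Ideal.mul_mem_mul (Ideal.mem_map_of_mem _ hyP) (Ideal.mem_map_of_mem _ hv'))
  have hN' := Submodule.le_of_le_smul_of_le_jacobson_bot (IsNoetherian.noetherian _)
    ((Localization.AtPrime.map_eq_maximalIdeal (I := P)).trans_le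
      (IsLocalRing.maximalIdeal_le_jacobson _)) hN
  obtain ⟨hQp, w, hw⟩ := hQ
  have hwm : w ∈ colonI J Q := mem_colon_ideal.2 fun q hq => by rw [mul_comm]; exact (hw q).1 hq
  obtain ⟨s, hs, hsw⟩ := exists_notMem_mul_mem_of_map_le (hN' (Ideal.mem_map_of_mem _ hwm))
  exact hs (hQP ((hw s).2 hsw))

theorem isAss_of_minimal_sup {J Q P : Ideal R} (hQ : IsAss J Q) {y : R}
    (hP : P ∈ (Q ⊔ Ideal.span {y}).minimalPrimes) (hy : ∀ u, y * u ∈ J → u ∈ J) :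
    IsAss (J ⊔ Ideal.span {y}) P := by
  have := hP.1.1
  obtain ⟨v, hv, hvP⟩ := exists_forall_mul_notMem_sup hQ (le_sup_left.trans hP.1.2)
    (hP.1.2 (Ideal.mem_sup_right (Ideal.mem_span_singleton_self y))) hy
  have h1 : P ∈ (colonI (J ⊔ Ideal.span {y}) (Ideal.span {v})).minimalPrimes := by
    refine ⟨⟨hP.1.1, fun s hs => ?_⟩, fun P' hP' hle => hP.2 ⟨hP'.1, le_trans ?_ hP'.2⟩ hle⟩
    · by_contra h
      exact hvP s h (mem_colon_ideal.1 hs v (Ideal.mem_span_singleton_self v))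
    · rw [le_colon_iff, Ideal.sup_mul]
      refine sup_le_sup ?_ Ideal.mul_le_left
      rw [Ideal.mul_le]
      intro q hq b hb
      obtain ⟨c, rfl⟩ := Ideal.mem_span_singleton'.1 hb
      rw [mul_left_comm]
      exact J.mul_mem_left _ (hv q hq)
  obtain ⟨hp, w, hw⟩ := isAss_of_mem_minimalPrimes h1
  refine ⟨hp, w * v, fun z => (hw z).trans ⟨fun h => ?_, fun h => mem_colon_ideal.2 fun b hb => ?_⟩⟩
  · rw [← mul_assoc]
    exact mem_colon_ideal.1 h v (Ideal.mem_span_singleton_self v)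
  · obtain ⟨c, rfl⟩ := Ideal.mem_span_singleton'.1 hb
    have : z * w * (c * v) = c * (z * (w * v)) := by ring
    rw [this]
    exact Ideal.mul_mem_left _ _ h

end localNakayama

section height

variable {R : Type*} [CommRing R]

theorem height_add_coheight_le {d : ℕ} (hdim : ringKrullDim R = (d : WithBot ℕ∞))
    {P : Ideal R} (hP : P.IsPrime) :
    P.height + Order.coheight (⟨P, hP⟩ : PrimeSpectrum R) ≤ d := by
  have : Nonempty (PrimeSpectrum R) := ⟨⟨P, hP⟩⟩
  rw [ringKrullDim, Order.krullDim_eq_iSup_height_add_coheight_of_nonempty] at hdim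
  have h : (⨆ a : PrimeSpectrum R, Order.height a + Order.coheight a) = (d : ℕ∞) := by
    exact_mod_cast hdim
  rw [← h]
  have := le_iSup (fun a : PrimeSpectrum R => Order.height a + Order.coheight a) ⟨P, hP⟩
  rwa [← PrimeSpectrum.height_eq_orderHeight] at this

/-- All primes containing `J` have height at least `j`. -/
def HeightGe (j : ℕ) (J : Ideal R) : Prop := ∀ q : Ideal R, q.IsPrime → J ≤ q → (j : ℕ∞) ≤ q.height

theorem HeightGe.succ [IsNoetherianRing R] {j : ℕ} {J : Ideal R} (hJ : HeightGe j J) {y : R}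
    (hy : ∀ u, y * u ∈ J → u ∈ J) : HeightGe (j + 1) (J ⊔ Ideal.span {y}) := by
  intro q hq hle
  obtain ⟨Q, hQ, hQq⟩ := Ideal.exists_minimalPrimes_le (le_sup_left.trans hle)
  have hyQ := notMem_of_isAss hy (isAss_of_mem_minimalPrimes hQ)
  have := hQ.1.1
  have hlt : Q < q := lt_of_le_of_ne hQq fun h => hyQ (h ▸ hle (Ideal.mem_sup_right
    (Ideal.mem_span_singleton_self y)))
  push_cast
  exact (add_le_add_left (hJ Q hQ.1.1 hQ.1.2) 1).trans (Ideal.height_add_one_le_of_lt_of_isPrime hlt)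

end height

section depth

variable {R : Type*} [CommRing R] [IsLocalRing R]

open IsLocalRing

/-- There is an `R ⧸ J`-regular sequence of length `k` in the maximal ideal. -/
def DepthGe : ℕ → Ideal R → Prop
  | 0, _ => True
  | k + 1, J => ∃ y ∈ maximalIdeal R, (∀ u, y * u ∈ J → u ∈ J) ∧ DepthGe k (J ⊔ Ideal.span {y})

theorem depthGe_of_isWeaklyRegular {rs : List R} (hm : ∀ x ∈ rs, x ∈ maximalIdeal R)
    (h : RingTheory.Sequence.IsWeaklyRegular R rs) : DepthGe rs.length (⊥ : Ideal R) := by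
  suffices ∀ k i, i + k = rs.length → DepthGe k (Ideal.ofList (rs.take i)) by
    simpa using this rs.length 0 (by simp)
  intro k
  induction k with
  | zero => exact fun _ _ => trivial
  | succ k ih =>
    intro i hi
    have hlt : i < rs.length := by omega
    refine ⟨rs[i], hm _ (List.getElem_mem hlt), fun u hu => ?_, ?_⟩
    · have := (isSMulRegular_quotient_iff_mem_of_smul_mem _ _).1 (h.regular_mod_prev i hlt) u
      simpa using this (by simpa using hu)
    · have := ih (i + 1) (by omega)
      rwa [List.take_add_one, List.getElem?_eq_getElem hlt, Option.toList_some, Ideal.ofList_append,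
        Ideal.ofList_singleton] at this

variable [IsNoetherianRing R]

theorem DepthGe.exchange {k : ℕ} : ∀ {J : Ideal R}, DepthGe (k + 1) J → ∀ {b : R},
    b ∈ maximalIdeal R → (∀ u, b * u ∈ J → u ∈ J) → DepthGe k (J ⊔ Ideal.span {b}) := by
  induction k with
  | zero => exact fun _ _ _ _ => trivial
  | succ k ih =>
    intro J hJ b hbm hb
    obtain ⟨y, hym, hy, hJ'⟩ := hJ
    obtain ⟨y', hym', hy', -⟩ := id hJ'
    have hswap : ∀ {b c : R}, (∀ u, b * u ∈ J → u ∈ J) →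
        (∀ u, c * u ∈ J ⊔ Ideal.span {b} → u ∈ J ⊔ Ideal.span {b}) →
        ∀ u, b * u ∈ J ⊔ Ideal.span {c} → u ∈ J ⊔ Ideal.span {c} := by
      intro b c hb hc u hu
      obtain ⟨j, hj, t, ht, h⟩ := Submodule.mem_sup.1 hu
      obtain ⟨v, rfl⟩ := Ideal.mem_span_singleton'.1 ht
      have hv : v ∈ J ⊔ Ideal.span {b} := hc v (by
        have : c * v = -j + u * b := by linear_combination h
        rw [this]
        exact Submodule.add_mem_sup (J.neg_mem hj) (Ideal.mem_span_singleton'.2 ⟨u, rfl⟩))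
      obtain ⟨j', hj', t', ht', h'⟩ := Submodule.mem_sup.1 hv
      obtain ⟨v', rfl⟩ := Ideal.mem_span_singleton'.1 ht'
      have h1 : u - v' * c ∈ J := hb _ (by
        have : b * (u - v' * c) = j + c * j' := by linear_combination -h - c * h'
        rw [this]
        exact J.add_mem hj (J.mul_mem_left _ hj'))
      have : u = (u - v' * c) + v' * c := by ring
      rw [this]
      exact Submodule.add_mem_sup h1 (Ideal.mem_span_singleton'.2 ⟨v', rfl⟩)
    have hcore : ¬ IsAss (J ⊔ Ideal.span {b}) (maximalIdeal R) := by
      rintro ⟨-, w, hw⟩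
      obtain ⟨j, hj, t, ht, h⟩ := Submodule.mem_sup.1 ((hw y).1 hym)
      obtain ⟨s, rfl⟩ := Ideal.mem_span_singleton'.1 ht
      have hs : s ∈ J ⊔ Ideal.span {y} := hy' s (by
        obtain ⟨j', hj', t', ht', h'⟩ := Submodule.mem_sup.1 ((hw y').1 hym')
        obtain ⟨s', rfl⟩ := Ideal.mem_span_singleton'.1 ht'
        have h1 : y' * s - s' * y ∈ J := hb _ (by
          have : b * (y' * s - s' * y) = y * j' - y' * j := by
            linear_combination y' * h - y * h'
          rw [this]
          exact J.sub_mem (J.mul_mem_left _ hj') (J.mul_mem_left _ hj))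
        have : y' * s = (y' * s - s' * y) + s' * y := by ring
        rw [this]
        exact Submodule.add_mem_sup h1 (Ideal.mem_span_singleton'.2 ⟨s', rfl⟩))
      obtain ⟨j', hj', t', ht', h'⟩ := Submodule.mem_sup.1 hs
      obtain ⟨s', rfl⟩ := Ideal.mem_span_singleton'.1 ht'
      have h1 : w - s' * b ∈ J := hy _ (by
        have : y * (w - s' * b) = j + b * j' := by linear_combination -h - b * h'
        rw [this]
        exact J.add_mem hj (J.mul_mem_left _ hj'))
      have h2 : w ∈ J ⊔ Ideal.span {b} := by
        have : w = (w - s' * b) + s' * b := by ring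
        rw [this]
        exact Submodule.add_mem_sup h1 (Ideal.mem_span_singleton'.2 ⟨s', rfl⟩)
      exact (maximalIdeal.isMaximal R).ne_top
        ((Ideal.eq_top_iff_one _).2 ((hw 1).2 (by simpa using h2)))
    obtain ⟨c, hcm, hc⟩ := exists_mem_forall_notMem (J := maximalIdeal R)
      (((finite_isAss J).union (finite_isAss (J ⊔ Ideal.span {y}))).union
        (finite_isAss (J ⊔ Ideal.span {b})))
      (by
        rintro P ((h | h) | h)
        · exact h.1
        · exact h.1
        · exact h.1)
      (by
        rintro P ((h | h) | h) hle
        · exact notMem_of_isAss hy h (hle hym)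
        · exact notMem_of_isAss hy' h (hle hym')
        · have := (maximalIdeal.isMaximal R).eq_of_le h.1.ne_top hle
          subst this
          exact hcore h)
    have hcJ := mem_of_mul_mem_of_isAss (K := J) fun P hP => hc P (Or.inl (Or.inl hP))
    have hcy := mem_of_mul_mem_of_isAss (K := J ⊔ Ideal.span {y})
      fun P hP => hc P (Or.inl (Or.inr hP))
    have hcb := mem_of_mul_mem_of_isAss (K := J ⊔ Ideal.span {b}) fun P hP => hc P (Or.inr hP)
    refine ⟨c, hcm, hcb, ?_⟩
    rw [sup_right_comm]
    refine ih ⟨y, hym, hswap hy hcy, ?_⟩ hbm (hswap hb hcb)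
    rw [sup_right_comm]
    exact ih hJ' hcm hcy

theorem DepthGe.le_coheight {k : ℕ} : ∀ {J : Ideal R}, DepthGe k J → ∀ {P : Ideal R}
    (hP : IsAss J P), (k : ℕ∞) ≤ Order.coheight (⟨P, hP.1⟩ : PrimeSpectrum R) := by
  induction k with
  | zero => simp
  | succ k ih =>
    rintro J ⟨y, hym, hy, hJ⟩ P hP
    obtain ⟨v, hv, hvm⟩ := exists_forall_mul_notMem_sup hP (le_maximalIdeal hP.1.ne_top) hym hy
    obtain ⟨P', hP', hle⟩ := exists_isAss_of_notMem (K := J ⊔ Ideal.span {y}) (w := v)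
      (by simpa using hvm 1 (fun h => (maximalIdeal.isMaximal R).ne_top
        ((Ideal.eq_top_iff_one _).2 h)))
    have hlt : (⟨P, hP.1⟩ : PrimeSpectrum R) < ⟨P', hP'.1⟩ := by
      refine lt_of_le_of_ne (fun q hq => hle q (Ideal.mem_sup_left (hv q hq))) fun h => ?_
      have h' : P = P' := congrArg PrimeSpectrum.asIdeal h
      exact notMem_of_isAss hy hP (h' ▸ hP'.le (Ideal.mem_sup_right
        (Ideal.mem_span_singleton_self y)))
    push_cast
    exact (add_le_add_left (ih hJ hP') 1).trans (Order.coheight_add_one_le hlt)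

theorem DepthGe.height_le {d k : ℕ} (hdim : ringKrullDim R = (d : WithBot ℕ∞)) {J : Ideal R}
    (hJ : DepthGe k J) {P : Ideal R} (hP : IsAss J P) : P.height + k ≤ d :=
  (add_le_add_right (hJ.le_coheight hP) _).trans (height_add_coheight_le hdim hP.1)

theorem exists_isAss_of_depthGe {d : ℕ} (hdim : ringKrullDim R = (d : WithBot ℕ∞)) {k : ℕ} :
    ∀ {j : ℕ} {J : Ideal R}, j + k = d → HeightGe j J → DepthGe k J → ∀ {Q : Ideal R}, Q.IsPrime →
      J ≤ Q → ∃ j' k' J', j' + k' = d ∧ HeightGe j' J' ∧ DepthGe k' J' ∧ IsAss J' Q := by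
  induction k with
  | zero =>
    intro j J hjk hH hD Q hQ hJQ
    obtain ⟨P, hP, hPQ⟩ := Ideal.exists_minimalPrimes_le hJQ
    have h1 := hH P hP.1.1 hP.1.2
    have h2 : Q.height ≤ d := le_self_add.trans (height_add_coheight_le hdim hQ)
    have := hP.1.1
    have : P = Q := Ideal.eq_of_le_of_height_le _ hPQ (h2.trans (by simpa [← hjk] using h1))
    subst this
    exact ⟨j, 0, J, hjk, hH, hD, isAss_of_mem_minimalPrimes hP⟩
  | succ k ih =>
    intro j J hjk hH hD Q hQ hJQ
    by_cases h : ∃ y ∈ Q, ∀ u, y * u ∈ J → u ∈ J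
    · obtain ⟨y, hyQ, hy⟩ := h
      exact ih (j := j + 1) (by omega) (hH.succ hy)
        (hD.exchange (le_maximalIdeal hQ.ne_top hyQ) hy) hQ
        (sup_le hJQ ((Ideal.span_singleton_le_iff_mem _).2 hyQ))
    · have h1 : ∃ P, IsAss J P ∧ Q ≤ P := by
        by_contra! h'
        obtain ⟨y, hyQ, hy⟩ := exists_mem_forall_notMem (finite_isAss J) (fun P hP => hP.1)
          (fun P hP => h' P hP)
        exact h ⟨y, hyQ, mem_of_mul_mem_of_isAss hy⟩
      obtain ⟨P, hP, hQP⟩ := h1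
      have h2 := hD.height_le hdim hP
      have h3 := hH Q hQ hJQ
      have := hP.1
      have h4 : P.height ≤ j := by
        rw [← hjk, Nat.cast_add] at h2
        exact (ENat.add_le_add_iff_right (ENat.natCast_ne_top _)).1 h2
      have : Q = P := Ideal.eq_of_le_of_height_le _ hQP (h4.trans h3)
      subst this
      exact ⟨j, k + 1, J, hjk, hH, hD, hP⟩

theorem height_le_height_add_one_of_covBy {d : ℕ} (hdim : ringKrullDim R = (d : WithBot ℕ∞))
    (hCM : DepthGe d (⊥ : Ideal R)) {Q P : Ideal R} (hQ : Q.IsPrime) (hP : P.IsPrime)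
    (hlt : Q < P) (hcov : ∀ P', P'.IsPrime → Q < P' → P' ≤ P → P' = P) :
    P.height ≤ Q.height + 1 := by
  obtain ⟨j, k, J, hjk, hH, hD, hA⟩ := exists_isAss_of_depthGe hdim (j := 0) (J := ⊥) (by simp)
    (fun _ _ _ => by simp) hCM hQ bot_le
  have hj : ∀ P, IsAss J P → P.height ≤ j := fun P hP => by
    have h2 := hD.height_le hdim hP
    rw [← hjk, Nat.cast_add] at h2
    exact (ENat.add_le_add_iff_right (ENat.natCast_ne_top _)).1 h2
  have hQj : Q.height = j := le_antisymm (hj Q hA) (hH Q hQ hA.le)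
  have hPj : (j : ℕ∞) + 1 ≤ P.height := by
    rw [← hQj]; exact Ideal.height_add_one_le_of_lt_of_isPrime hlt
  obtain ⟨y, hyP, hy⟩ := exists_mem_forall_notMem (J := P) (finite_isAss J) (fun P hP => hP.1)
    (fun P' hP' hle => by
      have h1 := (hPj.trans (Ideal.height_mono hle)).trans (hj P' hP')
      exact absurd h1 (by exact_mod_cast Nat.not_succ_le_self j))
  have hyJ := mem_of_mul_mem_of_isAss hy
  have hPd : P.height ≤ d := le_self_add.trans (height_add_coheight_le hdim hP)
  obtain ⟨k, rfl⟩ : ∃ k', k = k' + 1 := by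
    refine Nat.exists_eq_add_one.2 (Nat.pos_of_ne_zero ?_)
    rintro rfl
    have := hPj.trans hPd
    rw [← hjk] at this
    exact absurd this (by exact_mod_cast Nat.not_succ_le_self j)
  have hmin : P ∈ (Q ⊔ Ideal.span {y}).minimalPrimes := by
    refine ⟨⟨hP, sup_le hlt.le ((Ideal.span_singleton_le_iff_mem _).2 hyP)⟩, fun P' hP' hle => ?_⟩
    refine (hcov P' hP'.1 (lt_of_le_of_ne (le_sup_left.trans hP'.2) ?_) hle).ge
    rintro rfl
    exact hy Q hA (hP'.2 (Ideal.mem_sup_right (Ideal.mem_span_singleton_self y)))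
  have h3 := (hD.exchange (le_maximalIdeal hP.ne_top hyP) hyJ).height_le hdim
    (isAss_of_minimal_sup hA hmin hyJ)
  rw [← hjk, Nat.cast_add, Nat.cast_add, ← add_assoc, add_right_comm] at h3
  rw [hQj]
  exact (ENat.add_le_add_iff_right (ENat.natCast_ne_top _)).1 h3

theorem le_coheight_add_of_pow_le {n N : ℕ} {p : Ideal R} (hp : p.IsPrime) {s : Finset R}
    (hs : s.card ≤ n) (hsm : (s : Set R) ⊆ maximalIdeal R)
    (hN : maximalIdeal R ^ N ≤ p ⊔ Ideal.span (s : Set R)) :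
    Order.coheight (⟨p, hp⟩ : PrimeSpectrum R) ≤ n := by
  classical
  have h1 : (Order.coheight (⟨p, hp⟩ : PrimeSpectrum R) : WithBot ℕ∞) = ringKrullDim (R ⧸ p) := by
    rw [Order.coheight_eq_krullDim_Ici, ringKrullDim_quotient]
    rfl
  have : IsLocalRing (R ⧸ p) := .of_surjective' _ Ideal.Quotient.mk_surjective
  rw [← maximalIdeal_height_eq_ringKrullDim, WithBot.coe_inj] at h1
  rw [h1]
  refine le_trans (Ideal.height_le_card_of_mem_minimalPrimes_span_finset
    (s := s.image (Ideal.Quotient.mk p)) ⟨⟨inferInstance, ?_⟩, fun q hq _ => ?_⟩)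
    (by exact_mod_cast Finset.card_image_le.trans hs)
  · rw [Ideal.span_le, Finset.coe_image]
    rintro _ ⟨x, hx, rfl⟩
    have := IsLocalHom.of_surjective (Ideal.Quotient.mk p) Ideal.Quotient.mk_surjective
    exact map_nonunit (Ideal.Quotient.mk p) x (hsm hx)
  · have := hq.1
    have h2 : (maximalIdeal R).map (Ideal.Quotient.mk p) ^ N ≤ q := by
      rw [← Ideal.map_pow]
      refine (Ideal.map_mono hN).trans ?_
      rw [Ideal.map_sup, Ideal.map_quotient_self, bot_sup_eq, Ideal.map_span]
      simpa using hq.2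
    intro x hx
    obtain ⟨y, rfl⟩ := Ideal.Quotient.mk_surjective x
    refine Ideal.IsPrime.le_of_pow_le h2 (Ideal.mem_map_of_mem _ ?_)
    by_contra hy
    rw [mem_maximalIdeal, mem_nonunits_iff, not_not] at hy
    exact hx (hy.map _)

theorem le_height_add_of_pow_le {d : ℕ} (hdim : ringKrullDim R = (d : WithBot ℕ∞))
    (hCM : DepthGe d (⊥ : Ideal R)) {n N : ℕ} {p : Ideal R} (hp : p.IsPrime) {s : Finset R}
    (hs : s.card ≤ n) (hsm : (s : Set R) ⊆ maximalIdeal R)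
    (hN : maximalIdeal R ^ N ≤ p ⊔ Ideal.span (s : Set R)) : (d : ℕ∞) ≤ p.height + n := by
  obtain ⟨j, k, J, hjk, hH, hD, hA⟩ := exists_isAss_of_depthGe hdim (j := 0) (J := ⊥) (by simp)
    (fun _ _ _ => by simp) hCM hp bot_le
  rw [← hjk, Nat.cast_add]
  exact add_le_add (hH p hp hA.le) ((hD.le_coheight hA).trans
    (le_coheight_add_of_pow_le hp hs hsm hN))

end depth

section serre

variable {R : Type*} [CommRing R]

theorem mem_bot_of_mul_localization {p : Ideal R} [hp : p.IsPrime] {a : R}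
    (ha : ∀ u, a * u = 0 → u = 0) (u : Localization.AtPrime p)
    (hu : algebraMap R (Localization.AtPrime p) a * u = 0) : u = 0 := by
  obtain ⟨⟨r, s⟩, hrs⟩ := IsLocalization.surj p.primeCompl u
  have hun : IsUnit (algebraMap R (Localization.AtPrime p) s) :=
    IsLocalization.map_units (M := p.primeCompl) _ s
  dsimp only at hrs
  have h1 : algebraMap R (Localization.AtPrime p) (a * r) = algebraMap R _ 0 := by
    rw [map_mul, ← hrs, ← mul_assoc, hu, zero_mul, map_zero]
  rw [IsLocalization.eq_iff_exists p.primeCompl] at h1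
  obtain ⟨t, ht⟩ := h1
  have h2 : (t : R) * r = 0 := ha _ (by rw [mul_left_comm, ht, mul_zero])
  have h3 : algebraMap R (Localization.AtPrime p) r = algebraMap R _ 0 := by
    rw [IsLocalization.eq_iff_exists p.primeCompl]
    exact ⟨t, by rw [h2, mul_zero]⟩
  rw [h3, map_zero] at hrs
  exact hun.mul_left_eq_zero.1 hrs

open IsLocalRing

theorem IsAss.map_localization {K p : Ideal R} [hp : p.IsPrime] (h : IsAss K p) :
    IsAss (K.map (algebraMap R (Localization.AtPrime p)))
      (maximalIdeal (Localization.AtPrime p)) := by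
  obtain ⟨-, w, hw⟩ := h
  refine ⟨inferInstance, algebraMap _ _ w, fun y => ?_⟩
  obtain ⟨⟨r, s⟩, hrs⟩ := IsLocalization.surj p.primeCompl y
  have hu : IsUnit (algebraMap R (Localization.AtPrime p) s) :=
    IsLocalization.map_units (M := p.primeCompl) _ s
  rw [← Ideal.unit_mul_mem_iff_mem _ hu, ← Ideal.unit_mul_mem_iff_mem (K.map _) hu, ← mul_assoc,
    mul_comm _ y]
  dsimp only at hrs
  rw [hrs, ← map_mul, IsLocalization.AtPrime.to_map_mem_maximal_iff (Localization.AtPrime p) p]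
  refine ⟨fun h => Ideal.mem_map_of_mem _ ((hw r).1 h), fun h => ?_⟩
  obtain ⟨t, ht, htr⟩ := exists_notMem_mul_mem_of_map_le h
  exact (hp.mem_or_mem ((hw (t * r)).2 (by rwa [mul_assoc]))).resolve_left ht

variable [IsNoetherianRing R]

theorem SerreS2.height_lt_two (hS : SerreS2 R) {a : R} (ha : ∀ u, a * u = 0 → u = 0) {p : Ideal R}
    (hp : IsAss (Ideal.span {a}) p) : p.height < 2 := by
  by_contra! h
  have := hp.1
  obtain ⟨rs, hlen, hrs, hreg⟩ := hS ⟨p, hp.1⟩ 2 (by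
    rw [le_min_iff]
    refine ⟨le_rfl, ?_⟩
    dsimp only
    rw [IsLocalization.AtPrime.ringKrullDim_eq_height p]
    exact_mod_cast h)
  have hD := depthGe_of_isWeaklyRegular hrs hreg.toIsWeaklyRegular
  rw [hlen] at hD
  have ham : algebraMap R (Localization.AtPrime p) a ∈ maximalIdeal (Localization.AtPrime p) :=
    (IsLocalization.AtPrime.to_map_mem_maximal_iff _ p _).2
      (hp.le (Ideal.mem_span_singleton_self a))
  obtain ⟨y, hy, hyr, -⟩ := hD.exchange ham fun u hu => by
    rw [Ideal.mem_bot] at hu ⊢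
    exact mem_bot_of_mul_localization ha u hu
  have h1 := hp.map_localization
  rw [Ideal.map_span, Set.image_singleton, ← bot_sup_eq (Ideal.span _)] at h1
  exact notMem_of_isAss hyr h1 hy

theorem SerreS2.not_lt_lt {K : Ideal R} (hS : SerreS2 (R ⧸ K)) {a : R}
    (ha : ∀ u, a * u ∈ K → u ∈ K) {P : Ideal R} (hP : IsAss (K ⊔ Ideal.span {a}) P) {Q P' : Ideal R}
    (hQ : Q.IsPrime) (hP' : P'.IsPrime) (hK : K ≤ Q) (h1 : Q < P') (h2 : P' < P) : False := by
  have hmem : ∀ {J : Ideal R}, K ≤ J → ∀ x, Ideal.Quotient.mk K x ∈ J.map (Ideal.Quotient.mk K) ↔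
      x ∈ J := fun {J} hJ x => by
    rw [Ideal.mem_quotient_iff_mem hJ]
  have hprime : ∀ {J : Ideal R}, J.IsPrime → K ≤ J → (J.map (Ideal.Quotient.mk K)).IsPrime :=
    fun {J} hJ hKJ => Ideal.map_isPrime_of_surjective Ideal.Quotient.mk_surjective
      (by rwa [Ideal.mk_ker])
  have hlt : ∀ {J J' : Ideal R}, K ≤ J → J < J' →
      J.map (Ideal.Quotient.mk K) < J'.map (Ideal.Quotient.mk K) := by
    intro J J' hJ h
    refine lt_of_le_not_ge (Ideal.map_mono h.le) fun hle => h.not_ge fun x hx => ?_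
    exact (hmem hJ x).1 (hle (Ideal.mem_map_of_mem _ hx))
  have hKP' := hK.trans h1.le
  have hKP := hKP'.trans h2.le
  have hA : IsAss (Ideal.span {Ideal.Quotient.mk K a}) (P.map (Ideal.Quotient.mk K)) := by
    obtain ⟨hp, w, hw⟩ := hP
    refine ⟨hprime hp hKP, Ideal.Quotient.mk K w, fun y => ?_⟩
    obtain ⟨y, rfl⟩ := Ideal.Quotient.mk_surjective y
    have h3 : Ideal.span {Ideal.Quotient.mk K a} =
        (K ⊔ Ideal.span {a}).map (Ideal.Quotient.mk K) := by
      rw [Ideal.map_sup, Ideal.map_quotient_self, bot_sup_eq, Ideal.map_span, Set.image_singleton]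
    rw [hmem hKP, h3, ← map_mul, hmem le_sup_left, hw]
  have hlt2 := hS.height_lt_two (fun u hu => by
    obtain ⟨u, rfl⟩ := Ideal.Quotient.mk_surjective u
    rw [← map_mul, Ideal.Quotient.eq_zero_iff_mem] at hu
    exact Ideal.Quotient.eq_zero_iff_mem.2 (ha u hu)) hA
  have i1 := hprime hQ hK
  have i2 := hprime hP' hKP'
  have i3 := hA.1
  have h4 := Ideal.height_add_one_le_of_lt_of_isPrime (hlt hK h1)
  have h5 := Ideal.height_add_one_le_of_lt_of_isPrime (hlt hKP' h2)
  have h6 : (2 : ℕ∞) ≤ (P.map (Ideal.Quotient.mk K)).height := by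
    refine le_trans ?_ h5
    rw [← one_add_one_eq_two]
    exact add_le_add_left (le_trans (by simp) h4) 1
  exact absurd hlt2 h6.not_gt

end serre

section residual

variable {R : Type*} [CommRing R]

theorem colon_eq_colon_of_inf_le {A L I : Ideal R} (hAL : A ≤ L) (hLI : L ⊓ I ≤ A) :
    colonI L I = colonI A I := by
  refine le_antisymm (le_colon_iff.2 ?_) (Submodule.colon_mono hAL le_rfl)
  exact (le_inf (colon_mul_le L I) Ideal.mul_le_right).trans hLI

theorem HeightGe.le_idealHeight {n : ℕ} {J : Ideal R} (h : HeightGe n J) :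
    (n : ℕ∞) ≤ idealHeight J :=
  le_iInf₂ fun p hp => by
    rw [← PrimeSpectrum.height_eq_orderHeight]
    exact h _ p.2 hp

theorem idealHeight_le {J P : Ideal R} (hP : P.IsPrime) (h : J ≤ P) : idealHeight J ≤ P.height := by
  have := iInf₂_le (f := fun (p : PrimeSpectrum R) (_ : J ≤ p.asIdeal) => Order.height p) ⟨P, hP⟩ h
  rwa [← PrimeSpectrum.height_eq_orderHeight] at this

variable [IsNoetherianRing R]

theorem height_le_of_isAss_colon {L I P : Ideal R} {n : ℕ∞}
    (hL : ∀ P, IsAss L P → P.height ≤ n) (hP : IsAss (colonI L I) P) : P.height ≤ n := by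
  obtain ⟨hp, w, hw⟩ := hP
  obtain ⟨b, hb, hwb⟩ : ∃ b ∈ I, w * b ∉ L := by
    by_contra! h
    exact hp.ne_top ((Ideal.eq_top_iff_one _).2 ((hw 1).2 (by
      rw [one_mul]; exact mem_colon_ideal.2 h)))
  obtain ⟨P', hP', hle⟩ := exists_isAss_of_notMem hwb
  refine (Ideal.height_mono fun y hy => hle y ?_).trans (hL P' hP')
  rw [← mul_assoc]
  exact mem_colon_ideal.1 ((hw y).1 hy) b hb

theorem inf_colon_le_of_isAss {A L I : Ideal R} {n : ℕ} (hAL : A ≤ L) (hLI : L ⊓ I ≤ A)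
    (hL : ∀ P, IsAss L P → P.height ≤ n) (hG : HeightGe (n + 1) (I ⊔ colonI A I)) :
    I ⊓ colonI A I ≤ A := by
  intro u hu
  refine hLI ⟨?_, hu.1⟩
  by_contra huL
  obtain ⟨P, hP, hle⟩ := exists_isAss_of_notMem huL
  have h1 := hG P hP.1 (sup_le (fun b hb => hle b (hAL (by
    rw [mul_comm]; exact mem_colon_ideal.1 hu.2 b hb))) fun v hv => hle v (hAL
      (mem_colon_ideal.1 hv u hu.1)))
  exact absurd (h1.trans (hL P hP)) (by exact_mod_cast Nat.not_succ_le_self n)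

theorem mul_mem_colon_firstSpan {a : ℕ → R} {I : Ideal R} {i : ℕ}
    (hH : HeightGe (i + 1) (colonI (firstSpan a (i + 1)) I))
    (hG : HeightGe (i + 1) (I ⊔ colonI (firstSpan a i) I))
    (hA : ∀ P, IsAss (colonI (firstSpan a i) I) P → P.height ≤ i) :
    ∀ u, a i * u ∈ colonI (firstSpan a i) I → u ∈ colonI (firstSpan a i) I := by
  refine mem_of_mul_mem_of_isAss fun P hP ha => ?_
  have hlt : ¬ ((i + 1 : ℕ) : ℕ∞) ≤ P.height := fun h =>
    absurd (h.trans (hA P hP)) (by exact_mod_cast Nat.not_succ_le_self i)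
  have hIP : ¬ I ≤ P := fun h => hlt (hG P hP.1 (sup_le h hP.le))
  refine hlt (hH P hP.1 ?_)
  have h1 : colonI (firstSpan a (i + 1)) I * I ≤ P := by
    refine (colon_mul_le _ _).trans ?_
    rw [firstSpan_succ]
    exact sup_le ((le_colon_self _ _).trans hP.le) ((Ideal.span_singleton_le_iff_mem _).2 ha)
  exact (hP.1.mul_le.1 h1).resolve_right hIP

theorem colon_eq_of_forall_isAss {A I : Ideal R} (h : ∀ P, IsAss A P → ¬ I ≤ P) :
    colonI A I = A := by
  obtain ⟨b, hb, hbA⟩ := exists_mem_forall_notMem (finite_isAss A) (fun P hP => hP.1) h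
  refine le_antisymm (fun u hu => mem_of_mul_mem_of_isAss hbA u ?_) (le_colon_self _ _)
  rw [mul_comm]
  exact mem_colon_ideal.1 hu b hb

open IsLocalRing in
theorem residual_structure [IsLocalRing R] {d : ℕ} (hdim : ringKrullDim R = (d : WithBot ℕ∞))
    (hCM : DepthGe d (⊥ : Ideal R)) {I : Ideal R} (hI : I ≤ maximalIdeal R)
    (hS2 : WeaklyResiduallyS2 I (d - 2)) {a : ℕ → R} (ha : ∀ j < d, a j ∈ I)
    (hH : ∀ i ≤ d, HeightGe i (colonI (firstSpan a i) I))
    (hG : ∀ i < d, HeightGe (i + 1) (I ⊔ colonI (firstSpan a i) I)) : ∀ i < d,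
    (∀ P, IsAss (colonI (firstSpan a i) I) P → P.height ≤ i) ∧
      I ⊓ colonI (firstSpan a i) I ≤ firstSpan a i ∧
      ((i : ℕ∞) ≤ idealHeight I → DepthGe (d - i) (firstSpan a i)) := by
  have key : ∀ {A : Ideal R} {i : ℕ}, i ≤ d → DepthGe (d - i) A → ∀ P, IsAss A P →
      P.height ≤ i := by
    intro A i hi hD P hP
    have h := hD.height_le hdim hP
    have h' : (d : ℕ∞) = i + (d - i : ℕ) := by
      rw [← Nat.cast_add, Nat.add_sub_cancel' hi]
    rw [h'] at h
    exact (ENat.add_le_add_iff_right (ENat.natCast_ne_top _)).1 h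
  intro i
  induction i with
  | zero =>
    intro hd
    have h0 : ∀ P, IsAss (⊥ : Ideal R) P → P.height ≤ (0 : ℕ) :=
      key (Nat.zero_le d) (by simpa using hCM)
    rw [firstSpan_zero]
    refine ⟨fun P hP => height_le_of_isAss_colon h0 hP,
      inf_colon_le_of_isAss le_rfl inf_le_left h0 (by simpa using hG 0 hd), fun _ => by simpa using hCM⟩
  | succ i ih =>
    intro hd
    obtain ⟨hA, hInf, hD⟩ := ih (by omega)
    have hreg := mul_mem_colon_firstSpan (hH (i + 1) hd.le) (hG i (by omega)) hA
    have haI := ha i (by omega)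
    have haS : ∀ {n}, n ≤ d → firstSpan a n ≤ I := fun hn =>
      (firstSpan_le a).2 fun j hj => ha j (by omega)
    set K := colonI (firstSpan a i) I with hK
    have hAL : firstSpan a (i + 1) ≤ K ⊔ Ideal.span {a i} := by
      rw [firstSpan_succ]
      exact sup_le_sup_right (le_colon_self _ _) _
    have hLI : (K ⊔ Ideal.span {a i}) ⊓ I ≤ firstSpan a (i + 1) := by
      rintro u ⟨hu, huI⟩
      obtain ⟨v, hv, w, hw, rfl⟩ := Submodule.mem_sup.1 hu
      rw [firstSpan_succ]
      have hwI : w ∈ I := (Ideal.span_singleton_le_iff_mem I).2 haI hw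
      exact Submodule.add_mem_sup (hInf ⟨(I.add_mem_iff_left hwI).1 huI, hv⟩) hw
    have hlow : (i : ℕ∞) < idealHeight I →
        K = firstSpan a i ∧ DepthGe (d - (i + 1)) (firstSpan a (i + 1)) := by
      intro hi
      have h1 := hD hi.le
      have h2 : K = firstSpan a i := colon_eq_of_forall_isAss fun P hP hle =>
        (hi.trans_le (idealHeight_le hP.1 hle)).not_ge (key (by omega) h1 P hP)
      refine ⟨h2, ?_⟩
      rw [firstSpan_succ]
      refine DepthGe.exchange ?_ (hI haI) (h2 ▸ hreg)
      rwa [show d - (i + 1) + 1 = d - i by omega]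
    have hL : ∀ P, IsAss (K ⊔ Ideal.span {a i}) P → P.height ≤ (i + 1 : ℕ) := by
      intro P hP
      rcases lt_or_ge (i : ℕ∞) (idealHeight I) with hi | hi
      · obtain ⟨h1, h2⟩ := hlow hi
        rw [h1, ← firstSpan_succ] at hP
        exact key hd.le h2 P hP
      · have hS : SerreS2 (R ⧸ K) := by
          refine hS2 i hi (by omega) _ ⟨fun j => a j, ?_⟩ (haS (by omega))
            (hH i (by omega)).le_idealHeight ?_
          · rw [firstSpan]
            congr 1
            ext y
            simp [Fin.exists_iff]
          · exact_mod_cast (hG i (by omega)).le_idealHeight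
        have hPp := hP.1
        obtain ⟨Q, hQ, hQP⟩ := Ideal.exists_minimalPrimes_le (le_sup_left.trans hP.le)
        have hQA := isAss_of_mem_minimalPrimes hQ
        have haP : a i ∈ P := hP.le (Ideal.mem_sup_right (Ideal.mem_span_singleton_self _))
        have hlt : Q < P := lt_of_le_of_ne hQP fun h => notMem_of_isAss hreg hQA (h ▸ haP)
        refine (height_le_height_add_one_of_covBy hdim hCM hQ.1.1 hP.1 hlt
          fun P' hP' h1 h2 => ?_).trans (by push_cast; exact add_le_add_left (hA Q hQA) 1)
        by_contra hne
        exact hS.not_lt_lt hreg hP hQ.1.1 hP' hQ.1.2 h1 (lt_of_le_of_ne h2 hne)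
    refine ⟨fun P hP => ?_, inf_colon_le_of_isAss hAL hLI hL (hG (i + 1) hd), fun hi =>
      (hlow (lt_of_lt_of_le (by exact_mod_cast Nat.lt_succ_self i) hi)).2⟩
    rw [← colon_eq_colon_of_inf_le hAL hLI] at hP
    exact height_le_of_isAss_colon hL hP

end residual

section torsIn

variable {R : Type*} [CommRing R]

/-- The elements of `B` that some power of `𝔪` multiplies into `A`. -/
def torsIn (𝔪 A B : Ideal R) : Ideal R := B ⊓ ⨆ N : ℕ, colonI A (𝔪 ^ N)

theorem mem_torsIn {𝔪 A B : Ideal R} {u : R} :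
    u ∈ torsIn 𝔪 A B ↔ u ∈ B ∧ ∃ N, ∀ b ∈ 𝔪 ^ N, u * b ∈ A := by
  have hmono : Monotone fun N : ℕ => colonI A (𝔪 ^ N) := fun N N' h u hu => by
    rw [mem_colon_ideal] at hu ⊢
    exact fun b hb => hu b (Ideal.pow_le_pow_right h hb)
  rw [torsIn, Submodule.mem_inf, Submodule.mem_iSup_of_directed _ hmono.directed_le]
  simp only [mem_colon_ideal]

theorem torsIn_mono {𝔪 A A' B : Ideal R} (h : A ≤ A') : torsIn 𝔪 A B ≤ torsIn 𝔪 A' B := by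
  intro u hu
  rw [mem_torsIn] at hu ⊢
  exact ⟨hu.1, hu.2.imp fun N hN b hb => h (hN b hb)⟩

theorem relLen_torsIn_ne_top [IsNoetherianRing R] [IsLocalRing R] (A B : Ideal R) :
    relLen A (torsIn (IsLocalRing.maximalIdeal R) A B) ≠ ⊤ := by
  obtain ⟨e, he⟩ := exists_colon_pow_stable A (IsLocalRing.maximalIdeal R)
  refine relLen.ne_top_of_pow_mul_le (N := e) ?_
  rw [mul_comm, ← le_colon_iff]
  intro u hu
  obtain ⟨-, N, hN⟩ := mem_torsIn.1 hu
  exact he N (mem_colon_ideal.2 hN)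

end torsIn

section bound

variable {R : Type*} [CommRing R] {a : ℕ → R} {d : ℕ}

theorem firstSpan_inf_pow_le
    (ha : ∀ i < d, ∀ u ∈ firstSpan a d, a i * u ∈ firstSpan a i → u ∈ firstSpan a i)
    {j : ℕ} : ∀ {i : ℕ}, i + j = d → ∀ n,
      firstSpan a i ⊓ firstSpan a d ^ (n + 1) ≤ firstSpan a i * firstSpan a d ^ n := by
  induction j with
  | zero =>
    intro i hi n
    rw [Nat.add_zero] at hi
    subst hi
    rw [pow_succ']
    exact inf_le_right
  | succ j ih =>
    intro i hi n
    induction n with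
    | zero => simp
    | succ n ihn =>
      rintro u ⟨hu, huJ⟩
      obtain ⟨w, hw, v, hv, rfl⟩ := (mem_firstSpan_succ_mul a).1
        (ih (i := i + 1) (by omega) (n + 1) ⟨firstSpan_mono a (Nat.le_succ i) hu, huJ⟩)
      refine Submodule.add_mem _ hw ?_
      have h1 : a i * v ∈ firstSpan a i :=
        ((firstSpan a i).add_mem_iff_right (Ideal.mul_le_left hw)).1 hu
      have h2 : v ∈ firstSpan a i := ha i (by omega) v (Ideal.pow_le_self (Nat.succ_ne_zero n) hv) h1
      have h3 := Ideal.mul_mem_mul (mem_firstSpan a (show i < d by omega)) (ihn ⟨h2, hv⟩)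
      rw [mul_left_comm, ← pow_succ'] at h3
      exact h3

theorem mem_of_mul_mem_pow_sup
    (ha : ∀ i < d, ∀ u ∈ firstSpan a d, a i * u ∈ firstSpan a i → u ∈ firstSpan a i)
    {i : ℕ} (hi : i < d) {n : ℕ} {u : R} (hu : u ∈ firstSpan a d)
    (h : a i * u ∈ firstSpan a d ^ (n + 2) ⊔ firstSpan a i) :
    u ∈ firstSpan a d ^ (n + 1) ⊔ firstSpan a i := by
  obtain ⟨v, hv, w, hw, hvw⟩ := Submodule.mem_sup.1 h
  have h1 : v ∈ firstSpan a (i + 1) := by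
    have : v = a i * u - w := by rw [← hvw]; ring
    rw [this]
    exact sub_mem (Ideal.mul_mem_right _ _ (mem_firstSpan a (Nat.lt_succ_self i)))
      (firstSpan_mono a (Nat.le_succ i) hw)
  obtain ⟨w', hw', v', hv', rfl⟩ := (mem_firstSpan_succ_mul a).1
    (firstSpan_inf_pow_le ha (i := i + 1) (j := d - (i + 1)) (by omega) (n + 1) ⟨h1, hv⟩)
  have h2 : u - v' ∈ firstSpan a i := by
    refine ha i hi _ (sub_mem hu (Ideal.pow_le_self (Nat.succ_ne_zero n) hv')) ?_
    have : a i * (u - v') = w' + w := by linear_combination -hvw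
    rw [this]
    exact add_mem (Ideal.mul_le_left hw') hw
  have : u = v' + (u - v') := by ring
  rw [this]
  exact Submodule.add_mem_sup hv' h2

theorem relLen_torsIn_succ_le
    (ha : ∀ i < d, ∀ u ∈ firstSpan a d, a i * u ∈ firstSpan a i → u ∈ firstSpan a i) (𝔪 : Ideal R)
    {i : ℕ} (hi : i < d) {n : ℕ} (hn : n ≠ 0) :
    relLen (firstSpan a d ^ (n + 2) ⊔ firstSpan a i)
        (torsIn 𝔪 (firstSpan a d ^ (n + 2) ⊔ firstSpan a i) (firstSpan a d ^ (n + 1))) ≤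
      relLen (firstSpan a d ^ (n + 1) ⊔ firstSpan a i)
        (torsIn 𝔪 (firstSpan a d ^ (n + 1) ⊔ firstSpan a i) (firstSpan a d ^ n)) +
      relLen (firstSpan a d ^ (n + 2) ⊔ firstSpan a (i + 1))
        (torsIn 𝔪 (firstSpan a d ^ (n + 2) ⊔ firstSpan a (i + 1)) (firstSpan a d ^ (n + 1))) := by
  set J := firstSpan a d with hJ
  set T := torsIn 𝔪 (J ^ (n + 1) ⊔ firstSpan a i) (J ^ n) with hT
  have haJ : a i ∈ J := mem_firstSpan a hi
  have hmul : ∀ u ∈ J ^ (n + 1) ⊔ firstSpan a i, a i * u ∈ J ^ (n + 2) ⊔ firstSpan a i := by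
    intro u hu
    obtain ⟨v, hv, w, hw, rfl⟩ := Submodule.mem_sup.1 hu
    rw [mul_add]
    refine Submodule.add_mem_sup ?_ (Ideal.mul_mem_left _ _ hw)
    rw [pow_succ' J (n + 1)]
    exact Ideal.mul_mem_mul haJ hv
  have hTJ : ∀ u ∈ T, u ∈ J := fun u hu => Ideal.pow_le_self hn (mem_torsIn.1 hu).1
  have h1 : relLen (J ^ (n + 2) ⊔ firstSpan a i) (Ideal.span {a i} * T) =
      relLen (J ^ (n + 1) ⊔ firstSpan a i) T :=
    relLen.mul_left_le (a i) fun u hu =>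
      ⟨fun h => mem_of_mul_mem_pow_sup ha hi (hTJ u hu) h, hmul u⟩
  refine (relLen.le_add _ ((J ^ (n + 2) ⊔ firstSpan a i) ⊔ Ideal.span {a i} * T) _).trans ?_
  rw [relLen.sup_right, h1]
  refine add_le_add le_rfl ?_
  have hle : J ^ (n + 2) ⊔ firstSpan a i ≤ J ^ (n + 2) ⊔ firstSpan a (i + 1) :=
    sup_le_sup_left (firstSpan_mono a (Nat.le_succ i)) _
  refine le_trans (le_of_eq ?_) (relLen.mono_right (torsIn_mono hle))
  refine relLen.congr_left (le_antisymm (inf_le_inf_right _ (sup_le hle ?_)) (le_inf ?_ inf_le_right))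
  · refine Ideal.mul_le_left.trans (le_sup_of_le_right ?_)
    rw [Ideal.span_singleton_le_iff_mem]
    exact mem_firstSpan a (Nat.lt_succ_self i)
  · rintro u ⟨huB, huT⟩
    obtain ⟨huJ, N, hN⟩ := mem_torsIn.1 huT
    obtain ⟨v, hv, w, hw, rfl⟩ := Submodule.mem_sup.1 huB
    have h2 : w ∈ J ^ (n + 1) :=
      ((J ^ (n + 1)).add_mem_iff_right (Ideal.pow_le_pow_right (by omega) hv)).1 huJ
    obtain ⟨w', hw', s, hs, rfl⟩ := (mem_firstSpan_succ_mul a).1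
      (firstSpan_inf_pow_le ha (i := i + 1) (j := d - (i + 1)) (by omega) n ⟨hw, h2⟩)
    have hsT : s ∈ T := by
      refine mem_torsIn.2 ⟨hs, N, fun b hb => ?_⟩
      refine mem_of_mul_mem_pow_sup ha hi (J.mul_mem_right _ (Ideal.pow_le_self hn hs)) ?_
      have : a i * (s * b) = (v + (w' + a i * s)) * b - (v * b + w' * b) := by ring
      rw [this]
      exact sub_mem (hN b hb) (Submodule.add_mem_sup (Ideal.mul_mem_right _ _ hv)
        (Ideal.mul_mem_right _ _ (Ideal.mul_le_left hw')))
    rw [← add_assoc]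
    refine Submodule.add_mem_sup (Submodule.add_mem_sup hv (Ideal.mul_le_left hw')) ?_
    exact Ideal.mul_mem_mul (Ideal.mem_span_singleton_self _) hsT

theorem relLen_pow_le {k : ℕ} {K : Ideal R}
    (hK : K * firstSpan a (k + 1) ≤ firstSpan a k) {n : ℕ} (hn : n ≠ 0) :
    relLen (firstSpan a (k + 1) ^ (n + 1) ⊔ firstSpan a k) (firstSpan a (k + 1) ^ n) ≤
      relLen (K ⊔ Ideal.span {a k}) ⊤ := by
  set J := firstSpan a (k + 1) with hJ
  have haJ : a k ∈ J := mem_firstSpan a (Nat.lt_succ_self k)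
  have h1 : J ^ n ≤ firstSpan a k ⊔ Ideal.span {a k ^ n} := by
    rw [hJ, firstSpan_succ, ← Ideal.span_singleton_pow]
    exact sup_pow_le_sup_pow _ _ n
  set A' := J ^ (n + 1) ⊔ firstSpan a k with hA'
  have h2 : relLen A' (Ideal.span {a k ^ n} * ⊤) =
      relLen (colonI A' (Ideal.span {a k ^ n})) ⊤ := by
    refine relLen.mul_left_le _ fun u _ => ?_
    rw [mem_colon_ideal]
    refine ⟨fun h b hb => ?_, fun h => ?_⟩
    · obtain ⟨c, rfl⟩ := Ideal.mem_span_singleton'.1 hb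
      have : u * (c * a k ^ n) = c * (a k ^ n * u) := by ring
      rw [this]
      exact Ideal.mul_mem_left _ _ h
    · rw [mul_comm]
      exact h _ (Ideal.mem_span_singleton_self _)
  calc relLen A' (J ^ n) ≤ relLen A' (A' ⊔ Ideal.span {a k ^ n} * ⊤) := by
        refine relLen.mono_right (h1.trans ?_)
        rw [Ideal.mul_top]
        exact sup_le_sup_right le_sup_right _
    _ = relLen (colonI A' (Ideal.span {a k ^ n})) ⊤ := by rw [relLen.sup_right, h2]
    _ ≤ _ := by
        refine relLen.anti_left (sup_le ?_ ?_)
        · rw [le_colon_iff]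
          refine le_trans (Ideal.mul_mono_right ?_) (hK.trans le_sup_right)
          rw [Ideal.span_singleton_le_iff_mem]
          exact Ideal.pow_le_self hn (Ideal.pow_mem_pow haJ n)
        · rw [le_colon_iff, Ideal.span_singleton_mul_span_singleton, ← pow_succ',
            Ideal.span_singleton_le_iff_mem]
          exact Ideal.mem_sup_left (Ideal.pow_mem_pow haJ (n + 1))

theorem le_of_tendsto_length [IsNoetherianRing R] [IsLocalRing R] {k : ℕ}
    (ha : ∀ i < k + 1, ∀ u ∈ firstSpan a (k + 1), a i * u ∈ firstSpan a i → u ∈ firstSpan a i)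
    {K : Ideal R} (hK : K * firstSpan a (k + 1) ≤ firstSpan a k) {r : ℕ}
    (hr : relLen (K ⊔ Ideal.span {a k}) ⊤ = r) {L : ℝ}
    (hL : Tendsto (fun n : ℕ => (k.factorial : ℝ) / (n : ℝ) ^ k *
      ((mLength R (H0 (IsLocalRing.maximalIdeal R)
        (gradedPiece (firstSpan a (k + 1)) (M := R) n))).toNat : ℝ)) atTop (nhds L)) :
    L ≤ r := by
  set J := firstSpan a (k + 1) with hJ
  set 𝔪 := IsLocalRing.maximalIdeal R
  have hfin : ∀ i n, relLen (J ^ (n + 1) ⊔ firstSpan a i)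
      (torsIn 𝔪 (J ^ (n + 1) ⊔ firstSpan a i) (J ^ n)) ≠ ⊤ :=
    fun i n => relLen_torsIn_ne_top _ _
  refine le_of_tendsto_of_differences (k := k) (n₀ := 1)
    (fun i n => (relLen (J ^ (n + 1) ⊔ firstSpan a i)
      (torsIn 𝔪 (J ^ (n + 1) ⊔ firstSpan a i) (J ^ n))).toNat) ?_ ?_ ?_
  · intro n hn
    have h1 := (relLen.mono_right (inf_le_left : torsIn 𝔪 (J ^ (n + 1) ⊔ firstSpan a k) (J ^ n) ≤
      J ^ n)).trans (relLen_pow_le hK (n := n) (by omega))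
    rw [hr] at h1
    exact ENat.toNat_le_of_le_natCast h1
  · intro i hi n hn
    have h1 := relLen_torsIn_succ_le ha 𝔪 (i := i) (by omega) (n := n) (by omega)
    rw [← ENat.natCast_le_natCast, Nat.cast_add, ENat.natCast_toNat (hfin _ _),
      ENat.natCast_toNat (hfin _ _), ENat.natCast_toNat (hfin _ _)]
    exact h1
  · refine hL.congr fun n => ?_
    rw [mLength_H0_gradedPiece, firstSpan_zero, sup_bot_eq]
    rfl

end bound

section assembly

open IsLocalRing

variable {R : Type*} [CommRing R]

theorem HeightGe.mono {j : ℕ} {A B : Ideal R} (h : HeightGe j A) (hAB : A ≤ B) : HeightGe j B :=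
  fun q hq hBq => h q hq (hAB.trans hBq)

theorem map_colonI_le {A S : Type*} [CommRing A] [CommRing S] (f : A →+* S) (J K : Ideal A) :
    (colonI J K).map f ≤ colonI (J.map f) (K.map f) := by
  rw [le_colon_iff, ← Ideal.map_mul]
  exact Ideal.map_mono (colon_mul_le _ _)

theorem eval_genElt_mem {m d : ℕ} (x : Fin m → R) (c : Fin d × Fin m → R) (j : ℕ) :
    MvPolynomial.eval c (genElt d x j) ∈ Ideal.span (Set.range x) := by
  have h := Ideal.mem_map_of_mem (MvPolynomial.eval c) (genElt_mem (d := d) (x := x) j)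
  rwa [map_C_map_eval] at h

theorem eval_genElt {m d : ℕ} (x : Fin m → R) (c : Fin d × Fin m → R) {j : ℕ} (hj : j < d) :
    MvPolynomial.eval c (genElt d x j) = ∑ l, c (⟨j, hj⟩, l) * x l := by
  simp [genElt, hj]

theorem span_range_fin {k : ℕ} {a : ℕ → R} {b : Fin k → R} (h : ∀ j, b j = a j) :
    Ideal.span (Set.range b) = firstSpan a k := by
  rw [firstSpan]
  congr 1
  ext y
  constructor
  · rintro ⟨j, rfl⟩
    exact ⟨j, j.2, (h j).symm⟩
  · rintro ⟨j, hj, rfl⟩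
    exact ⟨⟨j, hj⟩, h ⟨j, hj⟩⟩

variable [IsLocalRing R]

theorem ForGeneral.generalElts {I : Ideal R} {i : ℕ} {P : (Fin i → R) → Prop}
    (h : ∀ (m : ℕ) (x : Fin m → R), Ideal.span (Set.range x) = I →
      ForGeneral fun c : Fin i × Fin m → R => P fun j => ∑ l, c (j, l) * x l) :
    GeneralElts (maximalIdeal R) I i P := by
  intro m x hx
  obtain ⟨F, hF, h⟩ := h m x hx
  refine ⟨F, fun h0 => hF ?_, fun c hc => h c fun hm => hc ?_⟩
  · rw [MvPolynomial.mem_map_C_iff]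
    intro n
    rw [← Ideal.Quotient.eq_zero_iff_mem, ← MvPolynomial.coeff_map, h0, MvPolynomial.coeff_zero]
  · have h1 : MvPolynomial.eval (fun p => Ideal.Quotient.mk (maximalIdeal R) (c p))
        (MvPolynomial.map (Ideal.Quotient.mk (maximalIdeal R)) F) =
        Ideal.Quotient.mk (maximalIdeal R) (MvPolynomial.eval c F) := by
      rw [MvPolynomial.eval_map]
      exact (MvPolynomial.eval₂_comp_left (Ideal.Quotient.mk (maximalIdeal R)) (RingHom.id R)
        c F).symm
    rw [h1, Ideal.Quotient.eq_zero_iff_mem]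
    exact hm

theorem maximalIdeal_height_le {d : ℕ} (hdim : ringKrullDim R = (d : WithBot ℕ∞)) :
    (maximalIdeal R).height ≤ (d : ℕ∞) := by
  have h := IsLocalRing.maximalIdeal_height_eq_ringKrullDim (R := R)
  rw [hdim] at h
  exact le_of_eq (by exact_mod_cast h)

theorem depthGe_of_isCMLocalRing {d : ℕ} (hdim : ringKrullDim R = (d : WithBot ℕ∞))
    (h : IsCMLocalRing R) : DepthGe d (⊥ : Ideal R) := by
  obtain ⟨rs, hm, hreg, hlen⟩ := h
  rw [hdim] at hlen
  have h1 : rs.length = d := by exact_mod_cast hlen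
  exact h1 ▸ depthGe_of_isWeaklyRegular hm hreg.toIsWeaklyRegular

variable [IsNoetherianRing R]

/-- The normalized length whose limit is the `j`-multiplicity in dimension `k + 1`. -/
def jSeq (I : Ideal R) (k n : ℕ) : ℝ :=
  (k.factorial : ℝ) / (n : ℝ) ^ k *
    ((mLength R (H0 (maximalIdeal R) (gradedPiece I (M := R) n))).toNat : ℝ)

theorem exists_tendsto_jSeq {k n₁ : ℕ} (hdim : ringKrullDim R = ((k + 1 : ℕ) : WithBot ℕ∞))
    {I J : Ideal R} (hI : I ≤ maximalIdeal R) (hJI : J ≤ I)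
    (hJ : ∀ n ≥ n₁, I ^ (n + 1) ≤ J * I ^ n) :
    ∃ r : ℕ, Tendsto (jSeq I k) atTop (nhds (r : ℝ)) ∧ Tendsto (jSeq J k) atTop (nhds (r : ℝ)) := by
  obtain ⟨m, x, hx⟩ := Submodule.fg_iff_exists_fin_generating_family.1 (IsNoetherian.noetherian J)
  change Ideal.span (Set.range x) = J at hx
  subst hx
  obtain ⟨e, K, hK, hsat, hnzd⟩ := exists_saturation x (Nat.lt_succ_self k)
  have hfin := relLen_saturation_ne_top (maximalIdeal_height_le hdim)
    (hK ▸ le_colon_self _ _) (fun u hu => hsat 1 u (by rwa [pow_one])) hnzd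
  obtain ⟨r, hr⟩ := ENat.ne_top_iff_exists.1 hfin
  exact ⟨r, (tendsto_and_exists_pow_succ_eq hI hJI hJ hK hnzd rfl hr.symm).1,
    (tendsto_and_exists_pow_succ_eq (n₁ := 0) (hJI.trans hI) le_rfl
      (fun n _ => (pow_succ' (Ideal.span (Set.range x)) n).le) hK hnzd rfl hr.symm).1⟩

theorem forGeneral_heightGe {m d : ℕ} (hdim : ringKrullDim R = (d : WithBot ℕ∞))
    (hCM : DepthGe d (⊥ : Ideal R)) {i : ℕ} (hi : i ≤ d)
    {B : Ideal (MvPolynomial (Fin d × Fin m) R)}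
    (h : ∀ q : Ideal (MvPolynomial (Fin d × Fin m) R), q.IsPrime → B ≤ q → (i : ℕ∞) ≤ q.height) :
    ForGeneral fun c : Fin d × Fin m → R => HeightGe i (B.map (MvPolynomial.eval c)) := by
  have hd : (d : ℕ∞) = i + (d - i : ℕ) := by rw [← Nat.cast_add, Nat.add_sub_cancel' hi]
  refine (forGeneral_exists_finset (d - i) B fun q hq hBq => ?_).mono ?_
  · refine (height_map_C_le.trans (maximalIdeal_height_le hdim)).trans ?_
    rw [hd]
    exact add_le_add (h q hq hBq) le_rfl
  · rintro c ⟨s, hs, hsm, N, hN⟩ p hp hBp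
    have h1 := le_height_add_of_pow_le hdim hCM hp hs hsm (hN.trans (sup_le_sup_right hBp _))
    rw [hd] at h1
    exact (ENat.add_le_add_iff_right (ENat.natCast_ne_top _)).1 h1

theorem relLen_residual_eq {k n₁ e r : ℕ} (hdim : ringKrullDim R = ((k + 1 : ℕ) : WithBot ℕ∞))
    (hCM : DepthGe (k + 1) (⊥ : Ideal R)) {I : Ideal R} (hI : I ≤ maximalIdeal R)
    (hS2 : WeaklyResiduallyS2 I (k + 1 - 2)) {a : ℕ → R} (ha : ∀ j, a j ∈ I)
    (hH : ∀ i < k + 2, HeightGe i (colonI (firstSpan a i) I))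
    (hG : ∀ i < k + 1, HeightGe (i + 1) (I ⊔ colonI (firstSpan a i) I))
    (hlim : Tendsto (jSeq I k) atTop (nhds (r : ℝ)))
    (hr : relLen (colonI (firstSpan a k) (I ^ e) ⊔ Ideal.span {a k}) ⊤ ≤ r)
    (hred : ∀ n ≥ n₁, I ^ (n + 1) ≤ firstSpan a (k + 1) * I ^ n) :
    relLen (colonI (firstSpan a k) I ⊔ Ideal.span {a k}) ⊤ = r := by
  have hres := residual_structure hdim hCM hI hS2 (fun j _ => ha j)
    (fun i hi => hH i (by omega)) hG
  have hJI : firstSpan a (k + 1) ≤ I := (firstSpan_le a).2 fun j _ => ha j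
  have hcol : colonI (colonI (firstSpan a k) I) I = colonI (firstSpan a k) I := by
    refine colon_eq_of_forall_isAss fun P hP hIP => ?_
    have h1 := (hG k (by omega) P hP.1 (sup_le hIP hP.le)).trans ((hres k (by omega)).1 P hP)
    exact absurd h1 (by exact_mod_cast Nat.not_succ_le_self k)
  have hpow : ∀ n, colonI (firstSpan a k) (I ^ n) ≤ colonI (firstSpan a k) I := by
    intro n
    induction n with
    | zero =>
      refine le_trans ?_ (le_colon_self _ _)
      rw [pow_zero, Ideal.one_eq_top]
      intro u hu
      simpa using mem_colon_ideal.1 hu 1 trivial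
    | succ n ih =>
      refine le_trans ?_ hcol.le
      refine le_colon_iff.2 (le_trans (le_colon_iff.2 ?_) ih)
      rw [mul_assoc, ← pow_succ']
      exact colon_mul_le _ _
  have hle := (relLen.anti_left (B := ⊤) (sup_le_sup_right (hpow e) (Ideal.span {a k}))).trans hr
  obtain ⟨r', hr'⟩ := ENat.ne_top_iff_exists.1 (ne_of_lt (hle.trans_lt (ENat.natCast_lt_top r)))
  obtain ⟨s, hsI, hsJ⟩ := exists_tendsto_jSeq hdim hI hJI hred
  have hsr : (s : ℝ) = r := tendsto_nhds_unique hsI hlim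
  rw [hsr] at hsJ
  have h1 : (r : ℝ) ≤ r' := by
    refine le_of_tendsto_length (K := colonI (firstSpan a k) I) ?_ ?_ hr'.symm hsJ
    · intro i hi u hu hau
      refine (hres i hi).2.1 ⟨hJI hu, ?_⟩
      exact mul_mem_colon_firstSpan (hH (i + 1) (by omega)) (hG i hi) (hres i hi).1 u
        (le_colon_self _ _ hau)
    · exact (Ideal.mul_mono_right hJI).trans (colon_mul_le _ _)
  refine le_antisymm hle ?_
  rw [← hr']
  exact_mod_cast h1

theorem forGeneral_relLen_residual_eq {k m : ℕ} {x : Fin m → R}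
    (hdim : ringKrullDim R = ((k + 1 : ℕ) : WithBot ℕ∞)) (hCM : DepthGe (k + 1) (⊥ : Ideal R))
    (hI : Ideal.span (Set.range x) ≤ maximalIdeal R)
    (hG : SatisfiesG (Ideal.span (Set.range x)) (k + 1))
    (hS2 : WeaklyResiduallyS2 (Ideal.span (Set.range x)) (k + 1 - 2)) :
    ∃ r : ℕ, Tendsto (jSeq (Ideal.span (Set.range x)) k) atTop (nhds (r : ℝ)) ∧
      ForGeneral fun c : Fin (k + 1) × Fin m → R =>
        relLen (colonI (firstSpan (fun j => MvPolynomial.eval c (genElt (k + 1) x j)) k)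
          (Ideal.span (Set.range x)) ⊔
          Ideal.span {MvPolynomial.eval c (genElt (k + 1) x k)}) ⊤ = r := by
  set I := Ideal.span (Set.range x) with hIx
  obtain ⟨e, K, hK, hsat, hnzd⟩ := exists_saturation x (Nat.lt_succ_self k)
  have hfin := relLen_saturation_ne_top (maximalIdeal_height_le hdim)
    (hK ▸ le_colon_self _ _) (fun u hu => hsat 1 u (by rwa [pow_one])) hnzd
  obtain ⟨r, hr⟩ := ENat.ne_top_iff_exists.1 hfin
  obtain ⟨hlim, n₂, hn₂⟩ := tendsto_and_exists_pow_succ_eq (n₁ := 0) hI le_rfl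
    (fun n _ => (pow_succ' I n).le) hK hnzd rfl hr.symm
  have hH : ForGeneral fun c : Fin (k + 1) × Fin m → R => ∀ i < k + 2, HeightGe i
      (colonI (firstSpan (fun j => MvPolynomial.eval c (genElt (k + 1) x j)) i) I) := by
    refine ForGeneral.forall_lt fun i hi => ?_
    refine (forGeneral_heightGe hdim hCM (by omega)
      fun q hq h => le_height_of_colon_le hG (by omega : i ≤ k + 1) q h).mono fun c hc => ?_
    refine hc.mono ((map_colonI_le _ _ _).trans ?_)
    rw [map_C_map_eval, map_eval_firstSpan]
  have hG' : ForGeneral fun c : Fin (k + 1) × Fin m → R => ∀ i < k + 1, HeightGe (i + 1)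
      (I ⊔ colonI (firstSpan (fun j => MvPolynomial.eval c (genElt (k + 1) x j)) i) I) := by
    refine ForGeneral.forall_lt fun i hi => ?_
    refine (forGeneral_heightGe (B := I.map MvPolynomial.C ⊔
      colonI (firstSpan (genElt (k + 1) x) i) (I.map MvPolynomial.C)) hdim hCM
      (by omega : i + 1 ≤ k + 1) fun q hq h => ?_).mono fun c hc => ?_
    · refine le_trans ?_ (add_one_le_height_of_colon_le hG hi.le q (le_sup_left.trans h)
        (le_sup_right.trans h))
      exact le_min (by exact_mod_cast hi) le_rfl
    · refine hc.mono ?_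
      rw [Ideal.map_sup, map_C_map_eval]
      refine sup_le_sup_left ((map_colonI_le _ _ _).trans ?_) _
      rw [map_C_map_eval, map_eval_firstSpan]
  have hlen := forGeneral_relLen_le (K ⊔ Ideal.span {genElt (k + 1) x k})
    (by rwa [Ideal.map_sup, Ideal.map_span, Set.image_singleton])
  have hred := forGeneral_map_le (A := (I ^ (n₂ + 1)).map MvPolynomial.C)
    (B := firstSpan (genElt (k + 1) x) (k + 1) *
      (I ^ n₂).map (MvPolynomial.C (σ := Fin (k + 1) × Fin m))) (by
    rw [Ideal.map_mul, map_firstSpan, Ideal.map_pow, Ideal.map_pow, Ideal.map_pow, Ideal.map_pow]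
    exact (hn₂ n₂ le_rfl).le)
  refine ⟨r, hlim, ((hH.and hG').and (hlen.and hred)).mono ?_⟩
  rintro c ⟨⟨h1, h2⟩, h3, h4⟩
  rw [map_C_map_eval, Ideal.map_mul, map_C_map_eval, map_eval_firstSpan] at h4
  refine relLen_residual_eq (n₁ := n₂) (e := e) hdim hCM hI hS2 (eval_genElt_mem x c) h1 h2 hlim ?_
    fun n hn => ?_
  · rw [Ideal.map_sup, Ideal.map_sup, Ideal.map_span, Ideal.map_span, Set.image_singleton,
      Set.image_singleton, ← hr] at h3
    refine (relLen.anti_left (sup_le_sup_right ?_ _)).trans h3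
    rw [hK]
    refine (map_colonI_le _ _ _).trans ?_
    rw [Ideal.map_pow, map_C_map_eval, map_eval_firstSpan]
  · obtain ⟨t, rfl⟩ := Nat.exists_eq_add_of_le hn
    have h5 := Ideal.mul_mono_left (K := I ^ t) h4
    rwa [mul_assoc, ← pow_add, ← pow_add, add_right_comm] at h5

end assembly

/-- Corollary 3b: if `R` is Cohen–Macaulay of dimension `d`, `I` satisfies `G_d` and is
weakly `(d−2)`-residually `S_2`, then for general elements `a₁, …, a_d` of `I`,
`j(I) = length_R (R/(((a₁, …, a_{d−1}) :_R I) + a_d R))`. -/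
theorem stmt_13 {R : Type*} [CommRing R] [IsNoetherianRing R] [IsLocalRing R]
    (hres : Infinite (IsLocalRing.ResidueField R))
    (d : ℕ) (hd : 0 < d) (hdim : ringKrullDim R = (d : WithBot ℕ∞))
    (hCM : IsCMLocalRing R)
    (I : Ideal R) (hI : I ≠ ⊤)
    (hG : SatisfiesG I d) (hS2 : WeaklyResiduallyS2 I (d - 2)) :
    GeneralElts (IsLocalRing.maximalIdeal R) I d fun a =>
      jMult (IsLocalRing.maximalIdeal R) I R d =
        ((mLength R (R ⧸ (Submodule.colon
            (Ideal.span (Set.range fun j : Fin (d - 1) =>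
              a (Fin.castLE (Nat.sub_le d 1) j))) I ⊔
          Ideal.span {a ⟨d - 1, Nat.sub_lt hd Nat.one_pos⟩}))).toNat : ℝ) := by
  obtain ⟨k, rfl⟩ := Nat.exists_eq_succ_of_ne_zero hd.ne'
  refine ForGeneral.generalElts fun m x hx => ?_
  subst hx
  obtain ⟨r, hlim, hr⟩ := forGeneral_relLen_residual_eq hdim (depthGe_of_isCMLocalRing hdim hCM)
    (IsLocalRing.le_maximalIdeal hI) hG hS2
  refine hr.mono fun c hc => ?_
  have hj : jMult (IsLocalRing.maximalIdeal R) (Ideal.span (Set.range x)) R (k + 1) = r :=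
    hlim.limUnder_eq
  rw [hj, mLength_eq, relLen.top_right]
  rw [← span_range_fin (b := fun j : Fin k => ∑ l, c (⟨j, Nat.lt_succ_of_lt j.2⟩, l) * x l)
    (fun j => (eval_genElt x c (Nat.lt_succ_of_lt j.2)).symm),
    eval_genElt x c (Nat.lt_succ_self k)] at hc
  exact (congrArg (fun t : ℕ∞ => (t.toNat : ℝ)) hc).symm

end
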